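/- Let R be a commutative noetherian ring of finite Krull dimension and C a semidualizing R-module, and let n ≥ 1. Then G^n(F_C^cot(R)) = GF_C(R) ∩ B_C(R) ∩ F_C(R)^⊥; that is, an R-module lies in the n-fold iterate G^n applied to the class of C-flat C-cotorsion R-modules if and only if it is G_C-flat, lies in the Bass class B_C(R), and is C-cotorsion. -/

import Mathlib

open CategoryTheory TensorProduct

universe u

section
variable (R : Type u) [CommRing R]

def extZero (M N : ModuleCat.{u} R) : Prop :=
  ∀ i : ℕ, 1 ≤ i → Subsingleton (((Ext R (ModuleCat.{u} R) i).obj (Opposite.op M)).obj N)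

def torZero (M N : ModuleCat.{u} R) : Prop :=
  ∀ i : ℕ, 1 ≤ i → Subsingleton (((Tor (ModuleCat.{u} R) i).obj M).obj N)

def IsSemidualizing (C : ModuleCat.{u} R) : Prop :=
  Module.Finite R C ∧ Function.Bijective (LinearMap.lsmul R C) ∧ extZero R C C

/-- A module is `C`-flat if it is isomorphic to `F ⊗[R] C` with `F` flat. -/
def IsCFlat (C M : ModuleCat.{u} R) : Prop :=
  ∃ F : ModuleCat.{u} R, Module.Flat R F ∧ Nonempty (M ≃ₗ[R] (F ⊗[R] C))

def IsCInjective (C M : ModuleCat.{u} R) : Prop :=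
  ∃ I : ModuleCat.{u} R, Module.Injective R I ∧ Nonempty (M ≃ₗ[R] (↥C →ₗ[R] ↥I))

/-- cotorsion: `Ext^{≥1}(F, N) = 0` for all flat `F`. -/
def IsCotorsion (N : ModuleCat.{u} R) : Prop :=
  ∀ F : ModuleCat.{u} R, Module.Flat R F → extZero R F N

/-- `C`-cotorsion: `Ext^{≥1}(F ⊗ C, N) = 0` for all flat `F`. -/
def IsCCotorsion (C N : ModuleCat.{u} R) : Prop :=
  ∀ F : ModuleCat.{u} R, Module.Flat R F →
    extZero R (ModuleCat.of R (↥F ⊗[R] ↥C)) N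

/-- `C`-flat `C`-cotorsion: isomorphic to `F ⊗ C` with `F` flat and cotorsion. -/
def IsCFlatCotorsion (C M : ModuleCat.{u} R) : Prop :=
  ∃ F : ModuleCat.{u} R, Module.Flat R F ∧ IsCotorsion R F ∧
    Nonempty (M ≃ₗ[R] (F ⊗[R] C))

/-- The natural evaluation map `C ⊗ Hom(C,M) → M`. -/
noncomputable def evalMap (C M : ModuleCat.{u} R) :
    (↥C ⊗[R] (↥C →ₗ[R] ↥M)) →ₗ[R] ↥M :=
  TensorProduct.lift (LinearMap.id (R := R) (M := ↥C →ₗ[R] ↥M)).flip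

/-- The Bass class `B_C(R)`. -/
noncomputable def InBassClass (C M : ModuleCat.{u} R) : Prop :=
  extZero R C M ∧
  torZero R C (ModuleCat.of R (↥C →ₗ[R] ↥M)) ∧
  Function.Bijective (evalMap R C M)

/-- A `ℤ`-indexed complex of `R`-modules: `d i : X (i+1) → X i`. -/
structure ZComplex where
  X : ℤ → ModuleCat.{u} R
  d : ∀ i : ℤ, ↥(X (i + 1)) →ₗ[R] ↥(X i)
  d_comp_d : ∀ i : ℤ, (d i).comp (d (i + 1)) = 0

namespace ZComplex

variable {R} (Z : ZComplex R)

/-- Exactness of the complex. -/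
def IsExact : Prop := ∀ i : ℤ, Function.Exact (Z.d (i + 1)) (Z.d i)

/-- Exactness of `Z ⊗[R] J`. -/
def TensorExact (J : ModuleCat.{u} R) : Prop :=
  ∀ i : ℤ, Function.Exact (LinearMap.rTensor (↥J) (Z.d (i + 1)))
    (LinearMap.rTensor (↥J) (Z.d i))

/-- Exactness of `Hom_R(V, Z)`. -/
def HomFromExact (V : ModuleCat.{u} R) : Prop :=
  ∀ i : ℤ, Function.Exact
    (fun f : ↥V →ₗ[R] ↥(Z.X (i + 1 + 1)) => (Z.d (i + 1)).comp f)
    (fun f : ↥V →ₗ[R] ↥(Z.X (i + 1)) => (Z.d i).comp f)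

/-- Exactness of `Hom_R(Z, V)`. -/
def HomToExact (V : ModuleCat.{u} R) : Prop :=
  ∀ i : ℤ, Function.Exact
    (fun g : ↥(Z.X i) →ₗ[R] ↥V => g.comp (Z.d i))
    (fun g : ↥(Z.X (i + 1)) →ₗ[R] ↥V => g.comp (Z.d (i + 1)))

/-- `M ≅ Coker(∂₁)`. -/
def IsCokerOfD1 (M : ModuleCat.{u} R) : Prop :=
  Nonempty (↥M ≃ₗ[R] (↥(Z.X 0) ⧸ LinearMap.range (Z.d 0)))

end ZComplex

end

section
variable (R : Type u) [CommRing R]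

/-- A complete `FF_C`-resolution witnessing that `M` is `G_C`-flat. -/
def IsGCFlat (C M : ModuleCat.{u} R) : Prop :=
  ∃ Z : ZComplex R, Z.IsExact ∧
    (∀ i : ℤ, 0 ≤ i → Module.Flat R (Z.X i)) ∧
    (∀ i : ℤ, i < 0 → IsCFlat R C (Z.X i)) ∧
    (∀ J : ModuleCat.{u} R, IsCInjective R C J → Z.TensorExact J) ∧
    Z.IsCokerOfD1 M

def IsCProjective (C M : ModuleCat.{u} R) : Prop :=
  ∃ P : ModuleCat.{u} R, Module.Projective R P ∧ Nonempty (M ≃ₗ[R] (P ⊗[R] C))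

/-- A complete `PP_C`-resolution witnessing that `M` is `G_C`-projective. -/
def IsGCProjective (C M : ModuleCat.{u} R) : Prop :=
  ∃ Z : ZComplex R, Z.IsExact ∧
    (∀ i : ℤ, 0 ≤ i → Module.Projective R (Z.X i)) ∧
    (∀ i : ℤ, i < 0 → IsCProjective R C (Z.X i)) ∧
    (∀ Q : ModuleCat.{u} R, IsCProjective R C Q → Z.HomToExact Q) ∧
    Z.IsCokerOfD1 M

/-- `G(𝒳)` for a class `𝒳` of modules. -/
def GClass (𝒳 : ModuleCat.{u} R → Prop) (M : ModuleCat.{u} R) : Prop :=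
  ∃ Z : ZComplex R, Z.IsExact ∧
    (∀ i : ℤ, 𝒳 (Z.X i)) ∧
    (∀ V : ModuleCat.{u} R, 𝒳 V → Z.HomFromExact V) ∧
    (∀ V : ModuleCat.{u} R, 𝒳 V → Z.HomToExact V) ∧
    Z.IsCokerOfD1 M

/-- Iterates `G^n(𝒳)`, with `G^0(𝒳) = 𝒳`. -/
def GIter : ℕ → (ModuleCat.{u} R → Prop) → (ModuleCat.{u} R → Prop)
  | 0, 𝒳 => 𝒳
  | n + 1, 𝒳 => GClass R (GIter n 𝒳)

/-- `H_C(𝒳)`: modules with a `P_C F_C^cot`-complete `𝒳`-resolution. -/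
def HClass (C : ModuleCat.{u} R) (𝒳 : ModuleCat.{u} R → Prop) (M : ModuleCat.{u} R) : Prop :=
  ∃ Z : ZComplex R, Z.IsExact ∧
    (∀ i : ℤ, 𝒳 (Z.X i)) ∧
    (∀ P : ModuleCat.{u} R, Module.Projective R P →
      Z.HomFromExact (ModuleCat.of R (↥P ⊗[R] ↥C))) ∧
    (∀ N : ModuleCat.{u} R, IsCFlatCotorsion R C N → Z.HomToExact N) ∧
    Z.IsCokerOfD1 M

/-- Iterates `H_C^n(𝒳)`, with `H_C^0(𝒳) = 𝒳`. -/
def HIter (C : ModuleCat.{u} R) : ℕ → (ModuleCat.{u} R → Prop) → (ModuleCat.{u} R → Prop)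
  | 0, 𝒳 => 𝒳
  | n + 1, 𝒳 => HClass R C (HIter C n 𝒳)

/-- `M` admits a resolution `0 → X_n → ⋯ → X_0 → M → 0` with each `X_i` in `𝒳`. -/
def HasResOfLength (𝒳 : ModuleCat.{u} R → Prop) (n : ℕ) (M : ModuleCat.{u} R) : Prop :=
  ∃ (P : ℕ → ModuleCat.{u} R) (d : ∀ i : ℕ, ↥(P (i + 1)) →ₗ[R] ↥(P i))
    (ε : ↥(P 0) →ₗ[R] ↥M),
      Function.Surjective ε ∧ Function.Exact (d 0) ε ∧
      (∀ i : ℕ, Function.Exact (d (i + 1)) (d i)) ∧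
      (∀ i : ℕ, i ≤ n → 𝒳 (P i)) ∧
      (∀ i : ℕ, n < i → Subsingleton (P i))

/-- `M` admits a coresolution `0 → M → Y_0 → ⋯ → Y_n → 0` with each `Y_i` in `𝒳`. -/
def HasCoresOfLength (𝒳 : ModuleCat.{u} R → Prop) (n : ℕ) (M : ModuleCat.{u} R) : Prop :=
  ∃ (P : ℕ → ModuleCat.{u} R) (d : ∀ i : ℕ, ↥(P i) →ₗ[R] ↥(P (i + 1)))
    (η : ↥M →ₗ[R] ↥(P 0)),
      Function.Injective η ∧ Function.Exact η (d 0) ∧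
      (∀ i : ℕ, Function.Exact (d i) (d (i + 1))) ∧
      (∀ i : ℕ, i ≤ n → 𝒳 (P i)) ∧
      (∀ i : ℕ, n < i → Subsingleton (P i))

/-- `C` is a dualizing module: semidualizing of finite injective dimension. -/
def IsDualizing (C : ModuleCat.{u} R) : Prop :=
  IsSemidualizing R C ∧
  ∃ n : ℕ, HasCoresOfLength R (fun I => Module.Injective R ↥I) n C

end

/-- A short exact sequence `0 → A → B → D → 0` of modules. -/
structure SES {R : Type u} [CommRing R] {A B D : Type u} [AddCommGroup A] [AddCommGroup B]
    [AddCommGroup D] [Module R A] [Module R B] [Module R D]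
    (f : A →ₗ[R] B) (g : B →ₗ[R] D) : Prop where
  inj : Function.Injective f
  exact : Function.Exact f g
  surj : Function.Surjective g

/-- The vanishing of `Ext^n(A, N)`. -/
def ExtV (R : Type u) [CommRing R] (A N : Type u) [AddCommGroup A] [AddCommGroup N]
    [Module R A] [Module R N] (n : ℕ) : Prop :=
  Subsingleton (Abelian.Ext (ModuleCat.of R A) (ModuleCat.of R N) n)

/-- The vanishing of all higher `Ext^n(A, N)`. -/
def Perp (R : Type u) [CommRing R] (A N : Type u) [AddCommGroup A] [AddCommGroup N]
    [Module R A] [Module R N] : Prop :=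
  ∀ n, ExtV R A N (n + 1)

section
variable {R : Type u} [CommRing R] {A B D X Y N : Type u} [AddCommGroup A] [AddCommGroup B]
  [AddCommGroup D] [AddCommGroup X] [AddCommGroup Y] [AddCommGroup N] [Module R A] [Module R B]
  [Module R D] [Module R X] [Module R Y] [Module R N] {f : A →ₗ[R] B} {g : B →ₗ[R] D}

namespace SES

theorem comp_eq_zero (h : SES f g) : g ∘ₗ f = 0 := h.exact.linearMap_comp_eq_zero

theorem apply_apply (h : SES f g) (x : A) : g (f x) = 0 := h.exact.apply_apply_eq_zero x

/-- The associated short complex. -/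
abbrev toShortComplex (h : SES f g) : ShortComplex (ModuleCat.{u} R) :=
  ShortComplex.mk (ModuleCat.ofHom f) (ModuleCat.ofHom g) (by
    rw [← ModuleCat.ofHom_comp, h.comp_eq_zero]; rfl)

theorem shortExact (h : SES f g) : h.toShortComplex.ShortExact where
  exact := by
    rw [ShortComplex.ShortExact.moduleCat_exact_iff_function_exact]
    exact h.exact
  mono_f := (ModuleCat.mono_iff_injective _).2 h.inj
  epi_g := (ModuleCat.epi_iff_surjective _).2 h.surj

end SES

theorem extV_iff {n : ℕ} :
    ExtV R A N n ↔ ∀ x : Abelian.Ext (ModuleCat.of R A) (ModuleCat.of R N) n, x = 0 :=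
  ⟨fun h x => @Subsingleton.elim _ h x 0, fun h => ⟨fun x y => (h x).trans (h y).symm⟩⟩

theorem ExtV.cov_mid (h : SES f g) {n : ℕ} (h1 : ExtV R X A n) (h2 : ExtV R X D n) :
    ExtV R X B n := by
  rw [extV_iff] at *
  intro x
  obtain ⟨y, rfl⟩ := Abelian.Ext.covariant_sequence_exact₂ _ h.shortExact x (h2 _)
  rw [h1 y]; simp

theorem ExtV.cov_right (h : SES f g) {n : ℕ} (h1 : ExtV R X B n) (h2 : ExtV R X A (n + 1)) :
    ExtV R X D n := by
  rw [extV_iff] at *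
  intro x
  obtain ⟨y, rfl⟩ := Abelian.Ext.covariant_sequence_exact₃ _ h.shortExact x rfl (h2 _)
  rw [h1 y]; simp

theorem ExtV.cov_left (h : SES f g) {n : ℕ} (h1 : ExtV R X D n) (h2 : ExtV R X B (n + 1)) :
    ExtV R X A (n + 1) := by
  rw [extV_iff] at *
  intro x
  obtain ⟨y, rfl⟩ := Abelian.Ext.covariant_sequence_exact₁ _ h.shortExact x (h2 _) rfl
  rw [h1 y]; simp

theorem ExtV.contra_mid (h : SES f g) {n : ℕ} (h1 : ExtV R A X n) (h2 : ExtV R D X n) :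
    ExtV R B X n := by
  rw [extV_iff] at *
  intro x
  obtain ⟨y, rfl⟩ := Abelian.Ext.contravariant_sequence_exact₂ h.shortExact _ x (h1 _)
  rw [h2 y]; simp

theorem ExtV.contra_left (h : SES f g) {n : ℕ} (h1 : ExtV R B X n) (h2 : ExtV R D X (n + 1)) :
    ExtV R A X n := by
  rw [extV_iff] at *
  intro x
  obtain ⟨y, rfl⟩ := Abelian.Ext.contravariant_sequence_exact₁ h.shortExact _ x
    (add_comm 1 n) (h2 _)
  rw [h1 y]; simp

theorem ExtV.contra_right (h : SES f g) {n : ℕ} (h1 : ExtV R A X n) (h2 : ExtV R B X (n + 1)) :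
    ExtV R D X (n + 1) := by
  rw [extV_iff] at *
  intro x
  obtain ⟨y, rfl⟩ := Abelian.Ext.contravariant_sequence_exact₃ h.shortExact _ x (h2 _)
    (add_comm 1 n)
  rw [h1 y]; simp

theorem ExtV.lift (h : SES f g) (h1 : ExtV R X A 1) (k : X →ₗ[R] D) :
    ∃ l : X →ₗ[R] B, g ∘ₗ l = k := by
  rw [extV_iff] at h1
  obtain ⟨y, hy⟩ := Abelian.Ext.covariant_sequence_exact₃ (ModuleCat.of R X) h.shortExact
    (Abelian.Ext.mk₀ (ModuleCat.ofHom k)) rfl (h1 _)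
  obtain ⟨l, rfl⟩ := Abelian.Ext.addEquiv₀.symm.surjective y
  rw [Abelian.Ext.addEquiv₀_symm_apply, Abelian.Ext.mk₀_comp_mk₀] at hy
  exact ⟨l.hom, ModuleCat.hom_ext_iff.1 (Abelian.Ext.addEquiv₀.symm.injective hy)⟩

theorem ExtV.extend (h : SES f g) (h1 : ExtV R D X 1) (k : A →ₗ[R] X) :
    ∃ l : B →ₗ[R] X, l ∘ₗ f = k := by
  rw [extV_iff] at h1
  obtain ⟨y, hy⟩ := Abelian.Ext.contravariant_sequence_exact₁ h.shortExact (ModuleCat.of R X)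
    (Abelian.Ext.mk₀ (ModuleCat.ofHom k)) rfl (h1 _)
  obtain ⟨l, rfl⟩ := Abelian.Ext.addEquiv₀.symm.surjective y
  rw [Abelian.Ext.addEquiv₀_symm_apply, Abelian.Ext.mk₀_comp_mk₀] at hy
  exact ⟨l.hom, ModuleCat.hom_ext_iff.1 (Abelian.Ext.addEquiv₀.symm.injective hy)⟩

theorem ExtV.of_lift (h : SES f g) (h1 : ExtV R X B 1)
    (h2 : ∀ k : X →ₗ[R] D, ∃ l : X →ₗ[R] B, g ∘ₗ l = k) : ExtV R X A 1 := by
  rw [extV_iff] at *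
  intro x
  obtain ⟨y, rfl⟩ := Abelian.Ext.covariant_sequence_exact₁ _ h.shortExact x (h1 _) rfl
  obtain ⟨k, rfl⟩ := Abelian.Ext.addEquiv₀.symm.surjective y
  obtain ⟨l, hl⟩ := h2 k.hom
  obtain rfl : k = ModuleCat.ofHom l ≫ ModuleCat.ofHom g := by ext1; exact hl.symm
  rw [Abelian.Ext.addEquiv₀_symm_apply, ← Abelian.Ext.mk₀_comp_mk₀,
    Abelian.Ext.comp_assoc_of_second_deg_zero, h.shortExact.comp_extClass]
  simp

theorem ExtV.of_extend (h : SES f g) (h1 : ExtV R B X 1)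
    (h2 : ∀ k : A →ₗ[R] X, ∃ l : B →ₗ[R] X, l ∘ₗ f = k) : ExtV R D X 1 := by
  rw [extV_iff] at *
  intro x
  obtain ⟨y, rfl⟩ := Abelian.Ext.contravariant_sequence_exact₃ h.shortExact _ x (h1 _)
    (add_zero 1)
  obtain ⟨k, rfl⟩ := Abelian.Ext.addEquiv₀.symm.surjective y
  obtain ⟨l, hl⟩ := h2 k.hom
  obtain rfl : k = ModuleCat.ofHom f ≫ ModuleCat.ofHom l := by ext1; exact hl.symm
  rw [Abelian.Ext.addEquiv₀_symm_apply, ← Abelian.Ext.mk₀_comp_mk₀]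
  rw [← Abelian.Ext.comp_assoc_of_second_deg_zero, h.shortExact.extClass_comp]
  simp

theorem ExtV.of_projective [Module.Projective R A] (n : ℕ) : ExtV R A N (n + 1) :=
  have : Projective (ModuleCat.of R A) :=
    (IsProjective.iff_projective (R := R) A).1 inferInstance
  extV_iff.2 fun x => Abelian.Ext.eq_zero_of_projective x

theorem ExtV.of_injective (h : Module.Injective R N) (n : ℕ) : ExtV R A N (n + 1) :=
  have : Injective (ModuleCat.of R N) := Module.injective_object_of_injective_module R N
  extV_iff.2 fun x => Abelian.Ext.eq_zero_of_injective x

theorem ExtV.retract_left (i : B →ₗ[R] A) (r : A →ₗ[R] B) (hr : r ∘ₗ i = .id) {n : ℕ}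
    (h : ExtV R A N n) : ExtV R B N n := by
  rw [extV_iff] at *
  intro x
  have h2 : ModuleCat.ofHom i ≫ ModuleCat.ofHom r = 𝟙 _ := by
    rw [← ModuleCat.ofHom_comp, hr]; rfl
  have : (Abelian.Ext.mk₀ (ModuleCat.ofHom i ≫ ModuleCat.ofHom r)).comp x (zero_add n) = x := by
    rw [h2]; simp
  rw [← this, ← Abelian.Ext.mk₀_comp_mk₀_assoc,
    h ((Abelian.Ext.mk₀ (ModuleCat.ofHom r)).comp x (zero_add n))]
  simp

theorem ExtV.retract_right (i : B →ₗ[R] A) (r : A →ₗ[R] B) (hr : r ∘ₗ i = .id) {n : ℕ}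
    (h : ExtV R N A n) : ExtV R N B n := by
  rw [extV_iff] at *
  intro x
  have h2 : ModuleCat.ofHom i ≫ ModuleCat.ofHom r = 𝟙 _ := by
    rw [← ModuleCat.ofHom_comp, hr]; rfl
  have : x.comp (Abelian.Ext.mk₀ (ModuleCat.ofHom i ≫ ModuleCat.ofHom r)) (add_zero n) = x := by
    rw [h2]; simp
  rw [← this, ← Abelian.Ext.mk₀_comp_mk₀, ← Abelian.Ext.comp_assoc_of_third_deg_zero,
    h (x.comp (Abelian.Ext.mk₀ (ModuleCat.ofHom i)) (add_zero n))]
  simp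

theorem ExtV.congr_left (e : A ≃ₗ[R] B) {n : ℕ} (h : ExtV R A N n) : ExtV R B N n :=
  h.retract_left (e.symm : B →ₗ[R] A) e (by ext; simp)

theorem ExtV.congr_right (e : A ≃ₗ[R] B) {n : ℕ} (h : ExtV R N A n) : ExtV R N B n :=
  h.retract_right (e.symm : B →ₗ[R] A) e (by ext; simp)

end

section
variable {R : Type u} [CommRing R] {A B D X Y N : Type u} [AddCommGroup A] [AddCommGroup B]
  [AddCommGroup D] [AddCommGroup X] [AddCommGroup Y] [AddCommGroup N] [Module R A] [Module R B]
  [Module R D] [Module R X] [Module R Y] [Module R N] {f : A →ₗ[R] B} {g : B →ₗ[R] D}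

namespace Perp

theorem one (h : Perp R X A) : ExtV R X A 1 := h 0

theorem cov_mid (h : SES f g) (h1 : Perp R X A) (h2 : Perp R X D) : Perp R X B :=
  fun n => (h1 n).cov_mid h (h2 n)

theorem cov_right (h : SES f g) (h1 : Perp R X A) (h2 : Perp R X B) : Perp R X D :=
  fun n => (h2 n).cov_right h (h1 (n + 1))

theorem cov_left (h : SES f g) (h1 : Perp R X B) (h2 : Perp R X D)
    (h3 : ∀ k : X →ₗ[R] D, ∃ l : X →ₗ[R] B, g ∘ₗ l = k) : Perp R X A
  | 0 => (h1 0).of_lift h h3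
  | n + 1 => (h2 n).cov_left h (h1 (n + 1))

theorem contra_mid (h : SES f g) (h1 : Perp R A X) (h2 : Perp R D X) : Perp R B X :=
  fun n => (h1 n).contra_mid h (h2 n)

theorem contra_left (h : SES f g) (h1 : Perp R B X) (h2 : Perp R D X) : Perp R A X :=
  fun n => (h1 n).contra_left h (h2 (n + 1))

theorem contra_right (h : SES f g) (h1 : Perp R A X) (h2 : Perp R B X)
    (h3 : ∀ k : A →ₗ[R] X, ∃ l : B →ₗ[R] X, l ∘ₗ f = k) : Perp R D X
  | 0 => (h2 0).of_extend h h3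
  | n + 1 => (h1 n).contra_right h (h2 (n + 1))

theorem retract_right (i : B →ₗ[R] A) (r : A →ₗ[R] B) (hr : r ∘ₗ i = .id)
    (h : Perp R N A) : Perp R N B := fun n => (h n).retract_right i r hr

theorem congr_left (e : A ≃ₗ[R] B) (h : Perp R A N) : Perp R B N := fun n => (h n).congr_left e

theorem congr_right (e : A ≃ₗ[R] B) (h : Perp R N A) : Perp R N B := fun n => (h n).congr_right e

theorem of_injective (h : Module.Injective R N) : Perp R A N := fun n => ExtV.of_injective h n

end Perp

theorem SES.of_surjective {g : B →ₗ[R] D} (h : Function.Surjective g) :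
    SES (LinearMap.ker g).subtype g where
  inj := Subtype.val_injective
  exact x := by simp
  surj := h

theorem SES.of_injective {f : A →ₗ[R] B} (h : Function.Injective f) :
    SES f (LinearMap.range f).mkQ where
  inj := h
  exact x := by simp
  surj := Submodule.mkQ_surjective _

/-- The canonical free cover. -/
noncomputable abbrev freeCover (R A : Type u) [CommRing R] [AddCommGroup A] [Module R A] :
    (A →₀ R) →ₗ[R] A := Finsupp.linearCombination R id

theorem freeCover_surjective : Function.Surjective (freeCover R A) :=
  Finsupp.linearCombination_id_surjective R A

theorem ses_freeCover : SES (A := LinearMap.ker (freeCover R A)) (B := A →₀ R)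
    (LinearMap.ker (freeCover R A)).subtype (freeCover R A) :=
  .of_surjective freeCover_surjective

variable (R A) in
theorem exists_free_ses : ∃ (K P : Type u) (_ : AddCommGroup K) (_ : AddCommGroup P)
    (_ : Module R K) (_ : Module R P) (k : K →ₗ[R] P) (p : P →ₗ[R] A),
    Module.Free R P ∧ SES k p :=
  ⟨_, _, _, _, _, _, _, _, inferInstance, ses_freeCover (R := R) (A := A)⟩

theorem ExtV.shift_right [Module.Projective R B] (h : SES f g) {n : ℕ} :
    ExtV R D N (n + 2) ↔ ExtV R A N (n + 1) :=
  ⟨fun h1 => (ExtV.of_projective n).contra_left h h1,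
    fun h1 => h1.contra_right h (ExtV.of_projective _)⟩

theorem ExtV.one_iff [Module.Projective R B] (h : SES f g) :
    ExtV R D N 1 ↔ ∀ k : A →ₗ[R] N, ∃ l : B →ₗ[R] N, l ∘ₗ f = k :=
  ⟨fun h1 => h1.extend h, fun h1 => (ExtV.of_projective 0).of_extend h h1⟩

theorem SES.finsupp (h : SES f g) (ι : Type u) :
    SES (Finsupp.mapRange.linearMap f : (ι →₀ A) →ₗ[R] (ι →₀ B))
      (Finsupp.mapRange.linearMap g) where
  inj := Finsupp.mapRange_injective _ (map_zero f) h.inj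
  exact x := by
    constructor
    · intro hx
      have h2 : ∀ i, ∃ y, f y = x i := fun i => (h.exact _).1 (DFunLike.congr_fun hx i)
      choose y hy using h2
      classical
      refine ⟨Finsupp.onFinset x.support y ?_, ?_⟩
      · intro i hi
        rw [Finsupp.mem_support_iff, ← hy]
        intro h3
        exact hi (h.inj (by simpa using h3))
      · ext i; simpa using hy i
    · rintro ⟨y, rfl⟩
      ext i; simp [h.apply_apply]
  surj := Finsupp.mapRange_surjective _ (map_zero g) h.surj

theorem ExtV.finsupp (ι : Type u) {n : ℕ} (h : ExtV R A N (n + 1)) :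
    ExtV R (ι →₀ A) N (n + 1) := by
  induction n generalizing A with
  | zero =>
    have h2 := ses_freeCover (R := R) (A := A)
    rw [one_iff h2] at h
    rw [one_iff (h2.finsupp ι)]
    intro k
    choose l hl using fun i => h (k ∘ₗ Finsupp.lsingle i)
    refine ⟨Finsupp.lsum R l, ?_⟩
    ext i x
    simpa using LinearMap.congr_fun (hl i) x
  | succ n ih =>
    have h2 := ses_freeCover (R := R) (A := A)
    rw [shift_right h2] at h
    rw [shift_right (h2.finsupp ι)]
    exact ih h

theorem ExtV.pi {ι : Type u} {N : ι → Type u} [∀ i, AddCommGroup (N i)] [∀ i, Module R (N i)]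
    {n : ℕ} (h : ∀ i, ExtV R A (N i) (n + 1)) : ExtV R A (∀ i, N i) (n + 1) := by
  induction n generalizing A with
  | zero =>
    have h2 := ses_freeCover (R := R) (A := A)
    simp only [zero_add, one_iff h2] at h ⊢
    intro k
    choose l hl using fun i => h i (LinearMap.proj i ∘ₗ k)
    refine ⟨LinearMap.pi l, ?_⟩
    ext x i
    simpa using LinearMap.congr_fun (hl i) x
  | succ n ih =>
    have h2 := ses_freeCover (R := R) (A := A)
    simp only [shift_right h2] at h ⊢
    exact ih h

theorem Perp.finsupp (ι : Type u) (h : Perp R A N) : Perp R (ι →₀ A) N :=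
  fun n => (h n).finsupp ι

theorem Perp.pi {ι : Type u} {N : ι → Type u} [∀ i, AddCommGroup (N i)] [∀ i, Module R (N i)]
    (h : ∀ i, Perp R A (N i)) : Perp R A (∀ i, N i) := fun n => ExtV.pi fun i => h i n

variable (R N) in
theorem exists_injective_embedding : ∃ (I : Type u) (_ : AddCommGroup I) (_ : Module R I)
    (j : N →ₗ[R] I), Module.Injective R I ∧ Function.Injective j := by
  obtain ⟨⟨J, hJ, j, hj⟩⟩ := EnoughInjectives.presentation (ModuleCat.of R N)
  refine ⟨J, inferInstance, inferInstance, j.hom, ?_, (ModuleCat.mono_iff_injective j).1 hj⟩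
  exact Module.injective_module_of_injective_object R J

variable (R A) in
theorem exists_finite_free_cover [IsNoetherianRing R] [Module.Finite R A] :
    ∃ (n : ℕ) (p : (Fin n → R) →ₗ[R] A), Function.Surjective p :=
  Module.Finite.exists_fin' R A

end

section
variable {R : Type u} [CommRing R] 

theorem extZero_iff (M N : ModuleCat.{u} R) : extZero R M N ↔ Perp R M N := by
  have key : ∀ n : ℕ, Subsingleton (((Ext R (ModuleCat.{u} R) (n + 1)).obj (Opposite.op M)).obj N) ↔
      ExtV R M N (n + 1) := by
    intro n
    let P := ProjectiveResolution.of M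
    have h1 : ExtV R M N (n + 1) ↔ ∀ f : P.complex.X (n + 1) ⟶ N,
        P.complex.d (n + 2) (n + 1) ≫ f = 0 → ∃ g, P.complex.d (n + 1) n ≫ g = f := by
      rw [extV_iff]
      constructor
      · intro h f hf
        rw [← P.extMk_eq_zero_iff f (n + 2) rfl hf n rfl]
        exact h _
      · intro h x
        obtain ⟨f, hf, rfl⟩ := P.extMk_surjective x (n + 2) rfl
        rw [P.extMk_eq_zero_iff f (n + 2) rfl hf n rfl]
        exact h f hf
    rw [h1, (P.isoExt (R := R) (n + 1) N).toLinearEquiv.toEquiv.subsingleton_congr]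
    rw [← ModuleCat.isZero_iff_subsingleton, ← HomologicalComplex.exactAt_iff_isZero_homology,
      HomologicalComplex.exactAt_iff' _ n (n + 1) (n + 2) (by simp) (by simp),
      ShortComplex.moduleCat_exact_iff]
    rfl
  constructor
  · intro h n
    exact (key n).1 (h (n + 1) (by omega))
  · intro h i hi
    obtain ⟨n, rfl⟩ : ∃ n, i = n + 1 := ⟨i - 1, by omega⟩
    exact (key n).2 (h n)

section
variable {A B D : Type u} [AddCommGroup A] [AddCommGroup B] [AddCommGroup D] [Module R A]
  [Module R B] [Module R D]

theorem CharacterModule.dual_exact_iff {f : A →ₗ[R] B} {g : B →ₗ[R] D} :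
    Function.Exact (dual g) (dual f) ↔ Function.Exact f g := by
  constructor
  · intro h x
    constructor
    · intro hx
      by_contra hx2
      have h3 : (LinearMap.range f).mkQ x ≠ 0 := by simpa using hx2
      obtain ⟨c, hc⟩ := exists_character_apply_ne_zero_of_ne_zero h3
      obtain ⟨c', hc'⟩ := (h (dual (LinearMap.range f).mkQ c)).1 (by
        ext y
        have : (LinearMap.range f).mkQ (f y) = 0 := by simp
        change c ((LinearMap.range f).mkQ (f y)) = 0
        rw [this, map_zero])
      apply hc
      have := DFunLike.congr_fun hc' x
      change c' (g x) = c _ at this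
      exact this.symm.trans (by rw [hx, map_zero])
    · rintro ⟨y, rfl⟩
      refine eq_zero_of_character_apply fun c => ?_
      exact DFunLike.congr_fun (h.apply_apply_eq_zero c) y
  · intro h c
    constructor
    · intro hc
      let c1 : CharacterModule (B ⧸ LinearMap.range f) :=
        QuotientAddGroup.lift (LinearMap.range f).toAddSubgroup c (by
          rintro _ ⟨y, rfl⟩
          exact DFunLike.congr_fun hc y)
      obtain ⟨c', hc'⟩ := dual_surjective_of_injective
        ((LinearMap.range f).liftQ g (LinearMap.range_le_ker_iff.2 h.linearMap_comp_eq_zero))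
        (by
          rw [← LinearMap.ker_eq_bot, Submodule.ker_liftQ_eq_bot]
          rw [LinearMap.exact_iff.1 h]) c1
      refine ⟨c', ?_⟩
      ext x
      exact DFunLike.congr_fun hc' (Submodule.Quotient.mk x)
    · rintro ⟨c, rfl⟩
      ext y
      change c (g (f y)) = 0
      rw [h.apply_apply_eq_zero, map_zero]


theorem rTensor_exact_iff {f : A →ₗ[R] B} {g : B →ₗ[R] D} (N : Type u) [AddCommGroup N]
    [Module R N] : Function.Exact (f.rTensor N) (g.rTensor N) ↔
      Function.Exact (fun k : D →ₗ[R] CharacterModule N => k ∘ₗ g)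
        (fun k : B →ₗ[R] CharacterModule N => k ∘ₗ f) := by
  rw [← CharacterModule.dual_exact_iff]
  refine (Function.Exact.iff_of_ladder_linearEquiv (f₁₂ := g.lcomp R (CharacterModule N))
    (f₂₃ := f.lcomp R (CharacterModule N)) (e₁ := CharacterModule.homEquiv)
    (e₂ := CharacterModule.homEquiv) (e₃ := CharacterModule.homEquiv) ?_ ?_)
  · ext k t
    induction t with
    | zero => exact (map_zero _).trans (map_zero _).symm
    | add x y hx hy => simp only [map_add, hx, hy]
    | tmul x y => rfl
  · ext k t
    induction t with
    | zero => exact (map_zero _).trans (map_zero _).symm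
    | add x y hx hy => simp only [map_add, hx, hy]
    | tmul x y => rfl

theorem lTensor_exact_iff_rTensor_exact {f : A →ₗ[R] B} {g : B →ₗ[R] D} (N : Type u)
    [AddCommGroup N] [Module R N] : Function.Exact (f.lTensor N) (g.lTensor N) ↔
      Function.Exact (f.rTensor N) (g.rTensor N) :=
  Function.Exact.iff_of_ladder_linearEquiv (e₁ := TensorProduct.comm R A N)
    (e₂ := TensorProduct.comm R B N) (e₃ := TensorProduct.comm R D N)
    (by ext; simp) (by ext; simp)

end

theorem torZero_iff (C N : ModuleCat.{u} R) : torZero R C N ↔ Perp R N (CharacterModule C) := by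
  have key : ∀ n : ℕ, Subsingleton (((Tor (ModuleCat.{u} R) (n + 1)).obj C).obj N) ↔
      ExtV R N (CharacterModule C) (n + 1) := by
    intro n
    let P := ProjectiveResolution.of N
    have h1 : ExtV R N (CharacterModule C) (n + 1) ↔
        ∀ f : P.complex.X (n + 1) ⟶ ModuleCat.of R (CharacterModule C),
        P.complex.d (n + 2) (n + 1) ≫ f = 0 → ∃ g, P.complex.d (n + 1) n ≫ g = f := by
      rw [extV_iff]
      constructor
      · intro h f hf
        rw [← P.extMk_eq_zero_iff f (n + 2) rfl hf n rfl]
        exact h _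
      · intro h x
        obtain ⟨f, hf, rfl⟩ := P.extMk_surjective x (n + 2) rfl
        rw [P.extMk_eq_zero_iff f (n + 2) rfl hf n rfl]
        exact h f hf
    rw [h1, Tor_obj, (P.isoLeftDerivedObj _ (n + 1)).toLinearEquiv.toEquiv.subsingleton_congr]
    simp only [HomologicalComplex.homologyFunctor_obj]
    rw [← ModuleCat.isZero_iff_subsingleton, ← HomologicalComplex.exactAt_iff_isZero_homology,
      HomologicalComplex.exactAt_iff' _ (n + 2) (n + 1) n (by simp) (by simp),
      ShortComplex.ShortExact.moduleCat_exact_iff_function_exact]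
    refine ((lTensor_exact_iff_rTensor_exact (f := (P.complex.d (n + 2) (n + 1)).hom)
      (g := (P.complex.d (n + 1) n).hom) C).trans (rTensor_exact_iff _)).trans ?_
    constructor
    · intro h f hf
      obtain ⟨g, hg⟩ := (h f.hom).1 (ModuleCat.hom_ext_iff.1 hf)
      exact ⟨ModuleCat.ofHom g, ModuleCat.hom_ext hg⟩
    · intro h f
      constructor
      · intro hf
        obtain ⟨g, hg⟩ := h (ModuleCat.ofHom f) (ModuleCat.hom_ext hf)
        exact ⟨g.hom, ModuleCat.hom_ext_iff.1 hg⟩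
      · rintro ⟨g, rfl⟩
        have := ModuleCat.hom_ext_iff.1 (P.complex.d_comp_d (n + 2) (n + 1) n)
        refine LinearMap.ext fun x => ?_
        exact (congrArg g (LinearMap.congr_fun this x)).trans (map_zero g)
  constructor
  · intro h n
    exact (key n).1 (h (n + 1) (by omega))
  · intro h i hi
    obtain ⟨n, rfl⟩ : ∃ n, i = n + 1 := ⟨i - 1, by omega⟩
    exact (key n).2 (h n)

end

section
variable {R : Type u} [CommRing R] {A B D X Y N F : Type u} [AddCommGroup A] [AddCommGroup B]
  [AddCommGroup D] [AddCommGroup X] [AddCommGroup Y] [AddCommGroup N] [AddCommGroup F]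
  [Module R A] [Module R B] [Module R D] [Module R X] [Module R Y] [Module R N] [Module R F]
  {f : A →ₗ[R] B} {g : B →ₗ[R] D}

theorem SES.lTensor_injective [Module.Flat R D] (h : SES f g) (X : Type u) [AddCommGroup X]
    [Module R X] : Function.Injective (f.lTensor X) :=
  LinearMap.lTensor_injective_of_exact_of_flat g h.surj f h.inj h.exact X

theorem SES.rTensor_injective [Module.Flat R D] (h : SES f g) (X : Type u) [AddCommGroup X]
    [Module R X] : Function.Injective (f.rTensor X) :=
  (LinearMap.lTensor_inj_iff_rTensor_inj X f).1 (h.lTensor_injective X)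

theorem SES.rTensor [Module.Flat R D] (h : SES f g) (X : Type u) [AddCommGroup X]
    [Module R X] : SES (f.rTensor X) (g.rTensor X) :=
  ⟨h.rTensor_injective X, rTensor_exact X h.exact h.surj, LinearMap.rTensor_surjective X h.surj⟩

theorem extV_one_characterModule_iff [Module.Projective R B] (h : SES f g) :
    ExtV R D (CharacterModule N) 1 ↔ Function.Injective (f.rTensor N) := by
  rw [ExtV.one_iff h, rTensor_injective_iff_lcomp_surjective]; rfl

theorem flat_of_extV_one (h : ∀ (N : Type u) [AddCommGroup N] [Module R N],
    ExtV R F (CharacterModule N) 1) : Module.Flat R F := by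
  rw [Module.Flat.iff_rTensor_preserves_injective_linearMap']
  intro X Y _ _ _ _ i hi
  rw [injective_iff_map_eq_zero]
  intro x hx
  obtain ⟨K, P, _, _, _, _, k, p, hP, hS⟩ := exists_free_ses R F
  obtain ⟨x', rfl⟩ := LinearMap.lTensor_surjective X hS.surj x
  have e1 : p.lTensor Y (i.rTensor P x') = 0 := by
    rw [← hx, ← LinearMap.comp_apply, ← LinearMap.comp_apply,
      LinearMap.lTensor_comp_rTensor, LinearMap.rTensor_comp_lTensor]
  obtain ⟨z, hz⟩ := (lTensor_exact Y hS.exact hS.surj _).1 e1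
  have hq := SES.of_injective hi
  set q := (LinearMap.range i).mkQ
  have e2 : q.rTensor _ z = 0 := by
    have := (extV_one_characterModule_iff hS).1 (h (Y ⧸ LinearMap.range i))
    rw [← LinearMap.lTensor_inj_iff_rTensor_inj] at this
    apply this
    rw [map_zero, ← LinearMap.comp_apply, LinearMap.lTensor_comp_rTensor,
      ← LinearMap.rTensor_comp_lTensor, LinearMap.comp_apply, hz, ← LinearMap.comp_apply,
      ← LinearMap.rTensor_comp, hq.comp_eq_zero]
    simp
  obtain ⟨w, rfl⟩ := (rTensor_exact _ hq.exact hq.surj _).1 e2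
  have e3 : x' = k.lTensor X w := by
    apply Module.Flat.rTensor_preserves_injective_linearMap (M := P) i hi
    rw [← hz, ← LinearMap.comp_apply, ← LinearMap.comp_apply,
      LinearMap.lTensor_comp_rTensor, LinearMap.rTensor_comp_lTensor]
  rw [e3, ← LinearMap.comp_apply, ← LinearMap.lTensor_comp, hS.comp_eq_zero]
  simp

theorem flat_kernel [Module.Flat R B] [Module.Flat R D] (h : SES f g) : Module.Flat R A := by
  rw [Module.Flat.iff_rTensor_preserves_injective_linearMap']
  intro X Y _ _ _ _ i hi
  have h1 : Function.Injective (f.lTensor Y ∘ₗ i.rTensor A) := by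
    rw [LinearMap.lTensor_comp_rTensor, ← LinearMap.rTensor_comp_lTensor]
    exact (Module.Flat.rTensor_preserves_injective_linearMap i hi).comp (h.lTensor_injective X)
  exact Function.Injective.of_comp h1

theorem Perp.flat_characterModule (F N : Type u) [AddCommGroup F] [AddCommGroup N] [Module R F]
    [Module R N] [Module.Flat R F] : Perp R F (CharacterModule N) := by
  intro n
  induction n generalizing F with
  | zero =>
    obtain ⟨K, P, _, _, _, _, k, p, hP, hS⟩ := exists_free_ses R F
    rw [zero_add, extV_one_characterModule_iff hS]
    exact hS.rTensor_injective N
  | succ n ih =>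
    obtain ⟨K, P, _, _, _, _, k, p, hP, hS⟩ := exists_free_ses R F
    rw [ExtV.shift_right hS]
    have := flat_kernel hS
    exact ih _

theorem flat_extension [Module.Flat R A] [Module.Flat R D] (h : SES f g) : Module.Flat R B :=
  flat_of_extV_one fun N _ _ => (Perp.flat_characterModule A N 0).contra_mid h
    (Perp.flat_characterModule D N 0)

/-- The biduality embedding. -/
def CharacterModule.eval (R Z : Type u) [CommRing R] [AddCommGroup Z] [Module R Z] :
    Z →ₗ[R] CharacterModule (CharacterModule Z) where
  toFun z :=
    { toFun := fun c => c z
      map_zero' := rfl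
      map_add' := fun _ _ => rfl }
  map_add' x y := by ext c; exact map_add c x y
  map_smul' r x := rfl

theorem CharacterModule.eval_injective : Function.Injective (eval R N) := by
  rw [injective_iff_map_eq_zero]
  exact fun x hx => eq_zero_of_character_apply fun c => DFunLike.congr_fun hx c

theorem CharacterModule.exists_extend (k : A →ₗ[R] CharacterModule N) :
    ∃ l : CharacterModule (CharacterModule A) →ₗ[R] CharacterModule N, l ∘ₗ eval R A = k :=
  ⟨dual (eval R N) ∘ₗ dual (dual k), rfl⟩

theorem SES.eval : SES (CharacterModule.eval R N) (LinearMap.range (CharacterModule.eval R N)).mkQ :=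
  .of_injective CharacterModule.eval_injective


/-- The natural map `A ⊗ I⁺ → Hom(A, I)⁺`. -/
noncomputable def tensorCharacter (R A I : Type u) [CommRing R] [AddCommGroup A] [AddCommGroup I]
    [Module R A] [Module R I] :
    A ⊗[R] CharacterModule I →ₗ[R] CharacterModule (A →ₗ[R] I) :=
  TensorProduct.lift
    { toFun := fun a => CharacterModule.dual (LinearMap.applyₗ a)
      map_add' := fun a b => by
        ext c h
        change c (h (a + b)) = c (h a) + c (h b)
        rw [map_add, map_add]
      map_smul' := fun r a => by
        ext c h
        change c (h (r • a)) = c ((r • h) a)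
        rw [map_smul]; rfl }

theorem tensorCharacter_comp (f : A →ₗ[R] B) :
    CharacterModule.dual (f.lcomp R N) ∘ₗ tensorCharacter R A N =
      tensorCharacter R B N ∘ₗ f.rTensor _ := by
  ext a c h; rfl

theorem tensorCharacter_bijective_pi (n : ℕ) :
    Function.Bijective (tensorCharacter R (Fin n → R) N) := by
  have hrep : ∀ x : (Fin n → R) ⊗[R] CharacterModule N, ∃ c : Fin n → CharacterModule N,
      x = ∑ i, (Pi.single i 1 : Fin n → R) ⊗ₜ[R] c i := by
    intro x
    induction x with
    | zero => exact ⟨0, by simp⟩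
    | tmul a c =>
      refine ⟨fun i => a i • c, ?_⟩
      conv_lhs => rw [pi_eq_sum_univ a]
      rw [TensorProduct.sum_tmul]
      refine Finset.sum_congr rfl fun i _ => ?_
      rw [← TensorProduct.smul_tmul]
      congr 2
      ext j
      simp [Pi.single_apply, eq_comm]
    | add x y hx hy =>
      obtain ⟨c, rfl⟩ := hx
      obtain ⟨d, rfl⟩ := hy
      exact ⟨c + d, by simp [TensorProduct.tmul_add, Finset.sum_add_distrib]⟩
  have happ : ∀ (c : Fin n → CharacterModule N) (h : (Fin n → R) →ₗ[R] N),
      tensorCharacter R _ N (∑ i, (Pi.single i 1 : Fin n → R) ⊗ₜ[R] c i) h =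
        ∑ i, c i (h (Pi.single i 1)) := by
    intro c h
    rw [map_sum]
    exact AddMonoidHom.finsetSum_apply _ _ _
  constructor
  · rw [injective_iff_map_eq_zero]
    intro x hx
    obtain ⟨c, rfl⟩ := hrep x
    have : c = 0 := by
      ext i y
      have h1 := happ c ((LinearMap.proj i : (Fin n → R) →ₗ[R] R).smulRight y)
      rw [hx, Finset.sum_eq_single i] at h1
      · have h2 : (0 : AddCircle (1 : ℚ)) = _ := h1
        refine Eq.trans ?_ h2.symm
        simp
      · intro j _ hj
        simp [hj.symm]
      · simp
    simp [this]
  · intro c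
    let d : Fin n → CharacterModule N := fun i =>
      { toFun := fun y => c ((LinearMap.proj i : (Fin n → R) →ₗ[R] R).smulRight y)
        map_zero' := by rw [LinearMap.smulRight_zero, map_zero]
        map_add' := fun x y => by
          rw [← map_add]; congr 1; ext; simp }
    refine ⟨∑ i, (Pi.single i 1 : Fin n → R) ⊗ₜ[R] d i, ?_⟩
    ext h
    rw [happ]
    change ∑ i, c ((LinearMap.proj i : (Fin n → R) →ₗ[R] R).smulRight (h (Pi.single i 1))) = c h
    rw [← map_sum]
    congr 1
    refine LinearMap.pi_ext' fun i => ?_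
    ext
    simp [Pi.single_apply]

theorem lcomp_exact (h : Function.Exact f g) (hg : Function.Surjective g) (N : Type u) [AddCommGroup N]
    [Module R N] : Function.Exact (g.lcomp R N) (f.lcomp R N) :=
  LinearMap.exact_lcomp_of_exact_of_surjective _ h hg

theorem tensorCharacter_bijective [IsNoetherianRing R] [Module.Finite R A] :
    Function.Bijective (tensorCharacter R A N) := by
  obtain ⟨n, p, hp⟩ := Module.Finite.exists_fin' R A
  obtain ⟨m, q, hq⟩ := Module.Finite.exists_fin' R (LinearMap.ker p)
  have hqp : Function.Exact ((LinearMap.ker p).subtype ∘ₗ q) p := by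
    rw [LinearMap.exact_iff, LinearMap.range_comp, LinearMap.range_eq_top.2 hq]; simp
  refine LinearMap.bijective_of_surjective_of_bijective_of_right_exact
    (f₁ := ((LinearMap.ker p).subtype ∘ₗ q).rTensor _) (f₂ := p.rTensor _)
    (g₁ := CharacterModule.dual (((LinearMap.ker p).subtype ∘ₗ q).lcomp R N))
    (g₂ := CharacterModule.dual (p.lcomp R N))
    (tensorCharacter R _ N) (tensorCharacter R _ N) _ (tensorCharacter_comp _)
    (tensorCharacter_comp _) (rTensor_exact _ hqp hp) ?_
    (tensorCharacter_bijective_pi m).2 (tensorCharacter_bijective_pi n)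
    (LinearMap.rTensor_surjective _ hp) ?_
  · rw [CharacterModule.dual_exact_iff]
    exact lcomp_exact hqp hp N
  · exact CharacterModule.dual_surjective_of_injective _ (LinearMap.lcomp_injective_of_surjective p hp)

theorem flat_characterModule_of_injective [IsNoetherianRing R] (h : Module.Injective R N) :
    Module.Flat R (CharacterModule N) := by
  rw [Module.Flat.iff_rTensor_injective]
  intro I _
  have h1 : Function.Surjective (I.subtype.lcomp R N) := by
    intro k
    obtain ⟨l, hl⟩ := Module.Injective.out I.subtype Subtype.val_injective k
    exact ⟨l, LinearMap.ext hl⟩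
  have h2 := (CharacterModule.dual_injective_of_surjective _ h1).comp
    (tensorCharacter_bijective (R := R) (A := I) (N := N)).1
  rw [← LinearMap.coe_comp, tensorCharacter_comp] at h2
  exact Function.Injective.of_comp h2

end

/-- Unbundled cotorsion modules. -/
def Cotor (R N : Type u) [CommRing R] [AddCommGroup N] [Module R N] : Prop :=
  ∀ (F : Type u) [AddCommGroup F] [Module R F] [Module.Flat R F], Perp R F N

section
variable {R : Type u} [CommRing R] {A B D X Y N F Z : Type u} [AddCommGroup A] [AddCommGroup B]
  [AddCommGroup D] [AddCommGroup X] [AddCommGroup Y] [AddCommGroup N] [AddCommGroup F]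
  [AddCommGroup Z] [Module R Z]
  [Module R A] [Module R B] [Module R D] [Module R X] [Module R Y] [Module R N] [Module R F]
  {f : A →ₗ[R] B} {g : B →ₗ[R] D}

theorem Cotor.characterModule (N : Type u) [AddCommGroup N] [Module R N] :
    Cotor R (CharacterModule N) := fun F _ _ _ => Perp.flat_characterModule F N

theorem Cotor.cov_mid (h : SES f g) (h1 : Cotor R A) (h2 : Cotor R D) : Cotor R B :=
  fun F _ _ _ => (h1 F).cov_mid h (h2 F)

theorem Cotor.congr (e : A ≃ₗ[R] B) (h : Cotor R A) : Cotor R B := fun F _ _ _ =>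
  (h F).congr_right e

theorem flat_bidual [IsNoetherianRing R] [Module.Flat R Z] :
    Module.Flat R (CharacterModule (CharacterModule Z)) :=
  flat_characterModule_of_injective (Module.Flat.iff_characterModule_injective.1 inferInstance)

theorem flat_coker_eval [IsNoetherianRing R] [Module.Flat R Z] :
    Module.Flat R (CharacterModule (CharacterModule Z) ⧸
      LinearMap.range (CharacterModule.eval R Z)) := by
  have := flat_bidual (R := R) (Z := Z)
  exact flat_of_extV_one fun N _ _ => ExtV.of_extend SES.eval
    (Cotor.characterModule N _ 0) CharacterModule.exists_extend

theorem exists_flat_cotorsion_hull [IsNoetherianRing R] (Z : Type u) [AddCommGroup Z] [Module R Z]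
    [Module.Flat R Z] : ∃ (A L : Type u) (_ : AddCommGroup A) (_ : AddCommGroup L)
    (_ : Module R A) (_ : Module R L) (i : Z →ₗ[R] A) (p : A →ₗ[R] L),
    SES i p ∧ Module.Flat R A ∧ Cotor R A ∧ Module.Flat R L :=
  ⟨_, _, _, _, _, _, _, _, SES.eval, flat_bidual, Cotor.characterModule _, flat_coker_eval⟩

theorem Cotor.exists_retraction [IsNoetherianRing R] [Module.Flat R Z] (h : Cotor R Z) :
    ∃ r : CharacterModule (CharacterModule Z) →ₗ[R] Z, r ∘ₗ CharacterModule.eval R Z = .id := by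
  have := flat_coker_eval (R := R) (Z := Z)
  exact (h _ 0).extend SES.eval .id

end

section
variable {R : Type u} [CommRing R] {A B D X Y N F Z : Type u} [AddCommGroup A] [AddCommGroup B]
  [AddCommGroup D] [AddCommGroup X] [AddCommGroup Y] [AddCommGroup N] [AddCommGroup F]
  [AddCommGroup Z] [Module R Z]
  [Module R A] [Module R B] [Module R D] [Module R X] [Module R Y] [Module R N] [Module R F]
  {f : A →ₗ[R] B} {g : B →ₗ[R] D}

/-- The natural map `F ⊗ Hom(A, N) → Hom(A, F ⊗ N)`. -/
noncomputable abbrev homTensor (R A F N : Type u) [CommRing R] [AddCommGroup A] [AddCommGroup F]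
    [AddCommGroup N] [Module R A] [Module R F] [Module R N] :
    F ⊗[R] (A →ₗ[R] N) →ₗ[R] A →ₗ[R] F ⊗[R] N :=
  TensorProduct.lTensorHomToHomLTensor (.id R) A F N

theorem homTensor_comp (f : A →ₗ[R] B) :
    f.lcomp R (F ⊗[R] N) ∘ₗ homTensor R B F N = homTensor R A F N ∘ₗ (f.lcomp R N).lTensor F := by
  ext a c h
  simp

theorem homTensor_bijective [IsNoetherianRing R] [Module.Finite R A] [Module.Flat R F] :
    Function.Bijective (homTensor R A F N) := by
  obtain ⟨n, p, hp⟩ := Module.Finite.exists_fin' R A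
  obtain ⟨m, q, hq⟩ := Module.Finite.exists_fin' R (LinearMap.ker p)
  have hqp : Function.Exact ((LinearMap.ker p).subtype ∘ₗ q) p := by
    rw [LinearMap.exact_iff, LinearMap.range_comp, LinearMap.range_eq_top.2 hq]; simp
  have hfree (n : ℕ) : Function.Bijective (homTensor R (Fin n → R) F N) := by
    have := (lTensorHomEquivHomLTensor R (Fin n → R) F N).bijective
    rwa [← LinearEquiv.coe_toLinearMap, lTensorHomEquivHomLTensor_toLinearMap] at this
  refine LinearMap.bijective_of_bijective_of_injective_of_left_exact
    (f₁ := (p.lcomp R N).lTensor F)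
    (f₂ := (((LinearMap.ker p).subtype ∘ₗ q).lcomp R N).lTensor F)
    (g₁ := p.lcomp R (F ⊗[R] N))
    (g₂ := ((LinearMap.ker p).subtype ∘ₗ q).lcomp R (F ⊗[R] N))
    _ (homTensor R _ F N) (homTensor R _ F N) (homTensor_comp _)
    (homTensor_comp _) (Module.Flat.lTensor_exact _ (lcomp_exact hqp hp _))
    (lcomp_exact hqp hp _) (hfree n) (hfree m).1 ?_ ?_
  · exact Module.Flat.lTensor_preserves_injective_linearMap _
      (LinearMap.lcomp_injective_of_surjective p hp)
  · exact LinearMap.lcomp_injective_of_surjective p hp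

theorem injective_tensor [IsNoetherianRing R] [Module.Flat R F] (h : Module.Injective R N) :
    Module.Injective R (F ⊗[R] N) := by
  apply Module.Baer.injective
  have key (I : Ideal R) : Function.Surjective (I.subtype.lcomp R (F ⊗[R] N)) := by
    have h1 : Function.Surjective (I.subtype.lcomp R N) := by
      intro k
      obtain ⟨l, hl⟩ := Module.Injective.out I.subtype Subtype.val_injective k
      exact ⟨l, LinearMap.ext hl⟩
    have h2 := (homTensor_bijective (A := I) (F := F) (N := N)).2.comp
      (LinearMap.lTensor_surjective F h1)
    rw [← LinearMap.coe_comp, ← homTensor_comp] at h2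
    exact Function.Surjective.of_comp h2
  intro I k
  obtain ⟨l, hl⟩ := key I k
  exact ⟨l, fun x hx => LinearMap.congr_fun hl ⟨x, hx⟩⟩

theorem flat_congr_characterModule (e : A ≃ₗ[R] B) (h : Module.Flat R (CharacterModule A)) :
    Module.Flat R (CharacterModule B) := .of_linearEquiv (CharacterModule.congr e).symm

theorem flat_and_cotor_hom_of_injective [IsNoetherianRing R] (hA : Module.Injective R A)
    (hN : Module.Injective R N) : Module.Flat R (A →ₗ[R] N) ∧ Cotor R (A →ₗ[R] N) := by
  have h1 := flat_characterModule_of_injective hN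
  obtain ⟨r, hr⟩ := Module.Injective.out (CharacterModule.eval R N)
    CharacterModule.eval_injective (.id : N →ₗ[R] N)
  have h2 : Module.Flat R (CharacterModule (A ⊗[R] CharacterModule N)) :=
    flat_congr_characterModule (TensorProduct.comm R _ _)
      (flat_characterModule_of_injective (injective_tensor (F := CharacterModule N) hA))
  let e := CharacterModule.homEquiv (R := R) (A := A) (B := CharacterModule N)
  let i : (A →ₗ[R] N) →ₗ[R] CharacterModule (A ⊗[R] CharacterModule N) :=
    e.toLinearMap ∘ₗ (CharacterModule.eval R N).compRight R
  let p : CharacterModule (A ⊗[R] CharacterModule N) →ₗ[R] (A →ₗ[R] N) :=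
    r.compRight R ∘ₗ e.symm.toLinearMap
  have hpi : p ∘ₗ i = .id := by
    ext a x
    simp [p, i, hr]
  exact ⟨.of_retract i p hpi, fun F _ _ _ =>
    (Perp.flat_characterModule F _).retract_right i p hpi⟩

theorem flat_pi [IsNoetherianRing R] {ι : Type u} {N : ι → Type u} [∀ i, AddCommGroup (N i)]
    [∀ i, Module R (N i)] [∀ i, Module.Flat R (N i)] : Module.Flat R (∀ i, N i) := by
  refine Module.Flat.of_forall_isTrivialRelation fun {l f x} hx => ?_
  let φ : (Fin l → R) →ₗ[R] R := Fintype.linearCombination R f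
  obtain ⟨m, q, hq⟩ := Module.Finite.exists_fin' R (LinearMap.ker φ)
  have key (p : ι) : ∃ y : Fin m → N p, ∀ i, x i p = ∑ j, (q fun k => if j = k then 1 else 0).1 i • y j := by
    have h0 : ∑ i, f i • x i p = 0 := by
      simpa [Finset.sum_apply] using congrFun hx p
    obtain ⟨k, a, y, h1, h2⟩ := Module.Flat.isTrivialRelation_of_sum_smul_eq_zero h0
    have h3 (j : Fin k) : (fun i => a i j) ∈ LinearMap.ker φ := by
      rw [LinearMap.mem_ker, Fintype.linearCombination_apply, ← h2 j]
      exact Finset.sum_congr rfl fun _ _ => mul_comm _ _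
    choose b hb using fun j => hq ⟨_, h3 j⟩
    refine ⟨fun j => ∑ s, b s j • y s, fun i => ?_⟩
    refine (h1 i).trans ?_
    have h4 (s : Fin k) : a i s = ∑ j, b s j * (q fun k => if j = k then 1 else 0).1 i := by
      have h5 := congrArg (fun v => v.1 i) (hb s)
      have h6 := ((LinearMap.proj i : (Fin l → R) →ₗ[R] R) ∘ₗ
        (LinearMap.ker φ).subtype ∘ₗ q).pi_apply_eq_sum_univ (b s)
      exact h5.symm.trans h6
    simp_rw [h4, Finset.smul_sum, Finset.sum_smul, smul_smul]
    rw [Finset.sum_comm]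
    simp_rw [mul_comm]
  choose y hy using key
  refine ⟨m, fun i j => (q fun k => if j = k then 1 else 0).1 i, fun j p => y p j, fun i => ?_, fun j => ?_⟩
  · ext p
    simp [hy p i, Finset.sum_apply]
  · have := (q fun k => if j = k then 1 else 0).2
    rw [LinearMap.mem_ker, Fintype.linearCombination_apply] at this
    refine (Finset.sum_congr rfl fun _ _ => ?_).trans this
    exact mul_comm _ _

end

section
variable {R : Type u} [CommRing R] {A B : Type u} [AddCommGroup A] [AddCommGroup B]
  [Module R A] [Module R B]

theorem Module.Injective.of_retraction (h : Module.Injective R A) (i : B →ₗ[R] A) (r : A →ₗ[R] B)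
    (hr : r ∘ₗ i = .id) : Module.Injective R B where
  out X Y _ _ _ _ f hf g := by
    obtain ⟨l, hl⟩ := h.out f hf (i ∘ₗ g)
    exact ⟨r ∘ₗ l, fun x => by simpa [hl] using LinearMap.congr_fun hr (g x)⟩

/-- Every element of `E` has a nonzero multiple in `K`. -/
def Submodule.Essential (K E : Submodule R A) : Prop :=
  ∀ x ∈ E, x ≠ 0 → ∃ a : R, a • x ∈ K ∧ a • x ≠ 0

theorem exists_maximal_essential (K : Submodule R A) :
    ∃ E : Submodule R A, K ≤ E ∧ K.Essential E ∧
      ∀ E' : Submodule R A, E ≤ E' → K.Essential E' → E' = E := by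
  obtain ⟨E, hKE, hE⟩ := zorn_le_nonempty₀ {E : Submodule R A | K.Essential E} (by
    intro c hc hcc y hy
    refine ⟨sSup c, fun x hx hx0 => ?_, fun z hz => le_sSup hz⟩
    obtain ⟨E, hE, hxE⟩ := (Submodule.mem_sSup_of_directed ⟨y, hy⟩ hcc.directedOn).1 hx
    exact hc hE x hxE hx0) K (fun x hx hx0 => ⟨1, by simpa using hx, by simpa using hx0⟩)
  exact ⟨E, hKE, hE.1, fun E' h1 h2 => (hE.eq_of_le h2 h1).symm⟩

theorem exists_maximal_disjoint (E : Submodule R A) :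
    ∃ S : Submodule R A, (∀ x ∈ S, x ∈ E → x = 0) ∧
      ∀ x ∉ S, ∃ a : R, ∃ s ∈ S, a • x + s ∈ E ∧ a • x + s ≠ 0 := by
  obtain ⟨S, hS⟩ := zorn_le₀ {S : Submodule R A | ∀ x ∈ S, x ∈ E → x = 0} (by
    intro c hc hcc
    rcases c.eq_empty_or_nonempty with rfl | ⟨y, hy⟩
    · exact ⟨⊥, fun x hx _ => by simpa using hx, by simp⟩
    refine ⟨sSup c, fun x hx hxE => ?_, fun z hz => le_sSup hz⟩
    obtain ⟨S, hS, hxS⟩ := (Submodule.mem_sSup_of_directed ⟨y, hy⟩ hcc.directedOn).1 hx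
    exact hc hS x hxS hxE)
  refine ⟨S, hS.1, fun x hx => ?_⟩
  by_contra! hcon
  refine hx (hS.2 (y := S ⊔ Submodule.span R {x}) (fun y hy hyE => ?_) le_sup_left
    (Submodule.mem_sup_right (Submodule.mem_span_singleton_self x)))
  obtain ⟨s, hs, z, hz, rfl⟩ := Submodule.mem_sup.1 hy
  obtain ⟨a, rfl⟩ := Submodule.mem_span_singleton.1 hz
  rw [add_comm] at hyE ⊢
  exact hcon a s hs hyE

/-- Existence of injective hulls. -/
theorem exists_injective_hull (R N : Type u) [CommRing R] [AddCommGroup N] [Module R N] :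
    ∃ (E : Type u) (_ : AddCommGroup E) (_ : Module R E) (j : N →ₗ[R] E), Module.Injective R E ∧
      Function.Injective j ∧ ∀ x : E, x ≠ 0 → ∃ (a : R) (y : N), a • x = j y ∧ a • x ≠ 0 := by
  obtain ⟨I, _, _, j, hI, hj⟩ := exists_injective_embedding R N
  obtain ⟨E, hKE, hE, hmax⟩ := exists_maximal_essential (LinearMap.range j)
  obtain ⟨S, hSE, hS⟩ := exists_maximal_disjoint E
  have hmono : Function.Injective (S.mkQ ∘ₗ E.subtype) := by
    rw [injective_iff_map_eq_zero]
    intro x hx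
    exact Subtype.ext (hSE x ((Submodule.Quotient.mk_eq_zero S).1 hx) x.2)
  obtain ⟨φ, hφ⟩ := Module.Injective.out (S.mkQ ∘ₗ E.subtype) hmono E.subtype
  have hφE (e : I) (he : e ∈ E) : φ (S.mkQ e) = e := hφ ⟨e, he⟩
  have hrange : LinearMap.range φ = E := by
    refine hmax _ (fun e he => ⟨_, hφE e he⟩) ?_
    rintro _ ⟨z, rfl⟩ hz0
    obtain ⟨x, rfl⟩ := S.mkQ_surjective z
    have hx : x ∉ S := fun hx => hz0 (by
      rw [Submodule.mkQ_apply, (Submodule.Quotient.mk_eq_zero S).2 hx, map_zero])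
    obtain ⟨a, s, hs, he, he0⟩ := hS x hx
    have h1 : a • φ (S.mkQ x) = a • x + s := by
      rw [← hφE _ he, map_add, map_smul, Submodule.mkQ_apply S s,
        (Submodule.Quotient.mk_eq_zero S).2 hs, add_zero, map_smul]
    obtain ⟨b, hb, hb0⟩ := hE _ he he0
    exact ⟨b * a, by rwa [mul_smul, h1], by rwa [mul_smul, h1]⟩
  let r : I →ₗ[R] E := (φ ∘ₗ S.mkQ).codRestrict E fun x => hrange ▸ ⟨_, rfl⟩
  have hr : r ∘ₗ E.subtype = .id := by
    ext e
    exact hφE e e.2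
  refine ⟨E, inferInstance, inferInstance, j.codRestrict E fun x => hKE ⟨x, rfl⟩,
    hI.of_retraction _ r hr, ?_, ?_⟩
  · exact fun x y h => hj (congrArg Subtype.val h)
  · intro x hx
    obtain ⟨a, ⟨y, hy⟩, ha⟩ := hE x x.2 (by simpa using hx)
    exact ⟨a, y, Subtype.ext hy.symm, fun h => ha (congrArg Subtype.val h)⟩


theorem exists_injective_residueField (q : Ideal R) [q.IsPrime] :
    ∃ (E : Type u) (_ : AddCommGroup E) (_ : Module R E) (u : E), Module.Injective R E ∧
      (∀ s ∉ q, Function.Bijective fun x : E => s • x) ∧ (∀ a : R, a • u = 0 ↔ a ∈ q) ∧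
      ∀ x : E, (∀ a ∈ q, a • x = 0) → ∃ s ∉ q, ∃ a : R, s • x = a • u := by
  obtain ⟨E, _, _, j, hE, hj, hess⟩ := exists_injective_hull R q.ResidueField
  have hu (a : R) : a • j 1 = 0 ↔ a ∈ q := by
    rw [← map_smul, map_eq_zero_iff j hj, Algebra.smul_def, mul_one,
      Ideal.algebraMap_residueField_eq_zero]
  have hdiv (s : R) (hs : s ∉ q) (k : q.ResidueField) : ∃ k', k = s • k' := by
    have h0 : algebraMap R q.ResidueField s ≠ 0 := by
      rwa [Ne, Ideal.algebraMap_residueField_eq_zero]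
    exact ⟨(algebraMap R q.ResidueField s)⁻¹ * k, by
      rw [Algebra.smul_def, mul_inv_cancel_left₀ h0]⟩
  have hinj (s : R) (hs : s ∉ q) (k : q.ResidueField) (hk : s • k = 0) : k = 0 := by
    have h0 : algebraMap R q.ResidueField s ≠ 0 := by
      rwa [Ne, Ideal.algebraMap_residueField_eq_zero]
    rw [Algebra.smul_def] at hk
    exact (mul_eq_zero.1 hk).resolve_left h0
  have hsE (s : R) (hs : s ∉ q) : Function.Injective (LinearMap.lsmul R E s) := by
    rw [injective_iff_map_eq_zero]
    intro x hx
    by_contra hx0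
    obtain ⟨a, y, hy, hy0⟩ := hess x hx0
    have h1 : s • y = 0 := hj (by
      rw [map_smul, ← hy, smul_comm, map_zero]
      exact (congrArg (a • ·) hx).trans (smul_zero a))
    rw [hy, hinj s hs y h1, map_zero] at hy0
    exact hy0 rfl
  refine ⟨E, inferInstance, inferInstance, j 1, hE, fun s hs => ⟨hsE s hs, ?_⟩, hu, ?_⟩
  · obtain ⟨r, hr⟩ := hE.out _ (hsE s hs) .id
    have hrinj : ∀ x, r x = 0 → x = 0 := by
      intro x hx
      by_contra hx0
      obtain ⟨a, y, hy, hy0⟩ := hess x hx0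
      obtain ⟨k, rfl⟩ := hdiv s hs y
      have h1 : j k = 0 := by
        have h2 := hr (j k)
        rw [LinearMap.lsmul_apply, ← map_smul, ← hy, map_smul, hx, smul_zero] at h2
        exact h2.symm
      rw [hy, map_smul, h1, smul_zero] at hy0
      exact hy0 rfl
    intro x
    refine ⟨r x, sub_eq_zero.1 (hrinj _ ?_)⟩
    have := hr (r x)
    rw [map_sub, sub_eq_zero]
    exact this
  · intro x hx
    by_cases hx0 : x = 0
    · exact ⟨1, Ideal.IsPrime.one_notMem ‹_›, 0, by simp [hx0]⟩
    obtain ⟨a, y, hy, hy0⟩ := hess x hx0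
    have ha : a ∉ q := fun ha => hy0 (hx a ha)
    obtain ⟨k, rfl⟩ := hdiv a ha y
    have hxk : x = j k := hsE a ha (by simpa using hy)
    obtain ⟨b, s, hs, hk⟩ : ∃ b s : R, s ∉ q ∧ s • k = b • 1 := by
      obtain ⟨⟨b, s⟩, h⟩ := IsLocalization.surj (nonZeroDivisors (R ⧸ q)) k
      obtain ⟨b, rfl⟩ := Ideal.Quotient.mk_surjective b
      obtain ⟨s', hs'⟩ := Ideal.Quotient.mk_surjective s.1
      refine ⟨b, s', fun hs => nonZeroDivisors.coe_ne_zero s ?_, ?_⟩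
      · rw [← hs', Ideal.Quotient.eq_zero_iff_mem]; exact hs
      · simp only [← hs'] at h
        rw [Algebra.smul_def, Algebra.smul_def, mul_one, mul_comm]
        exact h
    exact ⟨s, hs, b, by rw [hxk, ← map_smul, hk, map_smul]⟩

end

section
variable {R : Type u} [CommRing R] {A B E X J : Type u} [AddCommGroup A] [AddCommGroup B]
  [Module R A] [Module R B] [AddCommGroup E] [Module R E] [AddCommGroup X] [Module R X]
  [AddCommGroup J] [Module R J]

theorem LinearMap.map_mem_smul_top (f : A →ₗ[R] B) {I : Ideal R} {x : A}
    (hx : x ∈ I • (⊤ : Submodule R A)) : f x ∈ I • (⊤ : Submodule R B) :=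
  Submodule.smul_top_le_comap_smul_top I f hx

theorem mem_span_smul_top_iff {m : ℕ} (a : Fin m → R) {x : A} :
    x ∈ Ideal.span (Set.range a) • (⊤ : Submodule R A) ↔ ∃ c : Fin m → A, x = ∑ i, a i • c i := by
  constructor
  · intro hx
    induction hx using Submodule.smul_induction_on' with
    | smul r hr y _ =>
      obtain ⟨c, rfl⟩ := (Ideal.mem_span_range_iff_exists_fun).1 hr
      exact ⟨fun i => c i • y, by
        rw [Finset.sum_smul]
        exact Finset.sum_congr rfl fun i _ => by rw [mul_comm, mul_smul]⟩
    | add x _ y _ hx hy =>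
      obtain ⟨c, rfl⟩ := hx
      obtain ⟨d, rfl⟩ := hy
      exact ⟨c + d, by simp [Finset.sum_add_distrib]⟩
  · rintro ⟨c, rfl⟩
    exact Submodule.sum_mem _ fun i _ => Submodule.smul_mem_smul
      (Ideal.subset_span ⟨i, rfl⟩) trivial

theorem mem_smul_top_pi {I : Ideal R} (hI : I.FG) {ι : Type u} {N : ι → Type u}
    [∀ i, AddCommGroup (N i)] [∀ i, Module R (N i)] {t : ∀ i, N i}
    (ht : ∀ i, t i ∈ I • (⊤ : Submodule R (N i))) : t ∈ I • (⊤ : Submodule R (∀ i, N i)) := by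
  obtain ⟨m, a, rfl⟩ := Submodule.fg_iff_exists_fin_generating_family.1 hI
  choose c hc using fun i => (mem_span_smul_top_iff a).1 (ht i)
  refine (mem_span_smul_top_iff a).2 ⟨fun j i => c i j, ?_⟩
  ext i
  simpa [Finset.sum_apply] using hc i

theorem mem_smul_top_prod {I : Ideal R} {x : A} {y : B} (hx : x ∈ I • (⊤ : Submodule R A))
    (hy : y ∈ I • (⊤ : Submodule R B)) : (x, y) ∈ I • (⊤ : Submodule R (A × B)) := by
  have := add_mem ((LinearMap.inl R A B).map_mem_smul_top hx)
    ((LinearMap.inr R A B).map_mem_smul_top hy)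
  simpa using this

theorem hom_mem_smul_top {I : Ideal R} (hI : I.FG) (hJ : Module.Injective R J) (h : E →ₗ[R] J)
    (hh : ∀ x, (∀ a ∈ I, a • x = 0) → h x = 0) : h ∈ I • (⊤ : Submodule R (E →ₗ[R] J)) := by
  obtain ⟨m, a, rfl⟩ := Submodule.fg_iff_exists_fin_generating_family.1 hI
  let φ : E →ₗ[R] (Fin m → E) := LinearMap.pi fun i => LinearMap.lsmul R E (a i)
  have hker : LinearMap.ker φ ≤ LinearMap.ker h := by
    intro x hx
    refine hh x fun b hb => ?_
    obtain ⟨c, rfl⟩ := (Ideal.mem_span_range_iff_exists_fun).1 hb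
    rw [Finset.sum_smul]
    refine Finset.sum_eq_zero fun i _ => ?_
    have : a i • x = 0 := congrFun hx i
    rw [mul_smul, this, smul_zero]
  obtain ⟨l, hl⟩ := hJ.out ((LinearMap.ker φ).liftQ φ le_rfl)
    (LinearMap.ker_eq_bot.1 (Submodule.ker_liftQ_eq_bot _ _ _ le_rfl))
    ((LinearMap.ker φ).liftQ h hker)
  refine (mem_span_smul_top_iff a).2 ⟨fun i => l ∘ₗ LinearMap.single R (fun _ : Fin m => E) i, ?_⟩
  ext x
  have h1 := hl ((LinearMap.ker φ).mkQ x)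
  rw [Submodule.mkQ_apply, Submodule.liftQ_apply, Submodule.liftQ_apply] at h1
  rw [← h1, LinearMap.sum_apply]
  have h2 : φ x = ∑ i, Pi.single i (a i • x) := by
    rw [Finset.univ_sum_single (fun i => a i • x)]; rfl
  rw [h2, map_sum]
  refine Finset.sum_congr rfl fun i _ => ?_
  simp [Pi.single_smul]

theorem tmul_injective_of_bijective [Module.Flat R X] {s : R}
    (hs : Function.Injective fun x : E => s • x) :
    Function.Injective fun z : X ⊗[R] E => s • z := by
  have h := Module.Flat.lTensor_preserves_injective_linearMap (M := X) (LinearMap.lsmul R E s) hs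
  have h2 : ⇑((LinearMap.lsmul R E s).lTensor X) = fun z : X ⊗[R] E => s • z := by
    have : (LinearMap.lsmul R E s).lTensor X = LinearMap.lsmul R (X ⊗[R] E) s := by
      ext x e; simp
    rw [this]; rfl
  rwa [h2] at h

/-- The properties of an injective hull `E` of the residue field of `q`, with `u` a generator. -/
structure IsResidueHull (q : Ideal R) (u : E) : Prop where
  injective : Module.Injective R E
  bij : ∀ s ∉ q, Function.Bijective fun x : E => s • x
  smul_eq_zero : ∀ a : R, a • u = 0 ↔ a ∈ q
  exists_smul : ∀ x : E, (∀ a ∈ q, a • x = 0) → ∃ s ∉ q, ∃ a : R, s • x = a • u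

namespace IsResidueHull
variable {q : Ideal R} {u : E}

theorem exists_smul_tmul [IsNoetherianRing R] [q.IsPrime] [Module.Flat R X]
    (h : IsResidueHull q u) (z : X ⊗[R] E) (hz : ∀ a ∈ q, a • z = 0) :
    ∃ s ∉ q, ∃ x : X, s • z = x ⊗ₜ[R] u := by
  let φ : (R ⧸ q) →ₗ[R] X ⊗[R] E := q.liftQ (LinearMap.toSpanSingleton R _ z) hz
  obtain ⟨w, hw⟩ := (homTensor_bijective (A := R ⧸ q) (F := X) (N := E)).2 φ
  have hzw : z = homTensor R _ X E w (Ideal.Quotient.mk q 1) := by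
    rw [hw]
    exact (one_smul R z).symm
  rw [hzw]
  clear hzw hw φ hz
  induction w with
  | zero => exact ⟨1, Ideal.IsPrime.one_notMem ‹_›, 0, by simp⟩
  | tmul x k =>
    obtain ⟨s, hs, a, hk⟩ := h.exists_smul (k (Ideal.Quotient.mk q 1)) fun a ha => by
      rw [← map_smul]
      convert map_zero k
      rw [Algebra.smul_def, Ideal.Quotient.algebraMap_eq, map_one, mul_one]
      exact Ideal.Quotient.eq_zero_iff_mem.2 ha
    refine ⟨s, hs, a • x, ?_⟩
    rw [TensorProduct.lTensorHomToHomLTensor_apply, ← TensorProduct.tmul_smul, hk,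
      TensorProduct.tmul_smul, TensorProduct.smul_tmul']
  | add w₁ w₂ h1 h2 =>
    obtain ⟨s, hs, x, hx⟩ := h1
    obtain ⟨t, ht, y, hy⟩ := h2
    refine ⟨s * t, fun hst => (Ideal.IsPrime.mem_or_mem ‹_› hst).elim hs ht, t • x + s • y, ?_⟩
    rw [map_add, LinearMap.add_apply, smul_add, mul_smul, mul_smul, hy, smul_comm, hx,
      TensorProduct.add_tmul, TensorProduct.smul_tmul', TensorProduct.smul_tmul']

theorem mem_of_tmul_eq_zero [Module.Flat R X] (h : IsResidueHull q u) {x : X}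
    (hx : x ⊗ₜ[R] u = 0) : x ∈ q • (⊤ : Submodule R X) := by
  let φ : (R ⧸ q) →ₗ[R] E := q.liftQ (LinearMap.toSpanSingleton R _ u)
    fun a ha => (h.smul_eq_zero a).2 ha
  have hφ : Function.Injective φ := by
    rw [injective_iff_map_eq_zero]
    intro a ha
    obtain ⟨a, rfl⟩ := Ideal.Quotient.mk_surjective a
    exact Ideal.Quotient.eq_zero_iff_mem.2 ((h.smul_eq_zero a).1 ha)
  have h1 : x ⊗ₜ[R] (Ideal.Quotient.mk q 1) = 0 := by
    apply Module.Flat.lTensor_preserves_injective_linearMap (M := X) φ hφ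
    rw [map_zero, LinearMap.lTensor_tmul, ← hx]
    congr 1
    exact one_smul R u
  have h2 := congrArg (TensorProduct.tensorQuotEquivQuotSMul X q) h1
  rw [map_zero, TensorProduct.tensorQuotEquivQuotSMul_tmul_mk, one_smul] at h2
  exact (Submodule.Quotient.mk_eq_zero _).1 h2

theorem exists_sub_mem [IsNoetherianRing R] [q.IsPrime] [Module.Flat R X]
    (h : IsResidueHull q u) (t : E →ₗ[R] X ⊗[R] E) : ∃ s ∉ q, ∃ x : X,
      s • t - TensorProduct.mk R X E x ∈ q • (⊤ : Submodule R (E →ₗ[R] X ⊗[R] E)) := by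
  obtain ⟨s, hs, x, hx⟩ := h.exists_smul_tmul (t u) fun a ha => by
    rw [← map_smul, (h.smul_eq_zero a).2 ha, map_zero]
  refine ⟨s, hs, x, hom_mem_smul_top (IsNoetherian.noetherian q) (injective_tensor h.injective) _ fun y hy => ?_⟩
  obtain ⟨b, hb, a, hy⟩ := h.exists_smul y hy
  apply tmul_injective_of_bijective (X := X) (h.bij b hb).1
  simp only
  rw [← map_smul, hy, map_smul, smul_zero]
  simp [hx]

theorem mem_of_mk_mem [IsNoetherianRing R] [Module.Flat R X] (h : IsResidueHull q u) {x : X}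
    (hx : TensorProduct.mk R X E x ∈ q • (⊤ : Submodule R (E →ₗ[R] X ⊗[R] E))) :
    x ∈ q • (⊤ : Submodule R X) := by
  apply h.mem_of_tmul_eq_zero
  have key : ∀ t ∈ q • (⊤ : Submodule R (E →ₗ[R] X ⊗[R] E)), t u = 0 := by
    intro t ht
    induction ht using Submodule.smul_induction_on' with
    | smul r hr y _ =>
      rw [LinearMap.smul_apply, ← map_smul, (h.smul_eq_zero r).2 hr, map_zero]
    | add x _ y _ hx hy => rw [LinearMap.add_apply, hx, hy, add_zero]
  exact key _ hx

theorem hom_mem_smul_top_of_not_le {q' : Ideal R} (h : IsResidueHull q u) (hq : ¬ q' ≤ q)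
    (t : E →ₗ[R] J) : t ∈ q' • (⊤ : Submodule R (E →ₗ[R] J)) := by
  obtain ⟨a, ha, haq⟩ := Set.not_subset.1 hq
  let e : E ≃ₗ[R] E := LinearEquiv.ofBijective (LinearMap.lsmul R E a) (h.bij a haq)
  have : t = a • (t ∘ₗ e.symm.toLinearMap) := by
    ext x
    obtain ⟨y, rfl⟩ := e.surjective x
    rw [LinearMap.smul_apply, LinearMap.comp_apply, LinearEquiv.coe_coe, e.symm_apply_apply,
      ← map_smul]
    rfl
  rw [this]
  exact Submodule.smul_mem_smul ha trivial

end IsResidueHull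

end

section
variable {R : Type u} [CommRing R] {X Y W : Type u} [AddCommGroup X] [Module R X]
  [AddCommGroup Y] [Module R Y] [AddCommGroup W] [Module R W] {ι : Type u}

/-- The product of the modules `Hom(E i, X ⊗ E i)`. -/
abbrev HomTensorPi (E : ι → ModuleCat.{u} R) (X : Type u) [AddCommGroup X] [Module R X] : Type u :=
  ∀ i, E i →ₗ[R] X ⊗[R] E i

namespace HomTensorPi
variable (E : ι → ModuleCat.{u} R)

/-- The functoriality of `HomTensorPi`. -/
noncomputable def map (f : X →ₗ[R] Y) : HomTensorPi E X →ₗ[R] HomTensorPi E Y :=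
  LinearMap.pi fun i => (f.rTensor (E i)).compRight R ∘ₗ LinearMap.proj i

@[simp] theorem map_apply (f : X →ₗ[R] Y) (t : HomTensorPi E X) (i : ι) :
    map E f t i = f.rTensor (E i) ∘ₗ t i := rfl

variable (R X) in
/-- The canonical map to `HomTensorPi`. -/
noncomputable def unit : X →ₗ[R] HomTensorPi E X :=
  LinearMap.pi fun i => TensorProduct.mk R X (E i)

@[simp] theorem unit_apply (x : X) (i : ι) : unit R X E x i = TensorProduct.mk R X (E i) x := rfl

theorem map_unit (f : X →ₗ[R] Y) (x : X) : map E f (unit R X E x) = unit R Y E (f x) := by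
  ext i y
  simp

theorem map_map (f : X →ₗ[R] Y) (g : Y →ₗ[R] W) (h : g ∘ₗ f = 0) (t : HomTensorPi E X) :
    map E g (map E f t) = 0 := by
  funext i
  rw [map_apply, map_apply, ← LinearMap.comp_assoc, ← LinearMap.rTensor_comp, h,
    LinearMap.rTensor_zero, LinearMap.zero_comp]
  rfl

variable {E} [IsNoetherianRing R]

theorem flat [Module.Flat R X] (hE : ∀ i, Module.Injective R (E i)) :
    Module.Flat R (HomTensorPi E X) :=
  have := fun i => (flat_and_cotor_hom_of_injective (hE i) (injective_tensor (F := X) (hE i))).1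
  flat_pi

theorem cotor [Module.Flat R X] (hE : ∀ i, Module.Injective R (E i)) :
    Cotor R (HomTensorPi E X) := fun F _ _ _ => Perp.pi fun i =>
  (flat_and_cotor_hom_of_injective (hE i) (injective_tensor (F := X) (hE i))).2 F

theorem mem_of_forall_not_le {q : Ideal R} {p : ι → Ideal R} {u : ∀ i, E i}
    (h : ∀ i, IsResidueHull (p i) (u i)) (hq : ∀ i, ¬ q ≤ p i) (t : HomTensorPi E X) :
    t ∈ q • (⊤ : Submodule R (HomTensorPi E X)) :=
  mem_smul_top_pi (IsNoetherian.noetherian q) fun i =>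
    (h i).hom_mem_smul_top_of_not_le (hq i) (t i)

theorem exists_sub_mem {q : Ideal R} [q.IsPrime] [Module.Flat R X] {p : ι → Ideal R}
    {u : ∀ i, E i} (h : ∀ i, IsResidueHull (p i) (u i)) (i : ι) (hi : p i = q)
    (hq : ∀ j, q ≤ p j → j = i) (t : HomTensorPi E X) : ∃ s ∉ q, ∃ x : X,
      s • t - unit R X E x ∈ q • (⊤ : Submodule R (HomTensorPi E X)) := by
  subst hi
  obtain ⟨s, hs, x, hx⟩ := (h i).exists_sub_mem (t i)
  refine ⟨s, hs, x, mem_smul_top_pi (IsNoetherian.noetherian _) fun j => ?_⟩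
  by_cases hj : p i ≤ p j
  · obtain rfl := hq j hj
    exact hx
  · exact (h j).hom_mem_smul_top_of_not_le hj _

theorem mem_of_unit_mem [Module.Flat R X] {p : ι → Ideal R}
    {u : ∀ i, E i} (h : ∀ i, IsResidueHull (p i) (u i)) (i : ι) {x : X}
    (hx : unit R X E x ∈ p i • (⊤ : Submodule R (HomTensorPi E X))) :
    x ∈ p i • (⊤ : Submodule R X) :=
  (h i).mem_of_mk_mem (LinearMap.map_mem_smul_top
    (LinearMap.proj i : HomTensorPi E X →ₗ[R] E i →ₗ[R] X ⊗[R] E i) hx)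

end HomTensorPi

/-- A cochain complex of modules indexed by the natural numbers. -/
structure NatCochain (R : Type u) [CommRing R] where
  X : ℕ → ModuleCat.{u} R
  d : ∀ n, X n →ₗ[R] X (n + 1)
  d_d : ∀ n x, d (n + 1) (d n x) = 0

namespace NatCochain

/-- Exactness in positive degrees modulo `q`, after localizing at `q`. -/
def ExactAt (Y : NatCochain R) (q : Ideal R) : Prop :=
  ∀ n (y : Y.X (n + 1)), Y.d (n + 1) y ∈ q • (⊤ : Submodule R (Y.X (n + 1 + 1))) →
    ∃ s ∉ q, ∃ z : Y.X n, s • y - Y.d n z ∈ q • (⊤ : Submodule R (Y.X (n + 1)))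

/-- Exactness in positive degrees modulo `I`. -/
def ExactMod (Y : NatCochain R) (I : Ideal R) : Prop :=
  ∀ n (y : Y.X (n + 1)), Y.d (n + 1) y ∈ I • (⊤ : Submodule R (Y.X (n + 1 + 1))) →
    ∃ z : Y.X n, y - Y.d n z ∈ I • (⊤ : Submodule R (Y.X (n + 1)))

variable (E : ι → ModuleCat.{u} R) (Y : NatCochain R)

/-- The modules of the shifted mapping cone of `Y → HomTensorPi E Y`. -/
noncomputable def coneX : ℕ → ModuleCat.{u} R
  | 0 => Y.X 0
  | n + 1 => ModuleCat.of R (Y.X (n + 1) × HomTensorPi E (Y.X n))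

/-- The differential of the shifted mapping cone of `Y → HomTensorPi E Y`. -/
noncomputable def coneD : ∀ n, Y.coneX E n →ₗ[R] Y.coneX E (n + 1)
  | 0 => (Y.d 0).prod (HomTensorPi.unit R (Y.X 0) E)
  | n + 1 => (Y.d (n + 1) ∘ₗ LinearMap.fst R (Y.X (n + 1)) (HomTensorPi E (Y.X n))).prod
      (HomTensorPi.unit R (Y.X (n + 1)) E ∘ₗ LinearMap.fst R _ (HomTensorPi E (Y.X n)) -
        HomTensorPi.map E (Y.d n) ∘ₗ LinearMap.snd R (Y.X (n + 1)) _)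

theorem d_comp_d (n : ℕ) : Y.d (n + 1) ∘ₗ Y.d n = 0 := LinearMap.ext (Y.d_d n)

/-- The shifted mapping cone of `Y → HomTensorPi E Y`. -/
noncomputable def cone : NatCochain R where
  X := Y.coneX E
  d := Y.coneD E
  d_d := by
    rintro (_ | n) x
    · refine Prod.ext (Y.d_d 0 x) ?_
      exact sub_eq_zero.2 (HomTensorPi.map_unit E (Y.d 0) x).symm
    · refine Prod.ext (Y.d_d (n + 1) x.1) ?_
      change HomTensorPi.unit R _ E (Y.d (n + 1) x.1) - HomTensorPi.map E (Y.d (n + 1))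
        (HomTensorPi.unit R _ E x.1 - HomTensorPi.map E (Y.d n) x.2) = 0
      rw [map_sub, HomTensorPi.map_map E _ _ (Y.d_comp_d n), HomTensorPi.map_unit, sub_zero,
        sub_self]

theorem exists_lift_cone (n : ℕ) (z : Y.X n) : ∃ w : (Y.cone E).X n, (Y.cone E).d n w =
    ((Y.d n z, HomTensorPi.unit R (Y.X n) E z) : Y.X (n + 1) × HomTensorPi E (Y.X n)) := by
  cases n with
  | zero => exact ⟨z, rfl⟩
  | succ n =>
    refine ⟨((z, 0) : Y.X (n + 1) × HomTensorPi E (Y.X n)), Prod.ext rfl ?_⟩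
    exact (congrArg₂ _ rfl (map_zero (HomTensorPi.map E (Y.d n)))).trans (sub_zero _)

variable {E Y}

theorem ExactAt.cone {q : Ideal R} (hY : Y.ExactAt q)
    (hq : ∀ (X : Type u) [AddCommGroup X] [Module R X] (t : HomTensorPi E X),
      t ∈ q • (⊤ : Submodule R (HomTensorPi E X))) : (Y.cone E).ExactAt q := by
  intro n y hy
  obtain ⟨s, hs, z, hz⟩ := hY n y.1 (LinearMap.map_mem_smul_top (LinearMap.fst R (Y.X (n + 1 + 1))
    (HomTensorPi E (Y.X (n + 1)))) hy)
  obtain ⟨w, hw⟩ := Y.exists_lift_cone E n z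
  refine ⟨s, hs, w, ?_⟩
  rw [hw]
  exact mem_smul_top_prod hz (hq _ _)

theorem exactAt_cone {q : Ideal R} (hY : ∀ n, Module.Flat R (Y.X n))
    (h1 : ∀ (X : Type u) [AddCommGroup X] [Module R X] [Module.Flat R X] (t : HomTensorPi E X),
      ∃ s ∉ q, ∃ x : X,
      s • t - HomTensorPi.unit R X E x ∈ q • (⊤ : Submodule R (HomTensorPi E X)))
    (h2 : ∀ (X : Type u) [AddCommGroup X] [Module R X] [Module.Flat R X] (x : X),
      HomTensorPi.unit R X E x ∈ q • (⊤ : Submodule R (HomTensorPi E X)) →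
        x ∈ q • (⊤ : Submodule R X)) : (Y.cone E).ExactAt q := by
  intro n y hy
  obtain ⟨s, hs, z, hz⟩ := h1 (Y.X n) y.2
  obtain ⟨w, hw⟩ := Y.exists_lift_cone E n z
  refine ⟨s, hs, w, ?_⟩
  rw [hw]
  refine mem_smul_top_prod (h2 _ _ ?_) hz
  have hy2 := LinearMap.map_mem_smul_top (LinearMap.snd R (Y.X (n + 1 + 1))
    (HomTensorPi E (Y.X (n + 1)))) hy
  change HomTensorPi.unit R (Y.X (n + 1)) E y.1 - HomTensorPi.map E (Y.d n) y.2 ∈ _ at hy2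
  have h3 := add_mem (Submodule.smul_mem _ s hy2)
    (LinearMap.map_mem_smul_top (HomTensorPi.map E (Y.d n)) hz)
  rw [map_sub, map_smul, HomTensorPi.map_unit, smul_sub, sub_add_sub_cancel, ← map_smul,
    ← map_sub] at h3
  exact h3

theorem mem_colon_smul_top {X : Type u} [AddCommGroup X] [Module R X] [Module.Flat R X]
    {I : Ideal R} {a : R} {x : X} (hx : a • x ∈ I • (⊤ : Submodule R X)) :
    x ∈ (Submodule.comap (LinearMap.lsmul R R a) I) • (⊤ : Submodule R X) := by
  let K : Ideal R := Submodule.comap (LinearMap.lsmul R R a) I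
  let φ : (R ⧸ K) →ₗ[R] (R ⧸ I) := Submodule.mapQ K I (LinearMap.lsmul R R a) le_rfl
  have hφ : Function.Injective φ := by
    rw [injective_iff_map_eq_zero]
    intro b hb
    obtain ⟨b, rfl⟩ := Submodule.mkQ_surjective _ b
    exact (Submodule.Quotient.mk_eq_zero K).2 ((Submodule.Quotient.mk_eq_zero I).1 hb)
  have h1 : x ⊗ₜ[R] (Ideal.Quotient.mk K 1) = 0 := by
    apply Module.Flat.lTensor_preserves_injective_linearMap (M := X) φ hφ
    rw [map_zero, LinearMap.lTensor_tmul]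
    apply (TensorProduct.tensorQuotEquivQuotSMul X I).injective
    have : φ (Ideal.Quotient.mk K 1) = Ideal.Quotient.mk I a :=
      congrArg (Ideal.Quotient.mk I) (mul_one a)
    rw [this, TensorProduct.tensorQuotEquivQuotSMul_tmul_mk, map_zero]
    exact (Submodule.Quotient.mk_eq_zero _).2 hx
  have h2 := congrArg (TensorProduct.tensorQuotEquivQuotSMul X K) h1
  rw [map_zero, TensorProduct.tensorQuotEquivQuotSMul_tmul_mk, one_smul] at h2
  exact (Submodule.Quotient.mk_eq_zero _).1 h2

theorem mem_sup_span_smul_top {X : Type u} [AddCommGroup X] [Module R X] {I : Ideal R} {a : R}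
    {x : X} (hx : x ∈ (I ⊔ Ideal.span {a}) • (⊤ : Submodule R X)) :
    ∃ i ∈ I • (⊤ : Submodule R X), ∃ w, x = i + a • w := by
  rw [Submodule.sup_smul, Submodule.ideal_span_singleton_smul] at hx
  obtain ⟨i, hi, j, hj, rfl⟩ := Submodule.mem_sup.1 hx
  obtain ⟨w, -, rfl⟩ := (Submodule.mem_smul_pointwise_iff_exists _ _ _).1 hj
  exact ⟨i, hi, w, rfl⟩

theorem exactMod_of_exactAt [IsNoetherianRing R] (hY : ∀ n, Module.Flat R (Y.X n)) (h0 : Subsingleton (Y.X 0))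
    (h : ∀ q : Ideal R, q.IsPrime → Y.ExactAt q) (I : Ideal R) : Y.ExactMod I := by
  refine IsNoetherian.induction (P := fun I : Ideal R => Y.ExactMod I) (fun I ih => ?_) I
  replace ih : ∀ J : Ideal R, I < J → Y.ExactMod J := ih
  change Ideal R at I
  have hlt : ∀ a ∉ I, I < I ⊔ Ideal.span {a} := fun a ha =>
    lt_of_le_of_ne le_sup_left fun he => ha (he ▸ le_sup_right (a := I)
      (Ideal.mem_span_singleton_self a))
  intro n y hy
  by_cases htop : I = ⊤
  · exact ⟨0, by rw [htop, Submodule.top_smul]; trivial⟩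
  by_cases hI : I.IsPrime
  · obtain ⟨s, hs, z, hz⟩ := h I hI n y hy
    obtain ⟨v, i, hi, hzv⟩ : ∃ v : Y.X n, ∃ i ∈ I • (⊤ : Submodule R (Y.X (n + 1))),
        Y.d n z = i + s • Y.d n v := by
      cases n with
      | zero => exact ⟨0, 0, zero_mem _, by rw [Subsingleton.elim z 0]; simp⟩
      | succ n =>
        obtain ⟨w, hw⟩ := ih _ (hlt s hs) n z (by
          have h1 : Y.d (n + 1) z = s • y - (s • y - Y.d (n + 1) z) := by abel
          rw [h1]
          refine sub_mem (Submodule.smul_mem_smul (le_sup_right (a := I)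
            (Ideal.mem_span_singleton_self s)) trivial)
            (Submodule.smul_mono_left le_sup_left hz))
        obtain ⟨i, hi, v, hv⟩ := mem_sup_span_smul_top hw
        refine ⟨v, Y.d (n + 1) i, LinearMap.map_mem_smul_top _ hi, ?_⟩
        rw [← map_smul, ← map_add, ← hv, map_sub, Y.d_d, sub_zero]
    refine ⟨v, ?_⟩
    have h1 : s • (y - Y.d n v) ∈ I • (⊤ : Submodule R (Y.X (n + 1))) := by
      have : s • (y - Y.d n v) = (s • y - Y.d n z) + i := by rw [hzv, smul_sub]; abel
      rw [this]
      exact add_mem hz hi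
    have h2 : Submodule.comap (LinearMap.lsmul R R s) I ≤ I := fun b hb =>
      (hI.mem_or_mem hb).resolve_left hs
    exact Submodule.smul_mono_left h2 (mem_colon_smul_top h1)
  · obtain ⟨a, ha, b, hb, hab⟩ : ∃ a ∉ I, ∃ b ∉ I, a * b ∈ I := by
      by_contra! hc
      exact hI ⟨htop, fun {a b} hab => or_iff_not_imp_left.2 fun ha => by
        by_contra hb
        exact hc a ha b hb hab⟩
    obtain ⟨z, hz⟩ := ih _ (hlt a ha) n y (Submodule.smul_mono_left le_sup_left hy)
    obtain ⟨i, hi, w, hw⟩ := mem_sup_span_smul_top hz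
    have h1 : a • Y.d (n + 1) w ∈ I • (⊤ : Submodule R (Y.X (n + 1 + 1))) := by
      have : a • Y.d (n + 1) w = Y.d (n + 1) y - Y.d (n + 1) i := by
        have h2 := congrArg (Y.d (n + 1)) hw
        rw [map_sub, Y.d_d, sub_zero, map_add, map_smul] at h2
        rw [h2]; abel
      rw [this]
      exact sub_mem hy (LinearMap.map_mem_smul_top _ hi)
    obtain ⟨v, hv⟩ := ih (Submodule.comap (LinearMap.lsmul R R a) I)
      (lt_of_le_of_ne (fun c hc => I.mul_mem_left a hc) fun he => hb (by rw [he]; exact hab))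
      n w (mem_colon_smul_top h1)
    refine ⟨z + a • v, ?_⟩
    have h3 : y - Y.d n (z + a • v) = i + a • (w - Y.d n v) := by
      rw [map_add, map_smul, smul_sub, ← sub_sub, hw]; abel
    rw [h3]
    refine add_mem hi ?_
    have h4 : ∀ x ∈ Submodule.comap (LinearMap.lsmul R R a) I • (⊤ : Submodule R (Y.X (n + 1))),
        a • x ∈ I • (⊤ : Submodule R (Y.X (n + 1))) := by
      intro x hx
      induction hx using Submodule.smul_induction_on' with
      | smul r hr y _ => rw [← mul_smul]; exact Submodule.smul_mem_smul hr trivial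
      | add x _ y _ hx hy => rw [smul_add]; exact add_mem hx hy
    exact h4 _ hv

end NatCochain

end

section
variable {R : Type u} [CommRing R] {X : Type u} [AddCommGroup X] [Module R X] {ι : Type u}

instance HomTensorPi.subsingleton (E : ι → ModuleCat.{u} R) [Subsingleton X] :
    Subsingleton (HomTensorPi E X) :=
  ⟨fun s t => by
    funext i
    ext x
    have : Subsingleton (X ⊗[R] E i) := subsingleton_of_forall_eq 0 fun z => by
      induction z with
      | zero => rfl
      | tmul x y => rw [Subsingleton.elim x 0, TensorProduct.zero_tmul]
      | add x y hx hy => rw [hx, hy, add_zero]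
    exact Subsingleton.elim _ _⟩

variable (R X) in
/-- The complex with the single module `X` in degree one. -/
def NatCochain.single : NatCochain R where
  X n := match n with
    | 1 => ModuleCat.of R X
    | _ => ModuleCat.of R PUnit.{u + 1}
  d _ := 0
  d_d _ _ := rfl

theorem exists_primeSpectrum_isResidueHull [IsNoetherianRing R] :
    ∃ (E : PrimeSpectrum R → ModuleCat.{u} R) (u : ∀ p, E p),
      ∀ p, IsResidueHull p.asIdeal (u p) := by
  have h : ∀ p : PrimeSpectrum R, ∃ (E : ModuleCat.{u} R) (u : E),
      IsResidueHull p.asIdeal u := fun p => by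
    obtain ⟨E, _, _, u, h1, h2, h3, h4⟩ := exists_injective_residueField p.asIdeal
    exact ⟨ModuleCat.of R E, u, h1, h2, h3, h4⟩
  choose E u h using h
  exact ⟨E, u, h⟩

theorem exists_natCochain_exactAt [IsNoetherianRing R] [Module.Flat R X] (δ : PrimeSpectrum R → ℕ)
    (hδ : ∀ p q, p < q → δ q < δ p) (e : ℕ) : ∃ Y : NatCochain R, (∀ n, Module.Flat R (Y.X n)) ∧
      Subsingleton (Y.X 0) ∧ Nonempty (Y.X 1 ≃ₗ[R] X) ∧ (∀ n, Cotor R (Y.X (n + 2))) ∧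
      (∀ n, e + 2 ≤ n → Subsingleton (Y.X n)) ∧
      ∀ q : PrimeSpectrum R, δ q < e → Y.ExactAt q.asIdeal := by
  induction e with
  | zero =>
    have hP : Module.Injective R PUnit.{u + 1} :=
      ⟨fun _ _ _ _ _ _ _ _ _ => ⟨0, fun _ => Subsingleton.elim _ _⟩⟩
    refine ⟨NatCochain.single R X, fun n => ?_, inferInstanceAs (Subsingleton PUnit.{u + 1}),
      ⟨LinearEquiv.refl R X⟩, fun n F _ _ _ => Perp.of_injective (N := PUnit.{u + 1}) hP,
      fun n hn => ?_, fun q hq => absurd hq (Nat.not_lt_zero _)⟩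
    · match n with
      | 0 => exact inferInstanceAs (Module.Flat R PUnit.{u + 1})
      | 1 => assumption
      | n + 2 => exact inferInstanceAs (Module.Flat R PUnit.{u + 1})
    · match n, hn with
      | n + 2, _ => exact inferInstanceAs (Subsingleton PUnit.{u + 1})
  | succ e ih =>
    obtain ⟨Y, h1, h2, ⟨h3⟩, h4, h5, h6⟩ := ih
    obtain ⟨E, u, hu⟩ := exists_primeSpectrum_isResidueHull (R := R)
    let E' : {p : PrimeSpectrum R // δ p = e} → ModuleCat.{u} R := fun p => E p.1
    have hinj : ∀ p, Module.Injective R (E' p) := fun p => (hu p.1).injective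
    have hprod : ∀ (A B : Type u) [AddCommGroup A] [AddCommGroup B] [Module R A] [Module R B],
        SES (LinearMap.inl R A B) (LinearMap.snd R A B) := fun A B _ _ _ _ =>
      ⟨LinearMap.inl_injective, .inl_snd, LinearMap.snd_surjective⟩
    refine ⟨Y.cone E', fun n => ?_, h2, ⟨?_⟩, fun n => ?_, fun n hn => ?_, fun q hq => ?_⟩
    · cases n with
      | zero => exact h1 0
      | succ n =>
        have := HomTensorPi.flat (X := Y.X n) hinj
        exact flat_extension (hprod _ _)
    · refine LinearEquiv.trans (LinearEquiv.ofBijective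
        (LinearMap.fst R (Y.X 1) (HomTensorPi E' (Y.X 0))) ⟨?_, LinearMap.fst_surjective⟩) h3
      intro a b hab
      exact Prod.ext hab (Subsingleton.elim _ _)
    · exact (h4 n).cov_mid (hprod _ _) (HomTensorPi.cotor hinj)
    · obtain ⟨n, rfl⟩ : ∃ m, n = m + 1 := ⟨n - 1, by omega⟩
      have := h5 (n + 1) (by omega)
      have := h5 n (by omega)
      exact inferInstanceAs (Subsingleton (Y.X (n + 1) × HomTensorPi E' (Y.X n)))
    · rcases (Nat.lt_succ_iff.1 hq).lt_or_eq with hq | hq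
      · refine (h6 q hq).cone fun X _ _ t => HomTensorPi.mem_of_forall_not_le
          (fun p => hu p.1) (fun p hp => ?_) t
        rcases (show q ≤ p.1 from hp).lt_or_eq with h | h
        · have := hδ _ _ h
          have := p.2
          omega
        · have := p.2
          rw [← h] at this
          omega
      · have hu' : ∀ p : {p : PrimeSpectrum R // δ p = e},
            IsResidueHull p.1.asIdeal (u p.1) := fun p => hu p.1
        have hmax : ∀ p : {p : PrimeSpectrum R // δ p = e}, q.asIdeal ≤ p.1.asIdeal →
            p = ⟨q, hq⟩ := fun p hp => by
          rcases (show q ≤ p.1 from hp).lt_or_eq with h | h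
          · have := hδ _ _ h
            have := p.2
            omega
          · exact Subtype.ext h.symm
        exact NatCochain.exactAt_cone h1
          (fun X _ _ _ t => HomTensorPi.exists_sub_mem hu' ⟨q, hq⟩ rfl hmax t)
          (fun X _ _ _ x hx => HomTensorPi.mem_of_unit_mem hu' ⟨q, hq⟩ hx)

theorem exists_primeSpectrum_rank (hdim : ringKrullDim R < ⊤) :
    ∃ (δ : PrimeSpectrum R → ℕ) (e : ℕ), (∀ p q, p < q → δ q < δ p) ∧ ∀ p, δ p < e := by
  obtain ⟨e, he⟩ : ∃ e : ℕ, ringKrullDim R < e := by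
    generalize ringKrullDim R = x at hdim
    induction x with
    | bot => exact ⟨0, WithBot.bot_lt_coe _⟩
    | coe x =>
      induction x with
      | top => exact absurd hdim (lt_irrefl _)
      | coe x => exact ⟨x + 1, by exact_mod_cast Nat.lt_succ_self x⟩
  have h : ∀ p : PrimeSpectrum R, Order.coheight p < e := fun p => by
    exact_mod_cast (Order.coheight_le_krullDim p).trans_lt he
  have h' : ∀ p : PrimeSpectrum R, Order.coheight p ≠ ⊤ := fun p => (lt_top_of_lt (h p)).ne
  refine ⟨fun p => (Order.coheight p).toNat, e, fun p q hpq => ?_, fun p => ?_⟩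
  · have := Order.coheight_strictAnti hpq (lt_top_of_lt (h q))
    rw [← ENat.natCast_toNat (h' p), ← ENat.natCast_toNat (h' q)] at this
    exact_mod_cast this
  · have := h p
    rw [← ENat.natCast_toNat (h' p)] at this
    exact_mod_cast this

theorem exists_extV_flat_flat [IsNoetherianRing R] (hdim : ringKrullDim R < ⊤) :
    ∃ d, ∀ (F X : Type u) [AddCommGroup F] [Module R F] [AddCommGroup X] [Module R X]
      [Module.Flat R F] [Module.Flat R X] (k : ℕ), ExtV R F X (d + k + 1) := by
  obtain ⟨δ, e, hδ, he⟩ := exists_primeSpectrum_rank hdim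
  refine ⟨e + 2, fun F X _ _ _ _ _ _ k => ?_⟩
  obtain ⟨Y, h1, h2, ⟨h3⟩, h4, h5, h6⟩ := exists_natCochain_exactAt (X := X) δ hδ e
  have hex : ∀ n (y : Y.X (n + 1)), Y.d (n + 1) y = 0 → ∃ z, Y.d n z = y := fun n y hy => by
    obtain ⟨z, hz⟩ := NatCochain.exactMod_of_exactAt h1 h2 (fun q hq => h6 ⟨q, hq⟩ (he _)) ⊥ n y
      (by rw [hy]; exact zero_mem _)
    rw [Submodule.bot_smul, Submodule.mem_bot, sub_eq_zero] at hz
    exact ⟨z, hz.symm⟩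
  have key : ∀ j n, e + 2 ≤ (n + 2) + j → ∀ k, ExtV R F (LinearMap.ker (Y.d (n + 2))) (j + k + 1) := by
    intro j
    induction j with
    | zero =>
      intro n hn k
      have := h5 (n + 2) hn
      exact Perp.of_injective
        ⟨fun _ _ _ _ _ _ _ _ _ => ⟨0, fun _ => Subsingleton.elim _ _⟩⟩ _
    | succ j ih =>
      intro n hn k
      let g : Y.X (n + 2) →ₗ[R] LinearMap.ker (Y.d (n + 3)) :=
        (Y.d (n + 2)).codRestrict _ fun x => Y.d_d (n + 2) x
      have hg : Function.Surjective g := by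
        rintro ⟨y, hy⟩
        obtain ⟨z, hz⟩ := hex (n + 2) y hy
        exact ⟨z, Subtype.ext hz⟩
      have hker : LinearMap.ker g = LinearMap.ker (Y.d (n + 2)) := LinearMap.ker_codRestrict _ _ _
      have hS := SES.of_surjective hg
      have := (ih (n + 1) (by omega) k).cov_left hS (h4 n F (j + k + 1))
      rw [hker] at this
      rwa [show j + 1 + k + 1 = j + k + 1 + 1 by omega]
  let f : Y.X 1 →ₗ[R] LinearMap.ker (Y.d 2) := (Y.d 1).codRestrict _ fun x => Y.d_d 1 x
  have hf : Function.Bijective f := by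
    constructor
    · rw [injective_iff_map_eq_zero]
      intro x hx
      obtain ⟨z, rfl⟩ := hex 0 x (congrArg Subtype.val hx)
      rw [Subsingleton.elim z 0, map_zero]
    · rintro ⟨y, hy⟩
      obtain ⟨z, hz⟩ := hex 1 y hy
      exact ⟨z, Subtype.ext hz⟩
  exact (key (e + 2) 0 (by omega) k).congr_right
    ((LinearEquiv.ofBijective f hf).symm.trans h3)

theorem SES.projective_right {A B D : Type u} [AddCommGroup A] [AddCommGroup B] [AddCommGroup D]
    [Module R A] [Module R B] [Module R D] {f : A →ₗ[R] B} {g : B →ₗ[R] D}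
    [Module.Projective R B] (h : SES f g) (h1 : ExtV R D A 1) : Module.Projective R D := by
  obtain ⟨l, hl⟩ := h1.lift h .id
  exact Module.Projective.of_split l g hl

/-- Over a noetherian ring of finite Krull dimension, flat modules have bounded projective
dimension. -/
theorem exists_extV_flat [IsNoetherianRing R] (hdim : ringKrullDim R < ⊤) :
    ∃ d, ∀ (F N : Type u) [AddCommGroup F] [Module R F] [AddCommGroup N] [Module R N]
      [Module.Flat R F] (k : ℕ), ExtV R F N (d + k + 1) := by
  obtain ⟨d, hd⟩ := exists_extV_flat_flat hdim
  refine ⟨d, fun F N _ _ _ _ _ k => ?_⟩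
  have key : ∀ (j i : ℕ), i + j = d → ∀ (K : Type u) [AddCommGroup K] [Module R K] [Module.Flat R K],
      (∀ (X : Type u) [AddCommGroup X] [Module R X] [Module.Flat R X] (k : ℕ),
        ExtV R K X (j + k + 1)) → ∀ k, ExtV R K N (j + k + 1) := by
    intro j
    induction j with
    | zero =>
      intro i hi K _ _ _ hK k
      obtain ⟨L, P, _, _, _, _, l, p, hP, hS⟩ := exists_free_ses R K
      have := flat_kernel hS
      have := hS.projective_right (hK L 0)
      exact ExtV.of_projective _
    | succ j ih =>
      intro i hi K _ _ _ hK k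
      obtain ⟨L, P, _, _, _, _, l, p, hP, hS⟩ := exists_free_ses R K
      have := flat_kernel hS
      rw [show j + 1 + k + 1 = j + k + 2 by omega, ExtV.shift_right hS]
      refine ih (i + 1) (by omega) L (fun X _ _ _ k => ?_) k
      rw [← ExtV.shift_right hS, show j + k + 2 = j + 1 + k + 1 by omega]
      exact hK X k
  exact key d 0 (by omega) F (fun X _ _ _ k => hd F X k) k

end

section
variable {R : Type u} [CommRing R] {A B S Z L K N T : Type u} [AddCommGroup A] [AddCommGroup B]
  [AddCommGroup S] [AddCommGroup Z] [AddCommGroup L] [AddCommGroup K] [AddCommGroup N]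
  [AddCommGroup T] [Module R A] [Module R B] [Module R S] [Module R Z] [Module R L] [Module R K]
  [Module R N] [Module R T]

/-- `B` is the pushout of `i : S → A` and `f : S → Z`. -/
structure IsPushoutSq (i : S →ₗ[R] A) (f : S →ₗ[R] Z) (a : A →ₗ[R] B) (z : Z →ₗ[R] B) : Prop where
  comm : ∀ s, a (i s) = z (f s)
  surj : ∀ b, ∃ x y, a x + z y = b
  ker : ∀ x y, a x = z y → ∃ s, i s = x ∧ f s = y

theorem exists_isPushoutSq (i : S →ₗ[R] A) (f : S →ₗ[R] Z) :
    ∃ (B : Type u) (_ : AddCommGroup B) (_ : Module R B) (a : A →ₗ[R] B) (z : Z →ₗ[R] B),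
      IsPushoutSq i f a z := by
  let Q := LinearMap.range (i.prod (-f))
  refine ⟨(A × Z) ⧸ Q, inferInstance, inferInstance, Q.mkQ ∘ₗ LinearMap.inl R A Z,
    Q.mkQ ∘ₗ LinearMap.inr R A Z, fun s => ?_, fun b => ?_, fun x y hxy => ?_⟩
  · refine (Submodule.Quotient.eq Q).2 ⟨s, ?_⟩
    simp
  · obtain ⟨⟨x, y⟩, rfl⟩ := Q.mkQ_surjective b
    refine ⟨x, y, ?_⟩
    rw [LinearMap.comp_apply, LinearMap.comp_apply, ← map_add]
    simp
  · obtain ⟨s, hs⟩ := (Submodule.Quotient.eq Q).1 hxy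
    refine ⟨s, ?_, ?_⟩
    · simpa using congrArg Prod.fst hs
    · simpa using congrArg Prod.snd hs

namespace IsPushoutSq
variable {i : S →ₗ[R] A} {f : S →ₗ[R] Z} {a : A →ₗ[R] B} {z : Z →ₗ[R] B}

theorem symm (h : IsPushoutSq i f a z) : IsPushoutSq f i z a where
  comm s := (h.comm s).symm
  surj b := by
    obtain ⟨x, y, rfl⟩ := h.surj b
    exact ⟨y, x, add_comm _ _⟩
  ker y x hxy := by
    obtain ⟨s, h1, h2⟩ := h.ker x y hxy.symm
    exact ⟨s, h2, h1⟩

theorem exists_desc (h : IsPushoutSq i f a z) (u : A →ₗ[R] T) (v : Z →ₗ[R] T)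
    (huv : ∀ s, u (i s) = v (f s)) : ∃ w : B →ₗ[R] T, (∀ x, w (a x) = u x) ∧ ∀ y, w (z y) = v y := by
  have hs : Function.Surjective (a.coprod z) := fun b => by
    obtain ⟨x, y, hb⟩ := h.surj b
    exact ⟨(x, y), hb⟩
  have hk : LinearMap.ker (a.coprod z) ≤ LinearMap.ker (u.coprod v) := by
    rintro ⟨x, y⟩ hxy
    have hxy : a x + z y = 0 := hxy
    obtain ⟨s, rfl, hs⟩ := h.ker x (-y) (by rw [map_neg]; exact eq_neg_of_add_eq_zero_left hxy)
    change u (i s) + v y = 0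
    rw [huv, hs, map_neg, neg_add_cancel]
  let w := (LinearMap.ker (a.coprod z)).liftQ (u.coprod v) hk ∘ₗ
    ((a.coprod z).quotKerEquivOfSurjective hs).symm.toLinearMap
  have hw : ∀ x y, w (a x + z y) = u x + v y := fun x y => by
    have : ((a.coprod z).quotKerEquivOfSurjective hs).symm (a x + z y) =
        Submodule.Quotient.mk (x, y) := by
      rw [LinearEquiv.symm_apply_eq]; rfl
    rw [LinearMap.comp_apply, LinearEquiv.coe_coe, this]
    rfl
  exact ⟨w, fun x => by simpa using hw x 0, fun y => by simpa using hw 0 y⟩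

theorem exists_ses (h : IsPushoutSq i f a z) {p : A →ₗ[R] L} (hp : SES i p) :
    ∃ q : B →ₗ[R] L, SES z q ∧ (∀ x, q (a x) = p x) ∧ ∀ y, q (z y) = 0 := by
  obtain ⟨q, hq1, hq2⟩ := h.exists_desc p 0 fun s => hp.apply_apply s
  have hq2 : ∀ y, q (z y) = 0 := hq2
  refine ⟨q, ⟨?_, fun b => ⟨fun hb => ?_, ?_⟩, fun l => ?_⟩, hq1, hq2⟩
  · rw [injective_iff_map_eq_zero]
    intro y hy
    obtain ⟨s, h1, rfl⟩ := h.ker 0 y (by rw [map_zero, hy])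
    rw [hp.inj (h1.trans (map_zero i).symm), map_zero]
  · obtain ⟨x, y, rfl⟩ := h.surj b
    rw [map_add, hq1, hq2, add_zero] at hb
    obtain ⟨s, rfl⟩ := (hp.exact x).1 hb
    exact ⟨f s + y, by rw [map_add, h.comm]⟩
  · rintro ⟨y, rfl⟩
    exact hq2 y
  · obtain ⟨x, rfl⟩ := hp.surj l
    exact ⟨a x, hq1 x⟩

end IsPushoutSq

/-- Special flat precovers. -/
theorem exists_flat_precover [IsNoetherianRing R] (hdim : ringKrullDim R < ⊤) (N : Type u)
    [AddCommGroup N] [Module R N] : ∃ (B Z : Type u) (_ : AddCommGroup B) (_ : AddCommGroup Z)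
      (_ : Module R B) (_ : Module R Z) (f : B →ₗ[R] Z) (g : Z →ₗ[R] N),
      SES f g ∧ Module.Flat R Z ∧ Cotor R B := by
  obtain ⟨d, hd⟩ := exists_extV_flat hdim
  have key : ∀ j i, i + j = d → ∀ (N : Type u) [AddCommGroup N] [Module R N],
      ∃ (B Z : Type u) (_ : AddCommGroup B) (_ : AddCommGroup Z)
      (_ : Module R B) (_ : Module R Z) (f : B →ₗ[R] Z) (g : Z →ₗ[R] N),
      SES f g ∧ Module.Flat R Z ∧ ∀ (F : Type u) [AddCommGroup F] [Module R F] [Module.Flat R F]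
        (k : ℕ), ExtV R F B (i + k + 1) := by
    intro j
    induction j with
    | zero =>
      intro i hi N _ _
      obtain ⟨K, P, _, _, _, _, k, p, hP, hS⟩ := exists_free_ses R N
      exact ⟨K, P, _, _, _, _, k, p, hS, inferInstance, fun F _ _ _ k => by
        obtain rfl : i = d := hi
        exact hd F K k⟩
    | succ j ih =>
      intro i hi N _ _
      obtain ⟨B, Z, _, _, _, _, f, g, hS, hZ, -⟩ := ih (i + 1) (by omega) N
      obtain ⟨B₁, Z₁, _, _, _, _, f₁, g₁, hS₁, hZ₁, hB₁⟩ := ih (i + 1) (by omega) B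
      obtain ⟨A, L, _, _, _, _, a, l, hA, hAf, hAc, hL⟩ := exists_flat_cotorsion_hull (R := R) Z₁
      obtain ⟨E, _, _, a', z', hE⟩ := exists_isPushoutSq a (f ∘ₗ g₁)
      obtain ⟨q, hq, -, -⟩ := hE.exists_ses hA
      obtain ⟨w, hw1, hw2⟩ := hE.exists_desc (0 : A →ₗ[R] N) g
        fun s => (hS.apply_apply (g₁ s)).symm
      have hw1 : ∀ x, w (a' x) = 0 := hw1
      have hw : Function.Surjective w := fun n => by
        obtain ⟨y, rfl⟩ := hS.surj n
        exact ⟨z' y, hw2 y⟩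
      have hK : SES (a ∘ₗ f₁) (a'.codRestrict (LinearMap.ker w) hw1) := by
        refine ⟨hA.inj.comp hS₁.inj, fun x => ⟨fun hx => ?_, ?_⟩, ?_⟩
        · have hx : a' x = 0 := congrArg Subtype.val hx
          obtain ⟨s, rfl, hs⟩ := hE.ker x 0 (by rw [hx, map_zero])
          obtain ⟨t, rfl⟩ := (hS₁.exact s).1 (hS.inj (hs.trans (map_zero f).symm))
          exact ⟨t, rfl⟩
        · rintro ⟨t, rfl⟩
          refine Subtype.ext ((hE.comm _).trans ?_)
          rw [LinearMap.comp_apply, hS₁.apply_apply, map_zero, map_zero]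
          rfl
        · rintro ⟨e, he⟩
          obtain ⟨x, y, rfl⟩ := hE.surj e
          rw [LinearMap.mem_ker, map_add, hw1, hw2, zero_add] at he
          obtain ⟨b, rfl⟩ := (hS.exact y).1 he
          obtain ⟨s, rfl⟩ := hS₁.surj b
          refine ⟨x + a s, Subtype.ext ?_⟩
          change a' (x + a s) = _
          rw [map_add, hE.comm]
          rfl
      refine ⟨_, E, _, _, _, _, _, w, SES.of_surjective hw, flat_extension hq,
        fun F _ _ _ k => (hAc F (i + k)).cov_right hK ?_⟩
      have := hB₁ F k
      rwa [show i + 1 + k + 1 = i + k + 1 + 1 by omega] at this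
  obtain ⟨B, Z, _, _, _, _, f, g, hS, hZ, hB⟩ := key d 0 (by omega) N
  exact ⟨B, Z, _, _, _, _, f, g, hS, hZ, fun F _ _ _ n => by
    have := hB F n
    rwa [Nat.zero_add] at this⟩

end

section
variable {R : Type u} [CommRing R] {A B D M M₁ M₂ M₃ N F C : Type u} [AddCommGroup A]
  [AddCommGroup B] [AddCommGroup D] [AddCommGroup M] [AddCommGroup M₁] [AddCommGroup M₂]
  [AddCommGroup M₃] [AddCommGroup N] [AddCommGroup F] [AddCommGroup C] [Module R A] [Module R B]
  [Module R D] [Module R M] [Module R M₁] [Module R M₂] [Module R M₃] [Module R N] [Module R F]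
  [Module R C] {f : A →ₗ[R] B} {g : B →ₗ[R] D}

/-- Unbundled semidualizing modules. -/
structure Semidual (R C : Type u) [CommRing R] [AddCommGroup C] [Module R C] : Prop where
  finite : Module.Finite R C
  bij : Function.Bijective (LinearMap.lsmul R C)
  perp : Perp R C C

theorem Semidual.mk_bijective [IsNoetherianRing R] (hC : Semidual R C) [Module.Flat R F] :
    Function.Bijective (TensorProduct.mk R F C) := by
  have := hC.finite
  have h : TensorProduct.mk R F C = homTensor R C F C ∘ₗ
      (LinearEquiv.lTensor F
        (LinearEquiv.ofBijective (LinearMap.lsmul R C) hC.bij)).toLinearMap ∘ₗ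
        (TensorProduct.rid R F).symm.toLinearMap := by
    ext x c
    simp
  rw [h]
  let e : (F ⊗[R] R) ≃ₗ[R] F ⊗[R] (C →ₗ[R] C) :=
    LinearEquiv.lTensor F (LinearEquiv.ofBijective (LinearMap.lsmul R C) hC.bij)
  exact (homTensor_bijective (A := C) (F := F) (N := C)).comp
    (e.bijective.comp (TensorProduct.rid R F).symm.bijective)

theorem ExtV.tensor_flat [IsNoetherianRing R] [Module.Finite R A] [Module.Flat R F] {n : ℕ}
    (h : ExtV R A N (n + 1)) : ExtV R A (F ⊗[R] N) (n + 1) := by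
  induction n generalizing A with
  | zero =>
    obtain ⟨m, p, hp⟩ := exists_finite_free_cover (R := R) (A := A)
    have hS := SES.of_surjective hp
    rw [ExtV.one_iff hS] at h ⊢
    have h2 := (homTensor_bijective (A := LinearMap.ker p) (F := F) (N := N)).2.comp
      (LinearMap.lTensor_surjective F (g := (LinearMap.ker p).subtype.lcomp R N) h)
    rw [← LinearMap.coe_comp, ← homTensor_comp] at h2
    exact Function.Surjective.of_comp h2
  | succ n ih =>
    obtain ⟨m, p, hp⟩ := exists_finite_free_cover (R := R) (A := A)
    have hS := SES.of_surjective hp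
    rw [ExtV.shift_right hS] at h ⊢
    exact ih h

theorem Semidual.perp_tensor [IsNoetherianRing R] (hC : Semidual R C) [Module.Flat R F] :
    Perp R C (F ⊗[R] C) := fun n =>
  have := hC.finite
  (hC.perp n).tensor_flat

theorem perp_free_tensor [Module.Free R F] (h : Perp R C M) : Perp R (F ⊗[R] C) M := by
  classical
  obtain ⟨ι, ⟨b⟩⟩ : ∃ ι : Type u, Nonempty (Module.Basis ι R F) :=
    ⟨_, ⟨Module.Free.chooseBasis R F⟩⟩
  exact (h.finsupp ι).congr_left
    ((LinearEquiv.rTensor C b.repr).trans (TensorProduct.finsuppScalarLeft R C ι)).symm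

theorem extV_tensor_iff (hM : Perp R C M) [Module.Flat R F] {n : ℕ} :
    ExtV R (F ⊗[R] C) M (n + 1) ↔ ExtV R F (C →ₗ[R] M) (n + 1) := by
  obtain ⟨K, P, _, _, _, _, k, p, hP, hS⟩ := exists_free_ses R F
  have hK := flat_kernel hS
  have hT := hS.rTensor C
  have hPM : Perp R (P ⊗[R] C) M := perp_free_tensor hM
  induction n generalizing F K P with
  | zero =>
    rw [ExtV.one_iff hS]
    constructor
    · intro h l
      obtain ⟨m, hm⟩ := h.extend hT (TensorProduct.lift l)
      refine ⟨TensorProduct.curry m, ?_⟩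
      ext x c
      exact LinearMap.congr_fun hm (x ⊗ₜ c)
    · intro h
      refine (hPM 0).of_extend hT fun l => ?_
      obtain ⟨m, hm⟩ := h (TensorProduct.curry l)
      refine ⟨TensorProduct.lift m, ?_⟩
      ext x c
      exact LinearMap.congr_fun (LinearMap.congr_fun hm x) c
  | succ n ih =>
    obtain ⟨K', P', _, _, _, _, k', p', hP', hS'⟩ := exists_free_ses R K
    have ih := ih K' P' _ _ _ _ k' p' hP' hS' (flat_kernel hS') (hS'.rTensor C)
      (perp_free_tensor hM)
    rw [ExtV.shift_right hS]
    refine Iff.trans ?_ ih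
    exact ⟨fun h => (hPM n).contra_left hT h, fun h => h.contra_right hT (hPM (n + 1))⟩

/-- Unbundled `C`-cotorsion modules. -/
def CCotor (R C M : Type u) [CommRing R] [AddCommGroup C] [Module R C] [AddCommGroup M]
    [Module R M] : Prop :=
  ∀ (F : Type u) [AddCommGroup F] [Module R F] [Module.Flat R F], Perp R (F ⊗[R] C) M

theorem cCotor_iff (hM : Perp R C M) : CCotor R C M ↔ Cotor R (C →ₗ[R] M) :=
  ⟨fun h F _ _ _ n => (extV_tensor_iff hM).1 (h F n),
    fun h F _ _ _ n => (extV_tensor_iff hM).2 (h F n)⟩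

theorem CCotor.perp (h : CCotor R C M) : Perp R C M :=
  (h R).congr_left (TensorProduct.lid R C)

theorem Semidual.cCotor_tensor [IsNoetherianRing R] (hC : Semidual R C) [Module.Flat R F]
    (hF : Cotor R F) : CCotor R C (F ⊗[R] C) :=
  (cCotor_iff hC.perp_tensor).2 (hF.congr (LinearEquiv.ofBijective _ hC.mk_bijective))

/-- The evaluation map. -/
noncomputable def evalHom (R C M : Type u) [CommRing R] [AddCommGroup C] [AddCommGroup M]
    [Module R C] [Module R M] : (C →ₗ[R] M) ⊗[R] C →ₗ[R] M := TensorProduct.lift LinearMap.id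

@[simp] theorem evalHom_tmul (h : C →ₗ[R] M) (c : C) : evalHom R C M (h ⊗ₜ c) = h c := rfl

theorem evalHom_comp (f : A →ₗ[R] B) (x : (C →ₗ[R] A) ⊗[R] C) :
    evalHom R C B ((f.compRight R).rTensor C x) = f (evalHom R C A x) := by
  induction x with
  | zero => simp
  | tmul h c => simp
  | add x y hx hy => simp only [map_add, hx, hy]

/-- Unbundled Bass class. -/
structure Bass (R C M : Type u) [CommRing R] [AddCommGroup C] [Module R C] [AddCommGroup M]
    [Module R M] : Prop where
  perp : Perp R C M
  tor : Perp R (C →ₗ[R] M) (CharacterModule C)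
  bij : Function.Bijective (evalHom R C M)

theorem Semidual.bass_tensor [IsNoetherianRing R] (hC : Semidual R C) [Module.Flat R F] :
    Bass R C (F ⊗[R] C) where
  perp := hC.perp_tensor
  tor := (Perp.flat_characterModule F C).congr_left (LinearEquiv.ofBijective _ hC.mk_bijective)
  bij := by
    have h : evalHom R C (F ⊗[R] C) ∘ₗ (LinearEquiv.rTensor C
        (LinearEquiv.ofBijective _ (hC.mk_bijective (F := F)))).toLinearMap = .id := by
      ext x c
      simp
    have h2 : Function.Bijective (evalHom R C (F ⊗[R] C) ∘ (LinearEquiv.rTensor C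
        (LinearEquiv.ofBijective _ (hC.mk_bijective (F := F))))) := by
      have : ⇑(evalHom R C (F ⊗[R] C)) ∘ (LinearEquiv.rTensor C
        (LinearEquiv.ofBijective _ (hC.mk_bijective (F := F)))) = id := by
        funext x
        exact LinearMap.congr_fun h x
      rw [this]
      exact Function.bijective_id
    exact (Function.Bijective.of_comp_iff _ (LinearEquiv.bijective _)).1 h2

theorem Bass.congr (e : A ≃ₗ[R] B) (h : Bass R C A) : Bass R C B where
  perp := h.perp.congr_right e
  tor := h.tor.congr_left (e.congrRight)
  bij := by
    have h2 : ∀ x, evalHom R C B (LinearEquiv.rTensor C (e.congrRight (M := C)) x) =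
      e (evalHom R C A x) := fun x => evalHom_comp e.toLinearMap x
    have h3 : evalHom R C B ∘ (LinearEquiv.rTensor C (e.congrRight (M := C))) =
      e ∘ evalHom R C A := funext h2
    refine (Function.Bijective.of_comp_iff _
      (LinearEquiv.bijective (LinearEquiv.rTensor C (e.congrRight (M := C))))).1 ?_
    rw [h3]
    exact e.bijective.comp h.bij

theorem SES.hom (h : SES f g) (hl : ∀ k : C →ₗ[R] D, ∃ l : C →ₗ[R] B, g ∘ₗ l = k) :
    SES (f.compRight R : (C →ₗ[R] A) →ₗ[R] _) (g.compRight R) where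
  inj a b hab := LinearMap.ext fun x => h.inj (LinearMap.congr_fun hab x)
  exact k := by
    constructor
    · intro hk
      have hk : ∀ x, g (k x) = 0 := LinearMap.congr_fun hk
      refine ⟨(LinearEquiv.ofInjective f h.inj).symm.toLinearMap ∘ₗ
        k.codRestrict (LinearMap.range f) fun x => (h.exact _).1 (hk x), ?_⟩
      ext x
      exact congrArg Subtype.val ((LinearEquiv.ofInjective f h.inj).apply_symm_apply _)
    · rintro ⟨l, rfl⟩
      ext x
      exact h.apply_apply _
  surj := hl

theorem SES.rTensor_of_extV (h : SES f g) (hD : ExtV R D (CharacterModule C) 1) :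
    SES (f.rTensor C) (g.rTensor C) where
  inj := rTensor_injective_iff_lcomp_surjective.2 (hD.extend h)
  exact := _root_.rTensor_exact C h.exact h.surj
  surj := LinearMap.rTensor_surjective C h.surj

section
variable {f : M₁ →ₗ[R] M₂} {g : M₂ →ₗ[R] M₃}

theorem Bass.left (h : SES f g) (h2 : Bass R C M₂) (h3 : Bass R C M₃)
    (hl : ∀ k : C →ₗ[R] M₃, ∃ l : C →ₗ[R] M₂, g ∘ₗ l = k) : Bass R C M₁ := by
  have hH := h.hom hl
  have hT := hH.rTensor_of_extV (h3.tor 0)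
  refine ⟨h2.perp.cov_left h h3.perp hl, h2.tor.contra_left hH h3.tor, ?_, ?_⟩
  · refine Function.Injective.of_comp (f := f) fun x y hxy => hT.inj (h2.bij.1 ?_)
    rw [evalHom_comp, evalHom_comp]
    exact hxy
  · intro y
    obtain ⟨x, hx⟩ := h2.bij.2 (f y)
    obtain ⟨z, rfl⟩ := (hT.exact x).1 (h3.bij.1 (by
      rw [evalHom_comp, hx, h.apply_apply, map_zero]))
    rw [evalHom_comp] at hx
    exact ⟨z, h.inj hx⟩

theorem Bass.mid (h : SES f g) (h1 : Bass R C M₁) (h3 : Bass R C M₃) : Bass R C M₂ := by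
  have hH := h.hom (h1.perp.one.lift h)
  have hT := hH.rTensor_of_extV (h3.tor 0)
  refine ⟨h1.perp.cov_mid h h3.perp, h1.tor.contra_mid hH h3.tor, ?_, ?_⟩
  · rw [injective_iff_map_eq_zero]
    intro x hx
    obtain ⟨z, rfl⟩ := (hT.exact x).1 (h3.bij.1 (by rw [evalHom_comp, hx, map_zero, map_zero]))
    rw [evalHom_comp] at hx
    rw [h1.bij.1 ((h.inj (hx.trans (map_zero f).symm)).trans (map_zero _).symm), map_zero]
  · intro y
    obtain ⟨x, hx⟩ := h3.bij.2 (g y)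
    obtain ⟨x, rfl⟩ := hT.surj x
    rw [evalHom_comp] at hx
    obtain ⟨w, hw⟩ := (h.exact (y - evalHom R C M₂ x)).1 (by rw [map_sub, hx, sub_self])
    obtain ⟨w, rfl⟩ := h1.bij.2 w
    rw [← evalHom_comp] at hw
    exact ⟨x + (f.compRight R).rTensor C w, by rw [map_add, hw]; abel⟩

theorem Bass.right (h : SES f g) (h1 : Bass R C M₁) (h2 : Bass R C M₂) : Bass R C M₃ := by
  have hH := h.hom (h1.perp.one.lift h)
  have hT : Function.Injective ((f.compRight R : (C →ₗ[R] M₁) →ₗ[R] _).rTensor C) := by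
    intro x y hxy
    have := congrArg (evalHom R C M₂) hxy
    rw [evalHom_comp, evalHom_comp] at this
    exact h1.bij.1 (h.inj this)
  have hex := _root_.rTensor_exact C hH.exact hH.surj
  have hsurj := LinearMap.rTensor_surjective C hH.surj
  refine ⟨h1.perp.cov_right h h2.perp, h1.tor.contra_right hH h2.tor
    (rTensor_injective_iff_lcomp_surjective.1 hT), ?_, ?_⟩
  · rw [injective_iff_map_eq_zero]
    intro x hx
    obtain ⟨x, rfl⟩ := hsurj x
    rw [evalHom_comp] at hx
    obtain ⟨w, hw⟩ := (h.exact _).1 hx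
    obtain ⟨w, rfl⟩ := h1.bij.2 w
    rw [← evalHom_comp] at hw
    rw [← h2.bij.1 hw]
    exact hex.apply_apply_eq_zero w
  · intro y
    obtain ⟨y, rfl⟩ := h.surj y
    obtain ⟨x, rfl⟩ := h2.bij.2 y
    exact ⟨_, evalHom_comp g x⟩

end

/-- The members of an infinite resolution by modules of the Bass class are in the Bass class. -/
theorem bass_of_resolution {M W : ℕ → ModuleCat.{u} R} {i : ∀ n, M (n + 1) →ₗ[R] W n}
    {p : ∀ n, W n →ₗ[R] M n} (h : ∀ n, SES (i n) (p n)) (hM : ∀ n, Perp R C (M n))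
    (hW : ∀ n, Bass R C (W n)) (n : ℕ) : Bass R C (M n) := by
  have hH : ∀ n, SES ((i n).compRight R : (C →ₗ[R] M (n + 1)) →ₗ[R] _) ((p n).compRight R) :=
    fun n => (h n).hom ((hM (n + 1)).one.lift (h n))
  have hsurj : ∀ n, Function.Surjective (evalHom R C (M n)) := by
    intro n y
    obtain ⟨y, rfl⟩ := (h n).surj y
    obtain ⟨x, rfl⟩ := (hW n).bij.2 y
    exact ⟨_, evalHom_comp (p n) x⟩
  have hinj : ∀ n, Function.Injective (evalHom R C (M n)) := by
    intro n
    rw [injective_iff_map_eq_zero]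
    intro x hx
    obtain ⟨x, rfl⟩ := LinearMap.rTensor_surjective C (hH n).surj x
    rw [evalHom_comp] at hx
    obtain ⟨w, hw⟩ := ((h n).exact _).1 hx
    obtain ⟨w, rfl⟩ := hsurj _ w
    rw [← evalHom_comp] at hw
    rw [← (hW n).bij.1 hw]
    exact (_root_.rTensor_exact C (hH n).exact (hH n).surj).apply_apply_eq_zero w
  have hT : ∀ n, Function.Injective (((i n).compRight R :
      (C →ₗ[R] M (n + 1)) →ₗ[R] _).rTensor C) := by
    intro n x y hxy
    have := congrArg (evalHom R C (W n)) hxy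
    rw [evalHom_comp, evalHom_comp] at this
    exact hinj _ ((h n).inj this)
  refine ⟨hM n, fun k => ?_, hinj n, hsurj n⟩
  induction k generalizing n with
  | zero =>
    exact ((hW n).tor 0).of_extend (hH n) (rTensor_injective_iff_lcomp_surjective.1 (hT n))
  | succ k ih =>
    exact (ih (n + 1)).contra_right (hH n) ((hW n).tor (k + 1))

end

/-- Unbundled `C`-flat modules. -/
def CFlat (R C V : Type u) [CommRing R] [AddCommGroup C] [Module R C] [AddCommGroup V]
    [Module R V] : Prop :=
  ∃ F : ModuleCat.{u} R, Module.Flat R F ∧ Nonempty (V ≃ₗ[R] F ⊗[R] C)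

/-- Unbundled `C`-flat `C`-cotorsion modules. -/
def CFlatCotor (R C V : Type u) [CommRing R] [AddCommGroup C] [Module R C] [AddCommGroup V]
    [Module R V] : Prop :=
  ∃ F : ModuleCat.{u} R, Module.Flat R F ∧ Cotor R F ∧ Nonempty (V ≃ₗ[R] F ⊗[R] C)

/-- Modules left orthogonal to the `C`-flat `C`-cotorsion modules. -/
def LeftOrth (R C M : Type u) [CommRing R] [AddCommGroup C] [Module R C] [AddCommGroup M]
    [Module R M] : Prop :=
  ∀ V : ModuleCat.{u} R, CFlatCotor R C V → Perp R M V

section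
variable {R : Type u} [CommRing R] {A B D M N F V W C I : Type u} [AddCommGroup A]
  [AddCommGroup B] [AddCommGroup D] [AddCommGroup M] [AddCommGroup N] [AddCommGroup F]
  [AddCommGroup V] [AddCommGroup W] [AddCommGroup C] [AddCommGroup I] [Module R A] [Module R B]
  [Module R D] [Module R M] [Module R N] [Module R F] [Module R V] [Module R W] [Module R C]
  [Module R I] {f : A →ₗ[R] B} {g : B →ₗ[R] D}

theorem CFlatCotor.congr (e : V ≃ₗ[R] W) : CFlatCotor R C V → CFlatCotor R C W
  | ⟨F, hF, hF2, ⟨k⟩⟩ => ⟨F, hF, hF2, ⟨e.symm.trans k⟩⟩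

theorem CFlat.tensor (R F C : Type u) [CommRing R] [AddCommGroup F] [AddCommGroup C] [Module R F]
    [Module R C] [h : Module.Flat R F] : CFlat R C (F ⊗[R] C) :=
  ⟨ModuleCat.of R F, h, ⟨LinearEquiv.refl R _⟩⟩

theorem Cotor.cFlatCotor_tensor [h : Module.Flat R F] (hF : Cotor R F) :
    CFlatCotor R C (F ⊗[R] C) :=
  ⟨ModuleCat.of R F, h, hF, ⟨LinearEquiv.refl R _⟩⟩

theorem CFlatCotor.cFlat : CFlatCotor R C V → CFlat R C V
  | ⟨F, hF, _, k⟩ => ⟨F, hF, k⟩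

theorem CCotor.congr (e : M ≃ₗ[R] N) (h : CCotor R C M) : CCotor R C N :=
  fun F _ _ _ => (h F).congr_right e

theorem LeftOrth.congr (e : M ≃ₗ[R] N) (h : LeftOrth R C M) : LeftOrth R C N :=
  fun V hV => (h V hV).congr_left e

theorem CCotor.cov_mid (h : SES f g) (h1 : CCotor R C A) (h2 : CCotor R C D) : CCotor R C B :=
  fun F _ _ _ => (h1 F).cov_mid h (h2 F)

theorem CCotor.cov_right (h : SES f g) (h1 : CCotor R C A) (h2 : CCotor R C B) :
    CCotor R C D := fun F _ _ _ => (h1 F).cov_right h (h2 F)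

theorem LeftOrth.contra_mid (h : SES f g) (h1 : LeftOrth R C A) (h2 : LeftOrth R C D) :
    LeftOrth R C B := fun V hV => (h1 V hV).contra_mid h (h2 V hV)

theorem LeftOrth.contra_left (h : SES f g) (h1 : LeftOrth R C B) (h2 : LeftOrth R C D) :
    LeftOrth R C A := fun V hV => (h1 V hV).contra_left h (h2 V hV)

/-- A module of the Bass class with flat `Hom(C, V)` is `C`-flat. -/
theorem Bass.cFlat (hV : Bass R C V) [h : Module.Flat R (C →ₗ[R] V)] : CFlat R C V :=
  ⟨ModuleCat.of R (C →ₗ[R] V), h, ⟨(LinearEquiv.ofBijective _ hV.bij).symm⟩⟩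

section
variable [IsNoetherianRing R]

theorem CFlatCotor.characterModule [Module.Finite R C] (hI : Module.Injective R I) :
    CFlatCotor R C (CharacterModule (C →ₗ[R] I)) := by
  have := flat_characterModule_of_injective hI
  exact ((Cotor.characterModule I).cFlatCotor_tensor (C := C)).congr
    ((TensorProduct.comm R (CharacterModule I) C).trans
      (LinearEquiv.ofBijective _ tensorCharacter_bijective))

/-- Every `C`-flat `C`-cotorsion module is a retract of a character module of a
`C`-injective module. -/
theorem CFlatCotor.exists_retract [Module.Finite R C] (hV : CFlatCotor R C V) :
    ∃ I : ModuleCat.{u} R, Module.Injective R I ∧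
      ∃ (s : V →ₗ[R] CharacterModule (C →ₗ[R] I)) (r : CharacterModule (C →ₗ[R] I) →ₗ[R] V),
        r ∘ₗ s = .id := by
  obtain ⟨F, hF, hF2, ⟨k⟩⟩ := hV
  obtain ⟨r, hr⟩ := hF2.exists_retraction
  have hI : Module.Injective R (CharacterModule F) :=
    Module.Flat.iff_characterModule_injective.1 hF
  let e : CharacterModule (CharacterModule F) ⊗[R] C ≃ₗ[R]
      CharacterModule (C →ₗ[R] CharacterModule F) :=
    (TensorProduct.comm R _ C).trans (LinearEquiv.ofBijective _ tensorCharacter_bijective)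
  refine ⟨ModuleCat.of R (CharacterModule F), hI,
    e.toLinearMap ∘ₗ (CharacterModule.eval R F).rTensor C ∘ₗ k.toLinearMap,
    k.symm.toLinearMap ∘ₗ r.rTensor C ∘ₗ e.symm.toLinearMap, ?_⟩
  have h2 : ∀ x, r.rTensor C ((CharacterModule.eval R F).rTensor C x) = x := fun x => by
    rw [← LinearMap.comp_apply, ← LinearMap.rTensor_comp, hr, LinearMap.rTensor_id]; rfl
  ext x
  simp [h2]

theorem LeftOrth.of_flat [Module.Finite R C] [Module.Flat R M] : LeftOrth R C M := by
  intro V hV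
  obtain ⟨I, hI, s, r, hr⟩ := hV.exists_retract
  exact (Cotor.characterModule (R := R) (C →ₗ[R] I) M).retract_right s r hr

theorem CFlatCotor.cCotor (hC : Semidual R C) (hV : CFlatCotor R C V) : CCotor R C V := by
  obtain ⟨F, hF, hF2, ⟨k⟩⟩ := hV
  exact (hC.cCotor_tensor hF2).congr k.symm

theorem CFlat.leftOrth (hC : Semidual R C) (hV : CFlat R C V) : LeftOrth R C V := by
  obtain ⟨F, hF, ⟨k⟩⟩ := hV
  exact LeftOrth.congr k.symm fun V hV => hV.cCotor hC F

theorem CFlat.bass (hC : Semidual R C) (hV : CFlat R C V) : Bass R C V := by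
  obtain ⟨F, hF, ⟨k⟩⟩ := hV
  exact hC.bass_tensor.congr k.symm

theorem CFlat.flat_hom (hC : Semidual R C) (hV : CFlat R C V) : Module.Flat R (C →ₗ[R] V) := by
  obtain ⟨F, hF, ⟨k⟩⟩ := hV
  exact Module.Flat.of_linearEquiv
    ((LinearEquiv.ofBijective _ hC.mk_bijective).trans k.symm.congrRight).symm

theorem CFlat.extension (hC : Semidual R C) (h : SES f g) (h1 : CFlat R C A)
    (h2 : CFlat R C D) : CFlat R C B := by
  have hB := (h1.bass hC).mid h (h2.bass hC)
  have := h1.flat_hom hC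
  have := h2.flat_hom hC
  have := flat_extension (h.hom ((h1.bass hC).perp.one.lift h))
  exact hB.cFlat

theorem CFlat.cFlatCotor (hC : Semidual R C) (hV : CFlat R C V) (h : CCotor R C V) :
    CFlatCotor R C V :=
  ⟨ModuleCat.of R (C →ₗ[R] V), hV.flat_hom hC, (cCotor_iff h.perp).1 h,
    ⟨(LinearEquiv.ofBijective _ (hV.bass hC).bij).symm⟩⟩

/-- Every `C`-flat module embeds in a `C`-flat `C`-cotorsion module with `C`-flat cokernel. -/
theorem CFlat.exists_hull (hV : CFlat R C V) : ∃ (A L : ModuleCat.{u} R) (i : V →ₗ[R] A)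
    (p : A →ₗ[R] L), SES i p ∧ CFlatCotor R C A ∧ CFlat R C L := by
  obtain ⟨F, hF, ⟨k⟩⟩ := hV
  obtain ⟨A, L, _, _, _, _, i, p, hS, hA, hA2, hL⟩ := exists_flat_cotorsion_hull (R := R) F
  have hT := hS.rTensor C
  refine ⟨ModuleCat.of R (A ⊗[R] C), ModuleCat.of R (L ⊗[R] C), i.rTensor C ∘ₗ k.toLinearMap,
    p.rTensor C, ⟨hT.inj.comp k.injective, ?_, hT.surj⟩, hA2.cFlatCotor_tensor, .tensor R L C⟩
  intro x
  rw [hT.exact x]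
  exact ⟨fun ⟨y, hy⟩ => ⟨k.symm y, by simpa using hy⟩, fun ⟨y, hy⟩ => ⟨k y, hy⟩⟩

end

end

section
variable {R : Type u} [CommRing R]

/-- A factorization of the differentials of a complex through its cycles. -/
structure Cycles (Z : ZComplex R) where
  B : ℤ → ModuleCat.{u} R
  ι : ∀ i, B i →ₗ[R] Z.X i
  π : ∀ i, Z.X (i + 1) →ₗ[R] B i
  ses : ∀ i, SES (ι (i + 1)) (π i)
  d_eq : ∀ i x, Z.d i x = ι i (π i x)

/-- The cycles of an exact complex. -/
noncomputable def ZComplex.IsExact.cycles {Z : ZComplex R} (hZ : Z.IsExact) : Cycles Z where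
  B i := ModuleCat.of R (LinearMap.range (Z.d i))
  ι i := (LinearMap.range (Z.d i)).subtype
  π i := (Z.d i).rangeRestrict
  ses i :=
    { inj := Subtype.val_injective
      exact := fun x => by
        have h1 : (Z.d i).rangeRestrict x = 0 ↔ Z.d i x = 0 := Subtype.ext_iff
        rw [h1, hZ i x]
        exact ⟨fun hx => ⟨⟨x, hx⟩, rfl⟩, fun ⟨y, hy⟩ => hy ▸ y.2⟩
      surj := LinearMap.surjective_rangeRestrict _ }
  d_eq _ _ := rfl

namespace Cycles
variable {Z : ZComplex R} (c : Cycles Z) {V : ModuleCat.{u} R}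

theorem ι_injective (i : ℤ) : Function.Injective (c.ι i) := by
  obtain ⟨j, rfl⟩ : ∃ j, i = j + 1 := ⟨i - 1, by ring⟩
  exact (c.ses j).inj

theorem d_eq_zero_iff {i : ℤ} (x : Z.X (i + 1)) : Z.d i x = 0 ↔ ∃ y, c.ι (i + 1) y = x := by
  rw [c.d_eq, ← map_zero (c.ι i), (c.ι_injective i).eq_iff]
  exact (c.ses i).exact x

theorem isExact (c : Cycles Z) : Z.IsExact := by
  intro i x
  rw [c.d_eq_zero_iff]
  constructor
  · rintro ⟨y, rfl⟩
    obtain ⟨y, rfl⟩ := (c.ses (i + 1)).surj y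
    exact ⟨y, c.d_eq _ _⟩
  · rintro ⟨y, rfl⟩
    exact ⟨_, (c.d_eq _ _).symm⟩

theorem homToExact_of_extend (h : ∀ (i : ℤ) (k : c.B (i + 1) →ₗ[R] V),
    ∃ l : Z.X (i + 1) →ₗ[R] V, l ∘ₗ c.ι (i + 1) = k) : Z.HomToExact V := by
  intro i g
  constructor
  · intro hg
    have h1 : ∀ x, g (c.ι (i + 1) x) = 0 := by
      intro x
      obtain ⟨x, rfl⟩ := (c.ses (i + 1)).surj x
      rw [← c.d_eq]
      exact LinearMap.congr_fun hg x
    obtain ⟨k, hk⟩ : ∃ k : c.B i →ₗ[R] V, k ∘ₗ c.π i = g := by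
      have h2 := LinearMap.exact_lcomp_of_exact_of_surjective V (c.ses i).exact (c.ses i).surj
      exact (h2 g).1 (LinearMap.ext h1)
    obtain ⟨l, hl⟩ : ∃ l : Z.X i →ₗ[R] V, l ∘ₗ c.ι i = k := by
      obtain ⟨j, rfl⟩ : ∃ j, i = j + 1 := ⟨i - 1, by ring⟩
      exact h j k
    refine ⟨l, LinearMap.ext fun x => ?_⟩
    simp only [LinearMap.comp_apply, c.d_eq]
    rw [← hk, ← hl]
    rfl
  · rintro ⟨l, rfl⟩
    ext x
    have : Z.d i (Z.d (i + 1) x) = 0 := LinearMap.congr_fun (Z.d_comp_d i) x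
    simp [this]

theorem homToExact (h : ∀ i, ExtV R (c.B i) V 1) : Z.HomToExact V :=
  c.homToExact_of_extend fun i => (h i).extend (c.ses i)

theorem homFromExact_of_lift (h : ∀ (i : ℤ) (k : V →ₗ[R] c.B i),
    ∃ l : V →ₗ[R] Z.X (i + 1), c.π i ∘ₗ l = k) : Z.HomFromExact V := by
  intro i k
  constructor
  · intro hk
    have hk : ∀ x, Z.d i (k x) = 0 := LinearMap.congr_fun hk
    let e := LinearEquiv.ofInjective (c.ι (i + 1)) (c.ι_injective _)
    let l : V →ₗ[R] c.B (i + 1) := e.symm.toLinearMap ∘ₗ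
      k.codRestrict (LinearMap.range (c.ι (i + 1))) fun x => (c.d_eq_zero_iff _).1 (hk x)
    have hl : ∀ x, c.ι (i + 1) (l x) = k x := fun x =>
      congrArg Subtype.val (e.apply_symm_apply _)
    obtain ⟨m, hm⟩ := h (i + 1) l
    refine ⟨m, LinearMap.ext fun x => ?_⟩
    rw [← hl, ← hm]
    exact c.d_eq _ _
  · rintro ⟨l, rfl⟩
    ext x
    exact LinearMap.congr_fun (Z.d_comp_d i) (l x)

theorem homFromExact (h : ∀ i, ExtV R V (c.B i) 1) : Z.HomFromExact V :=
  c.homFromExact_of_lift fun i => (h (i + 1)).lift (c.ses i)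

theorem perp_to (hX : ∀ i, Perp R (Z.X i) V) (hV : Z.HomToExact V) (i : ℤ) :
    Perp R (c.B i) V := by
  intro n
  induction n generalizing i with
  | zero =>
    refine (hX (i + 1) 0).of_extend (c.ses i) fun k => ?_
    obtain ⟨g, hg⟩ := (hV (i + 1) (k ∘ₗ c.π (i + 1))).1 (by
      ext x
      have : c.π (i + 1) (Z.d (i + 1 + 1) x) = 0 := by
        rw [c.d_eq]
        exact (c.ses _).apply_apply _
      simp [this])
    refine ⟨g, LinearMap.ext fun x => ?_⟩
    obtain ⟨x, rfl⟩ := (c.ses (i + 1)).surj x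
    have := LinearMap.congr_fun hg x
    simp only [LinearMap.comp_apply, c.d_eq] at this
    exact this
  | succ n ih => exact (ih (i + 1)).contra_right (c.ses i) (hX (i + 1) (n + 1))

theorem perp_from (hX : ∀ i, Perp R V (Z.X i)) (hV : Z.HomFromExact V) (i : ℤ) :
    Perp R V (c.B i) := by
  intro n
  induction n generalizing i with
  | zero =>
    obtain ⟨i, rfl⟩ : ∃ j, i = j + 1 + 1 := ⟨i - 1 - 1, by ring⟩
    refine (hX (i + 1 + 1) 0).of_lift (c.ses (i + 1)) fun k => ?_
    obtain ⟨l, hl⟩ := (hV i (c.ι (i + 1) ∘ₗ k)).1 (LinearMap.ext fun x =>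
      (c.d_eq_zero_iff _).2 ⟨k x, rfl⟩)
    refine ⟨l, LinearMap.ext fun x => c.ι_injective _ ?_⟩
    have := LinearMap.congr_fun hl x
    simp only [LinearMap.comp_apply, c.d_eq] at this
    exact this
  | succ n ih =>
    obtain ⟨i, rfl⟩ : ∃ j, i = j + 1 := ⟨i - 1, by ring⟩
    exact (ih i).cov_left (c.ses i) (hX (i + 1) (n + 1))

theorem coker_equiv (i : ℤ) :
    Nonempty (c.B i ≃ₗ[R] Z.X (i + 1) ⧸ LinearMap.range (Z.d (i + 1))) := by
  have h1 : LinearMap.range (Z.d (i + 1)) = LinearMap.ker (c.π i) := by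
    rw [LinearMap.exact_iff.1 (c.ses i).exact]
    ext x
    constructor
    · rintro ⟨y, rfl⟩
      exact ⟨_, (c.d_eq (i + 1) y).symm⟩
    · rintro ⟨y, rfl⟩
      obtain ⟨y, rfl⟩ := (c.ses (i + 1)).surj y
      exact ⟨y, c.d_eq _ y⟩
  rw [h1]
  exact ⟨((c.π i).quotKerEquivOfSurjective (c.ses i).surj).symm⟩

theorem isCokerOfD1_iff {M : ModuleCat.{u} R} :
    Z.IsCokerOfD1 M ↔ Nonempty (M ≃ₗ[R] c.B (-1)) := by
  have h := c.coker_equiv (-1)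
  rw [neg_add_cancel] at h
  obtain ⟨e⟩ := h
  exact ⟨fun ⟨k⟩ => ⟨k.trans e.symm⟩, fun ⟨k⟩ => ⟨k.trans e⟩⟩

end Cycles

theorem ZComplex.HomToExact.retract {Z : ZComplex R} {V W : ModuleCat.{u} R} (s : W →ₗ[R] V)
    (r : V →ₗ[R] W) (hr : r ∘ₗ s = .id) (h : Z.HomToExact V) : Z.HomToExact W := by
  intro i g
  constructor
  · intro hg
    obtain ⟨l, hl⟩ := (h i (s ∘ₗ g)).1 (by
      have := congrArg (s ∘ₗ ·) hg
      simpa [LinearMap.comp_assoc] using this)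
    refine ⟨r ∘ₗ l, ?_⟩
    have := congrArg (r ∘ₗ ·) hl
    simpa [LinearMap.comp_assoc, ← LinearMap.comp_assoc _ s r, hr] using this
  · rintro ⟨l, rfl⟩
    ext x
    have : Z.d i (Z.d (i + 1) x) = 0 := LinearMap.congr_fun (Z.d_comp_d i) x
    simp [this]

/-- A module with an infinite coresolution by modules in `P`, all of whose cosyzygies are
in `Q`. -/
def Cores (P Q : ModuleCat.{u} R → Prop) (M : ModuleCat.{u} R) : Prop :=
  ∃ 𝒟 : ModuleCat.{u} R → Prop, 𝒟 M ∧ ∀ N, 𝒟 N → Q N ∧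
    ∃ (W N' : ModuleCat.{u} R) (i : N →ₗ[R] W) (p : W →ₗ[R] N'), SES i p ∧ P W ∧ 𝒟 N'

/-- A module with an infinite resolution by modules in `P`, all of whose syzygies are in `Q`. -/
def Resol (P Q : ModuleCat.{u} R → Prop) (M : ModuleCat.{u} R) : Prop :=
  ∃ 𝒟 : ModuleCat.{u} R → Prop, 𝒟 M ∧ ∀ N, 𝒟 N → Q N ∧
    ∃ (W N' : ModuleCat.{u} R) (i : N' →ₗ[R] W) (p : W →ₗ[R] N), SES i p ∧ P W ∧ 𝒟 N'

section
variable {P P' Q Q' : ModuleCat.{u} R → Prop} {M N : ModuleCat.{u} R}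

theorem Cores.mem : Cores P Q M → Q M
  | ⟨_, h, h2⟩ => (h2 _ h).1

theorem Cores.exists_ses : Cores P Q M → ∃ (W N : ModuleCat.{u} R) (i : M →ₗ[R] W)
    (p : W →ₗ[R] N), SES i p ∧ P W ∧ Cores P Q N
  | ⟨𝒟, h, h2⟩ => by
    obtain ⟨-, W, N, i, p, h3, h4, h5⟩ := h2 _ h
    exact ⟨W, N, i, p, h3, h4, 𝒟, h5, h2⟩

theorem Cores.cons {W : ModuleCat.{u} R} {i : M →ₗ[R] W} {p : W →ₗ[R] N} (h : SES i p)
    (hM : Q M) (hW : P W) (hN : Cores P Q N) : Cores P Q M := by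
  refine ⟨fun X => X = M ∨ Cores P Q X, Or.inl rfl, ?_⟩
  rintro X (rfl | hX)
  · exact ⟨hM, W, N, i, p, h, hW, Or.inr hN⟩
  · obtain ⟨W, N, i, p, h, hW, hN⟩ := hX.exists_ses
    exact ⟨hX.mem, W, N, i, p, h, hW, Or.inr hN⟩

theorem Cores.mono (hP : ∀ X, P X → P' X) (hQ : ∀ X, Q X → Q' X) :
    Cores P Q M → Cores P' Q' M
  | ⟨𝒟, h, h2⟩ => ⟨𝒟, h, fun N hN => ⟨hQ _ (h2 N hN).1, by
      obtain ⟨-, W, N, i, p, h3, h4, h5⟩ := h2 _ hN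
      exact ⟨W, N, i, p, h3, hP _ h4, h5⟩⟩⟩

theorem Cores.congr (e : M ≃ₗ[R] N) (hQ : Q N) (h : Cores P Q M) : Cores P Q N := by
  obtain ⟨W, L, i, p, hS, hW, hL⟩ := h.exists_ses
  refine Cores.cons (i := i ∘ₗ e.symm.toLinearMap) (p := p)
    ⟨hS.inj.comp e.symm.injective, fun x => ?_, hS.surj⟩ hQ hW hL
  rw [hS.exact x]
  exact ⟨fun ⟨y, hy⟩ => ⟨e y, by simpa using hy⟩, fun ⟨y, hy⟩ => ⟨e.symm y, hy⟩⟩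

theorem Cores.exists_seq (h : Cores P Q M) : ∃ (X W : ℕ → ModuleCat.{u} R)
    (i : ∀ n, X n →ₗ[R] W n) (p : ∀ n, W n →ₗ[R] X (n + 1)), X 0 = M ∧
      (∀ n, SES (i n) (p n)) ∧ (∀ n, P (W n)) ∧ ∀ n, Q (X n) := by
  obtain ⟨𝒟, hM, h2⟩ := h
  have h3 : ∀ N : {N // 𝒟 N}, ∃ (W : ModuleCat.{u} R) (N' : {N // 𝒟 N})
      (i : N.1 →ₗ[R] W) (p : W →ₗ[R] N'.1), SES i p ∧ P W := fun N => by
    obtain ⟨-, W, N', i, p, h3, h4, h5⟩ := h2 _ N.2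
    exact ⟨W, ⟨N', h5⟩, i, p, h3, h4⟩
  choose W N' i p hS hP using h3
  let X : ℕ → {N // 𝒟 N} := fun n => Nat.rec ⟨M, hM⟩ (fun _ N => N' N) n
  exact ⟨fun n => (X n).1, fun n => W (X n), fun n => i (X n), fun n => p (X n), rfl,
    fun n => hS (X n), fun n => hP (X n), fun n => (h2 _ (X n).2).1⟩

theorem Resol.exists_seq (h : Resol P Q M) : ∃ (X W : ℕ → ModuleCat.{u} R)
    (i : ∀ n, X (n + 1) →ₗ[R] W n) (p : ∀ n, W n →ₗ[R] X n), X 0 = M ∧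
      (∀ n, SES (i n) (p n)) ∧ (∀ n, P (W n)) ∧ ∀ n, Q (X n) := by
  obtain ⟨𝒟, hM, h2⟩ := h
  have h3 : ∀ N : {N // 𝒟 N}, ∃ (W : ModuleCat.{u} R) (N' : {N // 𝒟 N})
      (i : N'.1 →ₗ[R] W) (p : W →ₗ[R] N.1), SES i p ∧ P W := fun N => by
    obtain ⟨-, W, N', i, p, h3, h4, h5⟩ := h2 _ N.2
    exact ⟨W, ⟨N', h5⟩, i, p, h3, h4⟩
  choose W N' i p hS hP using h3
  let X : ℕ → {N // 𝒟 N} := fun n => Nat.rec ⟨M, hM⟩ (fun _ N => N' N) n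
  exact ⟨fun n => (X n).1, fun n => W (X n), fun n => i (X n), fun n => p (X n), rfl,
    fun n => hS (X n), fun n => hP (X n), fun n => (h2 _ (X n).2).1⟩

/-- Splicing a coresolution and a resolution. -/
theorem exists_cycles {X W X' W' : ℕ → ModuleCat.{u} R} {i : ∀ n, X n →ₗ[R] W n}
    {p : ∀ n, W n →ₗ[R] X (n + 1)} (h : ∀ n, SES (i n) (p n)) {W₀ : ModuleCat.{u} R}
    {i₀ : X' 0 →ₗ[R] W₀} {p₀ : W₀ →ₗ[R] X 0} (h₀ : SES i₀ p₀) {i' : ∀ n, X' (n + 1) →ₗ[R] W' n}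
    {p' : ∀ n, W' n →ₗ[R] X' n} (h' : ∀ n, SES (i' n) (p' n)) :
    ∃ (Z : ZComplex R) (c : Cycles Z), (∀ n, c.B (Int.negSucc n) = X n) ∧
      (∀ n : ℕ, c.B n = X' n) ∧ (∀ n, Z.X (Int.negSucc n) = W n) ∧ Z.X 0 = W₀ ∧
      ∀ n : ℕ, Z.X (n + 1 : ℕ) = W' n := by
  let B : ℤ → ModuleCat.{u} R := fun k => match k with
    | Int.negSucc n => X n
    | Int.ofNat n => X' n
  let Y : ℤ → ModuleCat.{u} R := fun k => match k with
    | Int.negSucc n => W n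
    | Int.ofNat 0 => W₀
    | Int.ofNat (n + 1) => W' n
  let ι : ∀ k, B k →ₗ[R] Y k := fun k => match k with
    | Int.negSucc n => i n
    | Int.ofNat 0 => i₀
    | Int.ofNat (n + 1) => i' n
  let π : ∀ k, Y (k + 1) →ₗ[R] B k := fun k => match k with
    | Int.negSucc 0 => p₀
    | Int.negSucc (n + 1) => p n
    | Int.ofNat n => p' n
  have hS : ∀ k, SES (ι (k + 1)) (π k) := fun k => match k with
    | Int.negSucc 0 => h₀
    | Int.negSucc (n + 1) => h n
    | Int.ofNat n => h' n
  let Z : ZComplex R := ⟨Y, fun k => ι k ∘ₗ π k, fun k => by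
    ext x
    have := (hS k).apply_apply (π (k + 1) x)
    simp only [LinearMap.comp_apply, this, map_zero, LinearMap.zero_apply]⟩
  exact ⟨Z, ⟨B, ι, π, hS, fun _ _ => rfl⟩, fun _ => rfl, fun _ => rfl, fun _ => rfl, rfl,
    fun _ => rfl⟩

theorem exists_cycles_of_resol {P' Q' : ModuleCat.{u} R → Prop} (h : Cores P Q M)
    (h' : Resol P' Q' M) : ∃ (Z : ZComplex R) (c : Cycles Z), (∀ i, Q (c.B i) ∨ Q' (c.B i)) ∧
      (∀ i < 0, P (Z.X i)) ∧ (∀ i, 0 ≤ i → P' (Z.X i)) ∧ Z.IsCokerOfD1 M := by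
  obtain ⟨X, W, i, p, rfl, hS, hP, hQ⟩ := h.exists_seq
  obtain ⟨X', W', i', p', h0, hS', hP', hQ'⟩ := h'.exists_seq
  have key : ∀ (T : ModuleCat.{u} R), T = X 0 → ∀ q : W' 0 →ₗ[R] T, SES (i' 0) q →
      ∃ q : W' 0 →ₗ[R] X 0, SES (i' 0) q := by
    rintro T rfl q hq
    exact ⟨q, hq⟩
  obtain ⟨q, hq⟩ := key _ h0 _ (hS' 0)
  obtain ⟨Z, c, h1, h2, h3, h4, h5⟩ := exists_cycles (X' := fun n => X' (n + 1))
    (W' := fun n => W' (n + 1)) hS hq (fun n => hS' (n + 1))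
  refine ⟨Z, c, ?_, ?_, ?_, ?_⟩
  · rintro (n | n)
    · exact Or.inr ((h2 n).symm ▸ hQ' _)
    · exact Or.inl ((h1 n).symm ▸ hQ _)
  · rintro (n | n) hn
    · exact absurd hn (by simp)
    · exact (h3 n).symm ▸ hP _
  · rintro ((_ | n) | n) hn
    · exact h4.symm ▸ hP' _
    · exact (h5 n).symm ▸ hP' _
    · exact absurd hn (by simp)
  · rw [c.isCokerOfD1_iff, show c.B (-1) = X 0 from h1 0]
    exact ⟨LinearEquiv.refl R _⟩

end

end

section
variable {R : Type u} [CommRing R] {A A' B D D' S T V U L : Type u} [AddCommGroup A]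
  [AddCommGroup A'] [AddCommGroup B] [AddCommGroup D] [AddCommGroup D'] [AddCommGroup S]
  [AddCommGroup T] [AddCommGroup V] [AddCommGroup U] [AddCommGroup L] [Module R A] [Module R A']
  [Module R B] [Module R D] [Module R D'] [Module R S] [Module R T] [Module R V] [Module R U]
  [Module R L]

theorem SES.id_zero : SES (LinearMap.id : A →ₗ[R] A) (0 : A →ₗ[R] PUnit.{u + 1}) :=
  ⟨fun _ _ h => h, fun x => by simp, fun _ => ⟨0, Subsingleton.elim _ _⟩⟩

theorem SES.zero_id : SES (0 : PUnit.{u + 1} →ₗ[R] A) (LinearMap.id : A →ₗ[R] A) :=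
  ⟨fun _ _ _ => Subsingleton.elim _ _, fun x => by simp [eq_comm], fun x => ⟨x, rfl⟩⟩

theorem IsPushoutSq.ses_comp {i : S →ₗ[R] A} {f : S →ₗ[R] T} {a : A →ₗ[R] B} {z : T →ₗ[R] B}
    (h : IsPushoutSq i f a z) {j : L →ₗ[R] S} (hf : SES j f) (hi : Function.Injective i) :
    SES (i ∘ₗ j) a where
  inj := hi.comp hf.inj
  exact x := by
    constructor
    · intro hx
      obtain ⟨s, rfl, hs⟩ := h.ker x 0 (hx.trans (map_zero z).symm)
      obtain ⟨l, rfl⟩ := (hf.exact s).1 hs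
      exact ⟨l, rfl⟩
    · rintro ⟨l, rfl⟩
      rw [LinearMap.comp_apply, h.comm, hf.apply_apply, map_zero]
  surj b := by
    obtain ⟨x, y, rfl⟩ := h.surj b
    obtain ⟨s, rfl⟩ := hf.surj y
    exact ⟨x + i s, by rw [map_add, h.comm]⟩

/-- The horseshoe lemma. -/
theorem SES.exists_horseshoe {f : A →ₗ[R] B} {g : B →ₗ[R] D} {i : A →ₗ[R] V} {p : V →ₗ[R] A'}
    {j : D →ₗ[R] U} {q : U →ₗ[R] D'} (h : SES f g) (hi : SES i p) (hj : SES j q) (k : B →ₗ[R] V)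
    (hk : k ∘ₗ f = i) : ∃ (B' : ModuleCat.{u} R) (s : B →ₗ[R] V × U) (t : V × U →ₗ[R] B')
      (α : A' →ₗ[R] B') (β : B' →ₗ[R] D'), SES s t ∧ SES α β := by
  have hk : ∀ a, k (f a) = i a := LinearMap.congr_fun hk
  let s : B →ₗ[R] V × U := k.prod (j ∘ₗ g)
  have hs : Function.Injective s := by
    rw [injective_iff_map_eq_zero]
    intro b hb
    obtain ⟨h1, h2⟩ := Prod.ext_iff.1 hb
    obtain ⟨a, rfl⟩ := (h.exact b).1 (hj.inj (h2.trans (map_zero j).symm))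
    have h3 : i a = 0 := (hk a).symm.trans h1
    rw [hi.inj (h3.trans (map_zero i).symm), map_zero]
  let Q := LinearMap.range s
  have hQ : ∀ b, Q.mkQ (k b, j (g b)) = 0 := fun b => (Submodule.Quotient.mk_eq_zero Q).2 ⟨b, rfl⟩
  obtain ⟨α, hα⟩ : ∃ α : A' →ₗ[R] (V × U) ⧸ Q, α ∘ₗ p = Q.mkQ ∘ₗ LinearMap.inl R V U := by
    refine (LinearMap.exact_lcomp_of_exact_of_surjective ((V × U) ⧸ Q) hi.exact hi.surj _).1 ?_
    ext a
    have := hQ (f a)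
    rw [h.apply_apply, map_zero, hk] at this
    exact this
  have hα : ∀ v, α (p v) = Q.mkQ (v, 0) := LinearMap.congr_fun hα
  let β : (V × U) ⧸ Q →ₗ[R] D' := Q.liftQ (q ∘ₗ LinearMap.snd R V U) (by
    rintro _ ⟨b, rfl⟩
    exact hj.apply_apply _)
  refine ⟨ModuleCat.of R ((V × U) ⧸ Q), s, Q.mkQ, α, β, .of_injective hs, ?_, ?_, ?_⟩
  · rw [injective_iff_map_eq_zero]
    intro x hx
    obtain ⟨v, rfl⟩ := hi.surj x
    rw [hα] at hx
    obtain ⟨b, hb⟩ := (Submodule.Quotient.mk_eq_zero Q).1 hx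
    obtain ⟨h1, h2⟩ := Prod.ext_iff.1 hb
    obtain ⟨a, rfl⟩ := (h.exact b).1 (hj.inj (h2.trans (map_zero j).symm))
    have h3 : i a = v := (hk a).symm.trans h1
    rw [← h3, hi.apply_apply]
  · intro x
    constructor
    · intro hx
      obtain ⟨⟨v, w⟩, rfl⟩ := Submodule.mkQ_surjective Q x
      obtain ⟨d, rfl⟩ := (hj.exact w).1 hx
      obtain ⟨b, rfl⟩ := h.surj d
      refine ⟨p (v - k b), ?_⟩
      rw [hα, ← sub_eq_zero, ← map_sub, ← neg_eq_zero, ← map_neg]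
      simpa using hQ b
    · rintro ⟨y, rfl⟩
      obtain ⟨v, rfl⟩ := hi.surj y
      rw [hα]
      exact map_zero q
  · intro x
    obtain ⟨w, rfl⟩ := hj.surj x
    exact ⟨Q.mkQ (0, w), rfl⟩

end

section
variable {R : Type u} [CommRing R] {C : ModuleCat.{u} R}

/-- Unbundled `G_C`-flat modules. -/
def GCFlat (R : Type u) [CommRing R] (C M : ModuleCat.{u} R) : Prop :=
  Cores (fun X => CFlat R C X) (fun X => LeftOrth R C X) M

theorem cFlatCotor_of_subsingleton {M : Type u} [AddCommGroup M] [Module R M] [Subsingleton M] :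
    CFlatCotor R C M := by
  have : Subsingleton (PUnit.{u + 1} ⊗[R] C) :=
    ⟨fun x y => by
      have h : ∀ z : PUnit.{u + 1} ⊗[R] C, z = 0 := fun z => by
        induction z with
        | zero => rfl
        | tmul a c => rw [Subsingleton.elim a 0, TensorProduct.zero_tmul]
        | add a b ha hb => rw [ha, hb, add_zero]
      rw [h x, h y]⟩
  refine ⟨ModuleCat.of R PUnit.{u + 1}, inferInstanceAs (Module.Flat R PUnit.{u + 1}),
    fun F _ _ _ => Perp.of_injective
      ⟨fun _ _ _ _ _ _ _ _ _ => ⟨0, fun _ => Subsingleton.elim (α := PUnit.{u + 1}) _ _⟩⟩, ⟨?_⟩⟩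
  exact { (0 : M →ₗ[R] PUnit.{u + 1} ⊗[R] C) with
    invFun := 0
    left_inv := fun _ => Subsingleton.elim _ _
    right_inv := fun _ => Subsingleton.elim _ _ }

theorem Cycles.leftOrth {Z : ZComplex R} (c : Cycles Z) (hX : ∀ i, LeftOrth R C (Z.X i))
    (hV : ∀ V : ModuleCat.{u} R, CFlatCotor R C V → Z.HomToExact V) (i : ℤ) :
    LeftOrth R C (c.B i) := fun V h => c.perp_to (fun i => hX i V h) (hV V h) i

theorem Cycles.cores {Z : ZComplex R} (c : Cycles Z) {P Q : ModuleCat.{u} R → Prop}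
    (hP : ∀ i < 0, P (Z.X i)) (hQ : ∀ i, Q (c.B i)) : Cores P Q (c.B (-1)) := by
  refine ⟨fun N => ∃ i < 0, N = c.B i, ⟨-1, by norm_num, rfl⟩, ?_⟩
  rintro _ ⟨i, hi, rfl⟩
  obtain ⟨i, rfl⟩ : ∃ j, i = j + 1 := ⟨i - 1, by ring⟩
  exact ⟨hQ _, Z.X (i + 1), c.B i, c.ι (i + 1), c.π i, c.ses i, hP _ hi, i, by lia, rfl⟩

/-- The `G_C`-flat `C`-cotorsion modules of the Bass class. -/
structure GCFlatCotor (R : Type u) [CommRing R] (C M : ModuleCat.{u} R) : Prop where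
  gcFlat : GCFlat R C M
  bass : Bass R C M
  cCotor : CCotor R C M

variable {M : ModuleCat.{u} R}

theorem GCFlat.leftOrth (h : GCFlat R C M) : LeftOrth R C M := Cores.mem h

variable [IsNoetherianRing R]

theorem tensorExact_iff (hC : Semidual R C) {Z : ZComplex R} :
    (∀ J : ModuleCat.{u} R, IsCInjective R C J → Z.TensorExact J) ↔
      ∀ V : ModuleCat.{u} R, CFlatCotor R C V → Z.HomToExact V := by
  have := hC.finite
  constructor
  · intro h V hV
    obtain ⟨I, hI, s, r, hr⟩ := hV.exists_retract
    refine ZComplex.HomToExact.retract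
      (V := ModuleCat.of R (CharacterModule (C →ₗ[R] I))) s r hr fun i => ?_
    exact (rTensor_exact_iff _).1 (h (ModuleCat.of R (C →ₗ[R] I))
      ⟨I, hI, ⟨LinearEquiv.refl R _⟩⟩ i)
  · rintro h J ⟨I, hI, ⟨e⟩⟩ i
    refine (rTensor_exact_iff _).2 (h (ModuleCat.of R (CharacterModule J)) ?_ i)
    exact (CFlatCotor.characterModule hI).congr (CharacterModule.congr e).symm

theorem LeftOrth.resol [Module.Finite R C] {M : ModuleCat.{u} R} (h : LeftOrth R C M) :
    Resol (fun X => Module.Flat R X) (fun X => LeftOrth R C X) M := by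
  refine ⟨fun X => LeftOrth R C X, h, fun N hN => ⟨hN, ?_⟩⟩
  obtain ⟨K, P, _, _, _, _, k, p, hP, hS⟩ := exists_free_ses R N
  have hP2 : Module.Flat R P := inferInstance
  exact ⟨ModuleCat.of R P, ModuleCat.of R K, k, p, hS, hP2, LeftOrth.of_flat.contra_left hS hN⟩

theorem isGCFlat_iff (hC : Semidual R C) {M : ModuleCat.{u} R} :
    IsGCFlat R C M ↔ GCFlat R C M := by
  have := hC.finite
  constructor
  · rintro ⟨Z, hZ, h1, h2, h3, h4⟩
    rw [tensorExact_iff hC] at h3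
    let c := hZ.cycles
    rw [c.isCokerOfD1_iff] at h4
    obtain ⟨e⟩ := h4
    have hQ := c.leftOrth (C := C) (fun i => by
      rcases lt_or_ge i 0 with hi | hi
      · exact CFlat.leftOrth hC (h2 i hi)
      · have := h1 i hi
        exact LeftOrth.of_flat) h3
    exact (c.cores (P := fun X => CFlat R C X) h2 hQ).congr e.symm ((hQ _).congr e.symm)
  · intro h
    obtain ⟨Z, c, h1, h2, h3, h4⟩ := exists_cycles_of_resol h (h.mem.resol)
    refine ⟨Z, c.isExact, h3, h2, (tensorExact_iff hC).2 fun V hV => ?_, h4⟩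
    exact c.homToExact fun i => ((or_self_iff.1 (h1 i)) V hV).one

theorem CFlat.gcFlat (hC : Semidual R C) (hM : CFlat R C M) : GCFlat R C M :=
  ⟨fun X => CFlat R C X, hM, fun N hN => ⟨hN.leftOrth hC, N, ModuleCat.of R PUnit, .id, 0,
    .id_zero, hN, cFlatCotor_of_subsingleton.cFlat⟩⟩

theorem CFlatCotor.gcFlatCotor (hC : Semidual R C) (hM : CFlatCotor R C M) :
    GCFlatCotor R C M :=
  ⟨hM.cFlat.gcFlat hC, hM.cFlat.bass hC, hM.cCotor hC⟩

theorem GCFlatCotor.exists_left (hC : Semidual R C) (hdim : ringKrullDim R < ⊤)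
    (hM : GCFlatCotor R C M) : ∃ (W N : ModuleCat.{u} R) (i : N →ₗ[R] W) (p : W →ₗ[R] M),
      SES i p ∧ CFlatCotor R C W ∧ GCFlatCotor R C N := by
  obtain ⟨K, F, _, _, _, _, f, g, hS, hF, hK⟩ := exists_flat_precover hdim (C →ₗ[R] M)
  have hH : Cotor R (C →ₗ[R] M) := (cCotor_iff hM.bass.perp).1 hM.cCotor
  have hF2 : Cotor R F := hK.cov_mid hS hH
  let φ : F ⊗[R] C →ₗ[R] M := TensorProduct.lift g
  have hφ : ∀ x, φ x = evalHom R C M (g.rTensor C x) := by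
    intro x
    have : φ = evalHom R C M ∘ₗ g.rTensor C := by ext a c; rfl
    rw [this]; rfl
  have hsurj : Function.Surjective φ := by
    intro y
    obtain ⟨x, rfl⟩ := hM.bass.bij.2 y
    obtain ⟨x, rfl⟩ := LinearMap.rTensor_surjective C hS.surj x
    exact ⟨x, hφ x⟩
  have hφS := SES.of_surjective hsurj
  have hW : CFlatCotor R C (F ⊗[R] C) := hF2.cFlatCotor_tensor
  have hlift : ∀ (F' : Type u) [AddCommGroup F'] [Module R F'] [Module.Flat R F']
      (k : F' ⊗[R] C →ₗ[R] M), ∃ l : F' ⊗[R] C →ₗ[R] F ⊗[R] C, φ ∘ₗ l = k := by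
    intro F' _ _ _ k
    obtain ⟨m, hm⟩ := (hK F').one.lift hS (TensorProduct.curry k)
    refine ⟨m.rTensor C, ?_⟩
    ext a c
    exact LinearMap.congr_fun (LinearMap.congr_fun hm a) c
  have hN : LeftOrth R C (LinearMap.ker φ) :=
    (hW.cFlat.leftOrth hC).contra_left hφS hM.gcFlat.leftOrth
  refine ⟨ModuleCat.of R (F ⊗[R] C), ModuleCat.of R (LinearMap.ker φ), _, φ, hφS, hW, ?_, ?_, ?_⟩
  · exact Cores.cons (M := ModuleCat.of R (LinearMap.ker φ)) (W := ModuleCat.of R (F ⊗[R] C))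
      hφS hN hW.cFlat hM.gcFlat
  · refine (hW.cFlat.bass hC).left hφS hM.bass fun k => ?_
    obtain ⟨l, hl⟩ := hlift R (k ∘ₗ (TensorProduct.lid R C).toLinearMap)
    refine ⟨l ∘ₗ (TensorProduct.lid R C).symm.toLinearMap, ?_⟩
    rw [← LinearMap.comp_assoc, hl]
    ext c
    simp
  · exact fun F' _ _ _ => (hW.cCotor hC F').cov_left hφS (hM.cCotor F') (hlift F')

theorem GCFlatCotor.exists_right (hC : Semidual R C) (hM : GCFlatCotor R C M) :
    ∃ (W N : ModuleCat.{u} R) (i : M →ₗ[R] W) (p : W →ₗ[R] N),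
      SES i p ∧ CFlatCotor R C W ∧ GCFlatCotor R C N := by
  obtain ⟨W₀, M₁, i₀, p₀, hS₀, hW₀, hM₁⟩ := hM.gcFlat.exists_ses
  obtain ⟨W₁, M₂, i₁, p₁, hS₁, hW₁, hM₂⟩ := hM₁.exists_ses
  obtain ⟨A, L, j, q, hj, hA, hL⟩ := hW₀.exists_hull
  obtain ⟨N, _, _, a, z, hP⟩ := exists_isPushoutSq j p₀
  obtain ⟨q', hq', -, -⟩ := hP.exists_ses hj
  have hS := hP.ses_comp hS₀ hj.inj
  obtain ⟨E, _, _, a', z', hP'⟩ := exists_isPushoutSq z i₁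
  obtain ⟨r, hr, -, -⟩ := hP'.exists_ses hq'
  obtain ⟨t, ht, -, -⟩ := hP'.symm.exists_ses hS₁
  have hE : CFlat R C E := hW₁.extension hC hr hL
  have hN : LeftOrth R C N := LeftOrth.contra_mid hq' hM₁.mem (hL.leftOrth hC)
  refine ⟨A, ModuleCat.of R N, _, a, hS, hA, ?_, ?_, ?_⟩
  · exact Cores.cons (M := ModuleCat.of R N) (W := ModuleCat.of R E) ht hN hE hM₂
  · exact hM.bass.right hS (hA.cFlat.bass hC)
  · exact hM.cCotor.cov_right hS (hA.cCotor hC)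

theorem GCFlatCotor.resol (hC : Semidual R C) (hdim : ringKrullDim R < ⊤)
    (hM : GCFlatCotor R C M) : Resol (fun X => CFlatCotor R C X) (GCFlatCotor R C) M :=
  ⟨GCFlatCotor R C, hM, fun _ hN => ⟨hN, hN.exists_left hC hdim⟩⟩

theorem GCFlatCotor.cores (hC : Semidual R C) (hM : GCFlatCotor R C M) :
    Cores (fun X => CFlatCotor R C X) (GCFlatCotor R C) M :=
  ⟨GCFlatCotor R C, hM, fun _ hN => ⟨hN, hN.exists_right hC⟩⟩

theorem GCFlatCotor.gClass (hC : Semidual R C) (hdim : ringKrullDim R < ⊤)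
    (hM : GCFlatCotor R C M) : GClass R (fun X => CFlatCotor R C X) M := by
  obtain ⟨Z, c, h1, h2, h3, h4⟩ := exists_cycles_of_resol (hM.cores hC) (hM.resol hC hdim)
  refine ⟨Z, c.isExact, fun i => ?_, fun V hV => ?_, fun V hV => ?_, h4⟩
  · rcases lt_or_ge i 0 with hi | hi
    · exact h2 i hi
    · exact h3 i hi
  · obtain ⟨F, hF, -, ⟨e⟩⟩ := hV
    exact c.homFromExact fun i => (((or_self_iff.1 (h1 i)).cCotor F).congr_left e.symm).one
  · exact c.homToExact fun i => ((or_self_iff.1 (h1 i)).gcFlat.leftOrth V hV).one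

end

section
variable {R : Type u} [CommRing R] {C M : ModuleCat.{u} R}

theorem Resol.bass (h : Resol (fun X => Bass R C X) (fun X => Perp R C X) M) : Bass R C M := by
  obtain ⟨X, W, i, p, rfl, hS, hP, hQ⟩ := h.exists_seq
  exact bass_of_resolution hS hQ hP 0

/-- The modules with a coresolution by `C`-flat `C`-cotorsion modules, all of whose cosyzygies
are left orthogonal to the `C`-flat `C`-cotorsion modules. -/
abbrev CFlatCotorCores (R : Type u) [CommRing R] (C M : ModuleCat.{u} R) : Prop :=
  Cores (fun X => CFlatCotor R C X) (fun X => LeftOrth R C X) M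

theorem GCFlatCotor.congr {N : ModuleCat.{u} R} (e : M ≃ₗ[R] N) (h : GCFlatCotor R C M) :
    GCFlatCotor R C N :=
  ⟨Cores.congr e (h.gcFlat.leftOrth.congr e) h.gcFlat, h.bass.congr e, h.cCotor.congr e⟩

variable [IsNoetherianRing R]

theorem CFlatCotor.prod (hC : Semidual R C) {V U : ModuleCat.{u} R} (hV : CFlatCotor R C V)
    (hU : CFlatCotor R C U) : CFlatCotor R C (V × U) := by
  have hS : SES (LinearMap.inl R V U) (LinearMap.snd R V U) :=
    ⟨LinearMap.inl_injective, .inl_snd, LinearMap.snd_surjective⟩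
  exact (CFlat.extension hC hS hV.cFlat hU.cFlat).cFlatCotor hC
    ((hV.cCotor hC).cov_mid hS (hU.cCotor hC))

theorem CFlatCotorCores.extension (hC : Semidual R C) {A B D : ModuleCat.{u} R}
    {f : A →ₗ[R] B} {g : B →ₗ[R] D} (h : SES f g) (hA : CFlatCotorCores R C A)
    (hD : CFlatCotorCores R C D) : CFlatCotorCores R C B := by
  refine ⟨fun B => ∃ (A D : ModuleCat.{u} R) (f : A →ₗ[R] B) (g : B →ₗ[R] D), SES f g ∧
    CFlatCotorCores R C A ∧ CFlatCotorCores R C D, ⟨A, D, f, g, h, hA, hD⟩, ?_⟩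
  rintro B ⟨A, D, f, g, h, hA, hD⟩
  obtain ⟨V, A', i, p, hi, hV, hA'⟩ := hA.exists_ses
  obtain ⟨U, D', j, q, hj, hU, hD'⟩ := hD.exists_ses
  obtain ⟨k, hk⟩ := (hD.mem V hV).one.extend h i
  obtain ⟨B', s, t, α, β, hs, hα⟩ := h.exists_horseshoe hi hj k hk
  exact ⟨hA.mem.contra_mid h hD.mem, ModuleCat.of R (V × U), B', s, t, hs, hV.prod hC hU,
    A', D', α, β, hα, hA', hD'⟩

/-- A module right orthogonal to the `C`-flat `C`-cotorsion modules is `C`-cotorsion. -/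
theorem cCotor_of_cFlatCotor (hdim : ringKrullDim R < ⊤) {N : Type u} [AddCommGroup N]
    [Module R N] (h : ∀ V : ModuleCat.{u} R, CFlatCotor R C V → Perp R V N) : CCotor R C N := by
  obtain ⟨d, hd⟩ := exists_extV_flat hdim
  have key : ∀ (j : ℕ) (F : Type u) [AddCommGroup F] [Module R F] [Module.Flat R F],
      (∀ (F' : Type u) [AddCommGroup F'] [Module R F'] [Module.Flat R F'] (k : ℕ),
        ExtV R F' F (j + k + 1)) → Perp R (F ⊗[R] C) N := by
    intro j
    induction j with
    | zero =>
      intro F _ _ _ hF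
      have hF2 : Cotor R F := fun F' _ _ _ k => by simpa using hF F' k
      exact h (ModuleCat.of R (F ⊗[R] C)) hF2.cFlatCotor_tensor
    | succ j ih =>
      intro F _ _ _ hF
      obtain ⟨A, L, _, _, _, _, i, p, hS, hA, hA2, hL⟩ := exists_flat_cotorsion_hull (R := R) F
      refine (h (ModuleCat.of R (A ⊗[R] C)) hA2.cFlatCotor_tensor).contra_left (hS.rTensor C)
        (ih L fun F' _ _ _ k => (hA2 F' (j + k)).cov_right hS ?_)
      have := hF F' k
      rwa [show j + 1 + k + 1 = j + k + 1 + 1 by ring] at this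
  exact fun F _ _ _ => key d F fun F' _ _ _ k => hd F' F k

variable {Z : ZComplex R}

theorem Cycles.cFlatCotorCores (hC : Semidual R C) (c : Cycles Z)
    (hX : ∀ i, GCFlatCotor R C (Z.X i)) (hB : ∀ i, LeftOrth R C (c.B i)) (i : ℤ) :
    CFlatCotorCores R C (c.B i) := by
  have hG : ∀ {N : ModuleCat.{u} R}, GCFlatCotor R C N → CFlatCotorCores R C N := fun hN =>
    (hN.cores hC).mono (fun _ h => h) fun _ h => h.gcFlat.leftOrth
  refine ⟨fun N => ∃ (i : ℤ) (G : ModuleCat.{u} R) (a : c.B i →ₗ[R] N) (b : N →ₗ[R] G),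
    SES a b ∧ CFlatCotorCores R C G, ⟨i, ModuleCat.of R PUnit, .id, 0, .id_zero, ?_⟩, ?_⟩
  · exact hG (CFlatCotor.gcFlatCotor hC (cFlatCotor_of_subsingleton))
  rintro N ⟨i, G, a, b, hS, hN⟩
  obtain ⟨i, rfl⟩ : ∃ j, i = j + 1 := ⟨i - 1, by ring⟩
  obtain ⟨E, _, _, e, z, hP⟩ := exists_isPushoutSq (c.ι (i + 1)) a
  obtain ⟨r, hr, -, -⟩ := hP.exists_ses (c.ses i)
  obtain ⟨t, ht, -, -⟩ := hP.symm.exists_ses hS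
  have hE : CFlatCotorCores R C (ModuleCat.of R E) :=
    CFlatCotorCores.extension hC ht (hG (hX (i + 1))) hN
  obtain ⟨V, G', j, q, hj, hV, hG'⟩ := hE.exists_ses
  obtain ⟨N', _, _, v, w, hP'⟩ := exists_isPushoutSq j r
  obtain ⟨s, hs, -, -⟩ := hP'.exists_ses hj
  exact ⟨(hB _).contra_mid hS hN.mem, V, ModuleCat.of R N', j ∘ₗ z, v, hP'.ses_comp hr hj.inj, hV,
    i, G', w, s, hs, hG'⟩

/-- The class of `G_C`-flat `C`-cotorsion modules of the Bass class is stable. -/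
theorem Cycles.gcFlatCotor (hC : Semidual R C) (hdim : ringKrullDim R < ⊤) (c : Cycles Z)
    (hX : ∀ i, GCFlatCotor R C (Z.X i))
    (h1 : ∀ V : ModuleCat.{u} R, CFlatCotor R C V → Z.HomFromExact V)
    (h2 : ∀ V : ModuleCat.{u} R, CFlatCotor R C V → Z.HomToExact V) (i : ℤ) :
    GCFlatCotor R C (c.B i) := by
  have hB := c.leftOrth (C := C) (fun i => (hX i).gcFlat.leftOrth) h2
  have hcot : ∀ i, CCotor R C (c.B i) := fun i => cCotor_of_cFlatCotor hdim fun V hV =>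
    c.perp_from (fun i => by
      obtain ⟨F, hF, -, ⟨e⟩⟩ := hV
      exact ((hX i).cCotor F).congr_left e.symm) (h1 V hV) i
  refine ⟨(c.cFlatCotorCores hC hX hB i).mono (fun _ h => h.cFlat) fun _ h => h, ?_, hcot i⟩
  refine Resol.bass ⟨fun N => ∃ i, N = c.B i, ⟨i, rfl⟩, ?_⟩
  rintro _ ⟨i, rfl⟩
  exact ⟨(hcot i).perp, Z.X (i + 1), c.B (i + 1), c.ι (i + 1), c.π i, c.ses i, (hX _).bass, _, rfl⟩

theorem GClass.gcFlatCotor (hC : Semidual R C) (hdim : ringKrullDim R < ⊤)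
    {𝒳 : ModuleCat.{u} R → Prop} (h1 : ∀ X, 𝒳 X → GCFlatCotor R C X)
    (h2 : ∀ X : ModuleCat.{u} R, CFlatCotor R C X → 𝒳 X) (h : GClass R 𝒳 M) :
    GCFlatCotor R C M := by
  obtain ⟨Z, hZ, hX, h3, h4, h5⟩ := h
  let c := hZ.cycles
  rw [c.isCokerOfD1_iff] at h5
  obtain ⟨e⟩ := h5
  exact (c.gcFlatCotor hC hdim (fun i => h1 _ (hX i)) (fun V hV => h3 V (h2 V hV))
    (fun V hV => h4 V (h2 V hV)) (-1)).congr e.symm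

end

section
variable {R : Type u} [CommRing R]

/-- A class containing a zero module is contained in its Gorenstein class. -/
theorem gClass_of_mem {𝒳 : ModuleCat.{u} R → Prop} (h0 : 𝒳 (ModuleCat.of R PUnit.{u + 1}))
    {M : ModuleCat.{u} R} (hM : 𝒳 M) : GClass R 𝒳 M := by
  let X : ℕ → ModuleCat.{u} R := fun n => match n with
    | 0 => M
    | _ + 1 => ModuleCat.of R PUnit.{u + 1}
  let X' : ℕ → ModuleCat.{u} R := fun _ => ModuleCat.of R PUnit.{u + 1}
  have hX : ∀ n, 𝒳 (X n) := fun n => match n with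
    | 0 => hM
    | _ + 1 => h0
  let p : ∀ n, X n →ₗ[R] X (n + 1) := fun n => (0 : X n →ₗ[R] PUnit.{u + 1})
  have hp : ∀ n, SES (LinearMap.id : X n →ₗ[R] X n) (p n) := fun _ => SES.id_zero
  obtain ⟨Z, c, h1, h2, h3, h4, h5⟩ := exists_cycles hp (X' := X') (i₀ := (0 : PUnit.{u + 1} →ₗ[R] M))
    (p₀ := LinearMap.id) SES.zero_id (W' := X') (i' := fun _ => LinearMap.id) (p' := fun _ => 0)
    fun _ => SES.id_zero
  have hsub : ∀ i, Subsingleton (c.B i) ∨ Subsingleton (c.B (i + 1)) := by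
    have hB : ∀ i, i ≠ -1 → Subsingleton (c.B i) := by
      rintro (n | _ | n) hn
      · exact (h2 n).symm ▸ inferInstanceAs (Subsingleton PUnit.{u + 1})
      · exact absurd rfl hn
      · exact (h1 (n + 1)).symm ▸ inferInstanceAs (Subsingleton PUnit.{u + 1})
    intro i
    by_cases hi : i = -1
    · exact Or.inr (hB _ (by lia))
    · exact Or.inl (hB _ hi)
  refine ⟨Z, c.isExact, ?_, fun V hV => ?_, fun V hV => ?_, ?_⟩
  · rintro ((_ | n) | n)
    · exact h4.symm ▸ hM
    · exact (h5 n).symm ▸ h0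
    · exact (h3 n).symm ▸ hX n
  · refine c.homFromExact_of_lift fun i k => ?_
    rcases hsub i with h | h
    · exact ⟨0, LinearMap.ext fun x => Subsingleton.elim _ _⟩
    · have hb : Function.Bijective (c.π i) := ⟨(injective_iff_map_eq_zero _).2 fun x hx => by
        obtain ⟨y, rfl⟩ := ((c.ses i).exact x).1 hx
        rw [Subsingleton.elim y 0, map_zero], (c.ses i).surj⟩
      exact ⟨(LinearEquiv.ofBijective _ hb).symm.toLinearMap ∘ₗ k, LinearMap.ext fun x =>
        (LinearEquiv.ofBijective _ hb).apply_symm_apply _⟩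
  · refine c.homToExact_of_extend fun i k => ?_
    rcases hsub i with h | h
    · have hb : Function.Bijective (c.ι (i + 1)) := ⟨c.ι_injective _, fun x =>
        ((c.ses i).exact x).1 (Subsingleton.elim _ _)⟩
      refine ⟨k ∘ₗ (LinearEquiv.ofBijective _ hb).symm.toLinearMap, LinearMap.ext fun x => ?_⟩
      exact congrArg k ((LinearEquiv.ofBijective _ hb).symm_apply_apply x)
    · exact ⟨0, LinearMap.ext fun x => by simp [Subsingleton.elim x 0]⟩
  · rw [c.isCokerOfD1_iff, show c.B (-1) = M from h1 0]
    exact ⟨LinearEquiv.refl R _⟩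

end

section
variable {R : Type u} [CommRing R]

theorem isCotorsion_iff {N : ModuleCat.{u} R} : IsCotorsion R N ↔ Cotor R N := by
  constructor
  · intro h F _ _ hF
    exact (extZero_iff (ModuleCat.of R F) N).1 (h (ModuleCat.of R F) hF)
  · intro h F hF
    exact (extZero_iff F N).2 (h F)

theorem isCCotorsion_iff {C N : ModuleCat.{u} R} : IsCCotorsion R C N ↔ CCotor R C N := by
  constructor
  · intro h F _ _ hF
    exact (extZero_iff (ModuleCat.of R (F ⊗[R] C)) N).1 (h (ModuleCat.of R F) hF)
  · intro h F hF
    exact (extZero_iff (ModuleCat.of R (F ⊗[R] C)) N).2 (h F)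

theorem isCFlatCotorsion_iff {C M : ModuleCat.{u} R} :
    IsCFlatCotorsion R C M ↔ CFlatCotor R C M :=
  exists_congr fun _ => and_congr_right fun _ => and_congr_left fun _ => isCotorsion_iff

theorem IsSemidualizing.semidual {C : ModuleCat.{u} R} (h : IsSemidualizing R C) :
    Semidual R C :=
  ⟨h.1, h.2.1, (extZero_iff C C).1 h.2.2⟩

theorem inBassClass_iff {C M : ModuleCat.{u} R} : InBassClass R C M ↔ Bass R C M := by
  have h : evalMap R C M = evalHom R C M ∘ₗ (TensorProduct.comm R C (C →ₗ[R] M)).toLinearMap :=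
    TensorProduct.ext' fun _ _ => rfl
  have hb : Function.Bijective (evalMap R C M) ↔ Function.Bijective (evalHom R C M) := by
    rw [h, LinearMap.coe_comp]
    exact Function.Bijective.of_comp_iff _ (TensorProduct.comm R C (C →ₗ[R] M)).bijective
  constructor
  · rintro ⟨h1, h2, h3⟩
    exact ⟨(extZero_iff C M).1 h1, (torZero_iff C _).1 h2, hb.1 h3⟩
  · rintro ⟨h1, h2, h3⟩
    exact ⟨(extZero_iff C M).2 h1, (torZero_iff C _).2 h2, hb.2 h3⟩

theorem gIter_succ_iff [IsNoetherianRing R] {C : ModuleCat.{u} R} (hC : Semidual R C)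
    (hdim : ringKrullDim R < ⊤) (n : ℕ) (M : ModuleCat.{u} R) :
    GIter R (n + 1) (IsCFlatCotorsion R C) M ↔ GCFlatCotor R C M := by
  have hX : IsCFlatCotorsion R C = fun X : ModuleCat.{u} R => CFlatCotor R C X :=
    funext fun _ => propext isCFlatCotorsion_iff
  induction n generalizing M with
  | zero =>
    change GClass R (IsCFlatCotorsion R C) M ↔ _
    rw [hX]
    exact ⟨GClass.gcFlatCotor hC hdim (fun _ h => h.gcFlatCotor hC) fun _ h => h,
      fun h => h.gClass hC hdim⟩
  | succ n ih =>
    change GClass R (GIter R (n + 1) (IsCFlatCotorsion R C)) M ↔ _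
    rw [show GIter R (n + 1) (IsCFlatCotorsion R C) = GCFlatCotor R C from
      funext fun X => propext (ih X)]
    exact ⟨GClass.gcFlatCotor hC hdim (fun _ h => h) fun _ h => h.gcFlatCotor hC,
      gClass_of_mem (cFlatCotor_of_subsingleton.gcFlatCotor hC)⟩

end

/-- If `R` has finite Krull dimension, then for `n ≥ 1`,
`G^n(F_C^cot(R)) = GF_C(R) ∩ B_C(R) ∩ F_C(R)^⊥`. -/
theorem stmt6 (R : Type u) [CommRing R] [IsNoetherianRing R]
    (hdim : ringKrullDim R < ⊤)
    (C : ModuleCat.{u} R) (hC : IsSemidualizing R C) (n : ℕ) (hn : 1 ≤ n)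
    (M : ModuleCat.{u} R) :
    GIter R n (IsCFlatCotorsion R C) M ↔
      (IsGCFlat R C M ∧ InBassClass R C M ∧ IsCCotorsion R C M) := by
  obtain ⟨n, rfl⟩ := Nat.exists_eq_add_of_le' hn
  rw [gIter_succ_iff hC.semidual hdim, isGCFlat_iff hC.semidual, inBassClass_iff,
    isCCotorsion_iff]
  exact ⟨fun h => ⟨h.gcFlat, h.bass, h.cCotor⟩, fun h => ⟨h.1, h.2.1, h.2.2⟩⟩
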